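/- Let d ≥ 2 be an integer and α ∈ (0, 1/6). Suppose there exist an odd prime p and a positive integer t < p with t ≤ d ≤ p, p − t < (5/(2√6) − 1)·√t, and log(t)/log(p) > 6α. Then for every ε ∈ (0, 1) there exist a constant C > 0 and infinitely many positive integers m such that for each such m there is a (d+1)-regular finite simple graph G_m on m vertices satisfying: (1) girth(G_m) ≥ 2α·log_{2d-1}(m); (2) the adjacency matrix A(G_m) has ⌊α·log_d(m)⌋ distinct eigenvalues, each admitting a (k, ε)-localized eigenvector for some k ≤ C·m^α; and (3) λ(G_m) ≤ (3/√2)·√d. -/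

import Mathlib

open Classical

set_option linter.unusedSectionVars false

noncomputable section

namespace Formal

variable {V : Type*} [Fintype V] [DecidableEq V]

/-- The real adjacency matrix of a finite simple graph. -/
def adjMat (G : SimpleGraph V) : Matrix V V ℝ :=
  letI := Classical.decRel G.Adj
  SimpleGraph.adjMatrix ℝ G

lemma adjMat_isHermitian (G : SimpleGraph V) : (adjMat G).IsHermitian := by
  letI := Classical.decRel G.Adj
  unfold adjMat
  rw [Matrix.IsHermitian, Matrix.conjTranspose_eq_transpose_of_trivial]
  exact SimpleGraph.isSymm_adjMatrix G

/-- `G` is `k`-regular: every vertex has exactly `k` neighbours. -/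
def IsRegular (G : SimpleGraph V) (k : ℕ) : Prop :=
  ∀ v : V, (G.neighborSet v).ncard = k

/-- The eigenvalues (with multiplicity) of the adjacency matrix, indexed by vertices. -/
def eigs (G : SimpleGraph V) : V → ℝ :=
  (adjMat_isHermitian G).eigenvalues

/-- The absolute values of the adjacency eigenvalues, sorted in increasing order. -/
def sortedAbsEigs (G : SimpleGraph V) : List ℝ :=
  (Finset.univ.val.map fun i => |eigs G i|).sort (· ≤ ·)

/-- `λ(G)`: the second largest absolute value of an eigenvalue (with multiplicity). -/
def secondLargestAbsEig (G : SimpleGraph V) : ℝ :=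
  (sortedAbsEigs G).getD (Fintype.card V - 2) 0

/-- `λ₃(G)`: the third largest absolute value of an eigenvalue (with multiplicity). -/
def thirdLargestAbsEig (G : SimpleGraph V) : ℝ :=
  (sortedAbsEigs G).getD (Fintype.card V - 3) 0

/-- `μ` has a `(k, ε)`-localized (ℓ²-normalized) eigenvector for `A(G)`. -/
def HasLocalizedEigenvector (G : SimpleGraph V) (μ : ℝ) (k : ℕ) (ε : ℝ) : Prop :=
  ∃ v : V → ℝ, (adjMat G).mulVec v = μ • v ∧ (∑ x, (v x) ^ 2) = 1 ∧
    ∃ S : Finset V, S.card = k ∧ ε ≤ ∑ x ∈ S, (v x) ^ 2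

/-- There are `r` distinct eigenvalues of `A(G)`, each with a `(k, ε)`-localized
eigenvector for some `k ≤ bound`. -/
def LocalizedSpectrum (G : SimpleGraph V) (r : ℕ) (ε bound : ℝ) : Prop :=
  ∃ Λ : Finset ℝ, Λ.card = r ∧
    ∀ μ ∈ Λ, ∃ k : ℕ, (k : ℝ) ≤ bound ∧ HasLocalizedEigenvector G μ k ε

/-- `girth(G) ≥ x` for a real number `x` (`girth = ⊤` counts as `≥ x`). -/
def girthGe {W : Type*} (G : SimpleGraph W) (x : ℝ) : Prop :=
  ∀ g : ℕ, G.girth = g → x ≤ g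

/-- `girth(G) > x` for a real number `x` (`girth = ⊤` counts as `> x`). -/
def girthGt {W : Type*} (G : SimpleGraph W) (x : ℝ) : Prop :=
  ∀ g : ℕ, G.girth = g → x < g

/-- The `j`-th prime, so `nthPrime 1 = 2`, `nthPrime 2 = 3`, ..., `nthPrime 10 = 29`. -/
def nthPrime (j : ℕ) : ℕ :=
  Nat.nth Nat.Prime (j - 1)

open Finset in
/-- Reduced words of length `n + 1` over `Fin D` with first letter `i` and last letter `j`. -/
def redWords (D : ℕ) : ℕ → Fin D → Fin D → Finset (List (Fin D))
  | 0, i, j => if i = j then {[i]} else ∅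
  | n + 1, i, j => ((univ.erase i).biUnion fun a => redWords D n a j).image (List.cons i)

section Words

variable {D : ℕ}

lemma head_of_mem_redWords {n : ℕ} {i j : Fin D} {w : List (Fin D)} (h : w ∈ redWords D n i j) :
    ∃ u, w = i :: u := by
  cases n with
  | zero =>
    unfold redWords at h
    split_ifs at h
    · exact ⟨[], by simpa using h⟩
    · simp at h
  | succ n =>
    simp only [redWords, Finset.mem_image] at h
    obtain ⟨u, -, rfl⟩ := h
    exact ⟨u, rfl⟩

lemma sum_redWords_succ {M : Type*} [AddCommMonoid M] (n : ℕ) (i j : Fin D)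
    (F : List (Fin D) → M) :
    ∑ w ∈ redWords D (n + 1) i j, F w =
      ∑ a ∈ Finset.univ.erase i, ∑ w ∈ redWords D n a j, F (i :: w) := by
  rw [redWords, Finset.sum_image (fun _ _ _ _ h => (List.cons.inj h).2), Finset.sum_biUnion]
  intro a _ b _ hab
  refine Finset.disjoint_left.2 fun w hw hw' => hab ?_
  obtain ⟨u, rfl⟩ := head_of_mem_redWords hw
  obtain ⟨u', hu⟩ := head_of_mem_redWords hw'
  exact (List.cons.inj hu).1

lemma sum_redWords_zero {M : Type*} [AddCommMonoid M] (i j : Fin D) (F : List (Fin D) → M) :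
    ∑ w ∈ redWords D 0 i j, F w = if i = j then F [i] else 0 := by
  rw [redWords]; split_ifs <;> simp

lemma mem_redWords_iff {n : ℕ} {i j : Fin D} {w : List (Fin D)} :
    w ∈ redWords D n i j ↔ w.length = n + 1 ∧ w.IsChain (· ≠ ·) ∧ w.head? = some i ∧
      w.getLast? = some j := by
  induction n generalizing i w with
  | zero =>
    rw [redWords]
    rcases w with _ | ⟨a, _ | ⟨b, w⟩⟩
    · split_ifs <;> simp
    · split_ifs <;> simp <;> grind
    · split_ifs <;> simp
  | succ n ih =>
    simp only [redWords, Finset.mem_image, Finset.mem_biUnion, Finset.mem_erase, Finset.mem_univ,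
      and_true]
    rcases w with _ | ⟨a, _ | ⟨b, w⟩⟩
    · simp
    · simp only [ih]
      constructor
      · rintro ⟨u, ⟨a, ha, h⟩, hu⟩
        simp only [List.cons.injEq] at hu
        simp [hu.2] at h
      · simp
    · simp only [ih]
      constructor
      · rintro ⟨u, ⟨a', ha, h⟩, hu⟩
        simp only [List.cons.injEq] at hu
        obtain ⟨rfl, rfl⟩ := hu
        simp only [List.length_cons, List.isChain_cons_cons, List.head?_cons,
          List.getLast?_cons_cons, Option.some.injEq] at h ⊢
        refine ⟨by omega, ⟨?_, h.2.1⟩, trivial, h.2.2.2⟩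
        rw [h.2.2.1]; exact ha.symm
      · rintro ⟨h1, h2, h3, h4⟩
        simp only [List.length_cons, List.isChain_cons_cons, List.head?_cons,
          List.getLast?_cons_cons, Option.some.injEq] at h1 h2 h3 h4
        refine ⟨b :: w, ⟨b, ?_, by simpa using by omega, h2.2, rfl, h4⟩, by rw [h3]⟩
        rw [← h3]; exact h2.1.symm

lemma sum_card_redWords (d n : ℕ) (i : Fin (d + 1)) :
    ∑ j, (redWords (d + 1) n i j).card = d ^ n := by
  induction n generalizing i with
  | zero =>
    simp only [Finset.card_eq_sum_ones, sum_redWords_zero]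
    simp
  | succ n ih =>
    simp only [Finset.card_eq_sum_ones, sum_redWords_succ] at ih ⊢
    rw [Finset.sum_comm, Finset.sum_congr rfl fun a _ => ih a]
    simp [pow_succ, mul_comm]

end Words

section TraceIdentity

variable {A : Type*} [Ring A] [Algebra ℝ A] {d : ℕ} (P : Fin (d + 1) → A)

/-- The sum over reduced words with given length and ends of the corresponding products. -/
def wordSum (n : ℕ) (i j : Fin (d + 1)) : A :=
  ∑ w ∈ redWords (d + 1) n i j, (w.map P).prod

lemma wordSum_succ (n : ℕ) (i j : Fin (d + 1)) :
    wordSum P (n + 1) i j = P i * ∑ a ∈ Finset.univ.erase i, wordSum P n a j := by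
  simp only [wordSum, sum_redWords_succ, Finset.mul_sum, List.map_cons, List.prod_cons]

lemma wordSum_zero (i j : Fin (d + 1)) : wordSum P 0 i j = if i = j then P i else 0 := by
  simp [wordSum, sum_redWords_zero]

lemma wordSum_succ_right (n : ℕ) (i j : Fin (d + 1)) :
    wordSum P (n + 1) i j = (∑ b ∈ Finset.univ.erase j, wordSum P n i b) * P j := by
  induction n generalizing i with
  | zero =>
    rw [wordSum_succ]
    simp only [wordSum_zero, Finset.sum_ite_eq, Finset.sum_ite_eq', Finset.mem_erase,
      Finset.mem_univ, and_true]
    by_cases h : i = j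
    · simp [h]
    · simp [h, Ne.symm h]
  | succ n ih =>
    rw [wordSum_succ, Finset.sum_congr rfl fun a _ => ih a, ← Finset.sum_mul, Finset.sum_comm,
      ← mul_assoc, Finset.mul_sum]
    simp only [wordSum_succ]

/-- The sum over all reduced words of length `n + 1`. -/
def redSum (n : ℕ) : A := ∑ i, ∑ j, wordSum P n i j

lemma redSum_zero : redSum P 0 = ∑ i, P i := by
  simp [redSum, wordSum_zero]

variable {P}

lemma mul_redSum (hP : ∀ i, P i * P i = 1) (n : ℕ) :
    (∑ i, P i) * redSum P (n + 1) = redSum P (n + 2) + (d : ℝ) • redSum P n := by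
  have h1 : (∑ i, P i) * redSum P (n + 1) =
      ∑ k, P k * ∑ j, (∑ i ∈ Finset.univ.erase k, wordSum P (n + 1) i j +
        wordSum P (n + 1) k j) := by
    rw [Finset.sum_mul]
    refine Finset.sum_congr rfl fun k _ => ?_
    rw [redSum, Finset.sum_comm]
    simp
  have h2 : ∀ k j, P k * wordSum P (n + 1) k j = ∑ a, wordSum P n a j - wordSum P n k j := by
    intro k j
    rw [wordSum_succ, ← mul_assoc, hP, one_mul, Finset.sum_erase_eq_sub (Finset.mem_univ k)]
  rw [h1]
  simp only [Finset.mul_sum (Finset.univ), mul_add, h2, ← wordSum_succ, Finset.sum_add_distrib,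
    Finset.sum_sub_distrib]
  rw [redSum, add_right_inj, redSum, Finset.sum_comm (f := fun x y => ∑ a, wordSum P n a y)]
  simp only [Finset.sum_const, Finset.card_univ, Fintype.card_fin, ← Finset.smul_sum]
  rw [Finset.sum_comm]
  rw [← Nat.cast_smul_eq_nsmul ℝ, Nat.cast_succ, add_smul, one_smul, add_sub_cancel_right]

lemma redSum_one (hP : ∀ i, P i * P i = 1) :
    redSum P 1 = (∑ i, P i) * (∑ i, P i) - ((d : ℝ) + 1) • (1 : A) := by
  have : ∀ k j, wordSum P 1 k j = P k * P j - if k = j then 1 else 0 := by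
    intro k j
    rw [wordSum_succ, Finset.sum_erase_eq_sub (Finset.mem_univ k)]
    simp only [wordSum_zero, Finset.sum_ite_eq', Finset.mem_univ, if_true]
    split_ifs with h
    · simp [h, hP]
    · simp
  simp only [redSum, this, Finset.sum_sub_distrib, ← Finset.mul_sum, ← Finset.sum_mul]
  simp [add_smul, ← Nat.cast_smul_eq_nsmul ℝ]

/-- Rescaled Chebyshev polynomials of the first kind: `q ℓ (2 √d cos θ) = 2 d^{ℓ/2} cos (ℓ θ)`. -/
def chebQ (d : ℕ) : ℕ → Polynomial ℝ
  | 0 => 2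
  | 1 => Polynomial.X
  | n + 2 => Polynomial.X * chebQ d (n + 1) - Polynomial.C (d : ℝ) * chebQ d n

/-- The polynomials in `∑ i, P i` giving the sums over reduced words. -/
def redPoly (d : ℕ) : ℕ → Polynomial ℝ
  | 0 => Polynomial.X
  | 1 => Polynomial.X * Polynomial.X - Polynomial.C ((d : ℝ) + 1)
  | n + 2 => Polynomial.X * redPoly d (n + 1) - Polynomial.C (d : ℝ) * redPoly d n

lemma redSum_eq_aeval (hP : ∀ i, P i * P i = 1) (n : ℕ) :
    redSum P n = Polynomial.aeval (∑ i, P i) (redPoly d n) := by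
  induction n using Nat.twoStepInduction with
  | zero => simp [redPoly, redSum_zero]
  | one => rw [redSum_one hP, redPoly, map_sub, map_mul, Polynomial.aeval_X, Polynomial.aeval_C,
      Algebra.algebraMap_eq_smul_one]
  | more n ih0 ih1 =>
    rw [redPoly, map_sub, map_mul, map_mul, Polynomial.aeval_X, ← ih0, ← ih1, mul_redSum hP,
      Polynomial.aeval_C, ← Algebra.smul_def, add_sub_cancel_right]

lemma chebQ_sub (d n : ℕ) :
    chebQ d (n + 3) - chebQ d (n + 1) = redPoly d (n + 2) - Polynomial.C (d : ℝ) * redPoly d n := by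
  induction n using Nat.twoStepInduction with
  | zero => simp only [chebQ, redPoly, map_add, map_one]; ring
  | one => simp only [chebQ, redPoly, map_add, map_one]; ring
  | more n ih0 ih1 =>
    rw [show n + 2 + 3 = n + 3 + 2 by ring, show n + 2 + 1 = n + 1 + 2 by ring, chebQ, redPoly,
      chebQ.eq_3 d (n + 1), redPoly.eq_3 d n]
    rw [show n + 1 + 3 = n + 3 + 1 by ring] at ih1
    have e' : redPoly d (n + 2) = Polynomial.X * redPoly d (n + 1) -
      Polynomial.C (d : ℝ) * redPoly d n := rfl
    have e'' : chebQ d (n + 3) = Polynomial.X * chebQ d (n + 1 + 1) -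
      Polynomial.C (d : ℝ) * chebQ d (n + 1) := rfl
    linear_combination Polynomial.X * ih1 - Polynomial.C (d : ℝ) * ih0 +
      Polynomial.C (d : ℝ) * e'' - Polynomial.C (d : ℝ) * e'

lemma aeval_chebQ_sub (hP : ∀ i, P i * P i = 1) (n : ℕ) :
    Polynomial.aeval (∑ i, P i) (chebQ d (n + 3)) - Polynomial.aeval (∑ i, P i) (chebQ d (n + 1)) =
      redSum P (n + 2) - (d : ℝ) • redSum P n := by
  rw [redSum_eq_aeval hP, redSum_eq_aeval hP, ← map_sub, chebQ_sub, map_sub, map_mul,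
    Polynomial.aeval_C, ← Algebra.smul_def]

/-- The cyclically reduced words of length `n + 1`, summed. -/
def cycSum {M : Type*} [AddCommMonoid M] (d n : ℕ) (F : List (Fin (d + 1)) → M) : M :=
  ∑ i, ∑ j ∈ Finset.univ.erase i, ∑ w ∈ redWords (d + 1) n i j, F w

variable {tr : A →ₗ[ℝ] ℝ}

lemma trace_redSum (n : ℕ) :
    tr (redSum P n) = cycSum d n (fun w => tr (w.map P).prod) + ∑ i, tr (wordSum P n i i) := by
  rw [redSum, map_sum, cycSum, ← Finset.sum_add_distrib]
  refine Finset.sum_congr rfl fun i _ => ?_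
  rw [map_sum, ← Finset.sum_erase_add _ _ (Finset.mem_univ i)]
  simp [wordSum, map_sum]

lemma sum_trace_wordSum_add_two (hP : ∀ i, P i * P i = 1) (htr : ∀ a b, tr (a * b) = tr (b * a))
    (n : ℕ) : ∑ i, tr (wordSum P (n + 2) i i) =
      ((d : ℝ) - 1) * tr (redSum P n) + ∑ i, tr (wordSum P n i i) := by
  have h : ∀ i, tr (wordSum P (n + 2) i i) = tr (redSum P n) - ∑ b, tr (wordSum P n i b)
      - ∑ a, tr (wordSum P n a i) + tr (wordSum P n i i) := by
    intro i
    rw [wordSum_succ, Finset.sum_congr rfl fun a _ => wordSum_succ_right P n a i,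
      ← Finset.sum_mul, htr, mul_assoc, hP, mul_one, Finset.sum_congr rfl fun a _ =>
      Finset.sum_erase_eq_sub (f := wordSum P n a) (Finset.mem_univ i),
      Finset.sum_erase_eq_sub (Finset.mem_univ i), Finset.sum_sub_distrib]
    simp only [map_sub, map_sum, redSum]
    ring
  rw [Finset.sum_congr rfl fun i _ => h i]
  simp only [Finset.sum_add_distrib, Finset.sum_sub_distrib]
  rw [Finset.sum_comm (f := fun i a => tr (wordSum P n a i))]
  have : ∑ i, ∑ b, tr (wordSum P n i b) = tr (redSum P n) := by simp [redSum]
  rw [this]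
  simp
  ring

theorem trace_chebQ (hP : ∀ i, P i * P i = 1) (htr : ∀ a b, tr (a * b) = tr (b * a)) (n : ℕ) :
    tr (Polynomial.aeval (∑ i, P i) (chebQ d (n + 1))) =
      cycSum d n (fun w => tr (w.map P).prod) +
        if Even n then tr (∑ i, P i) else -((d : ℝ) - 1) * tr 1 := by
  induction n using Nat.twoStepInduction with
  | zero =>
    have : cycSum d 0 (fun w => tr (w.map P).prod) = 0 := by
      refine Finset.sum_eq_zero fun i _ => Finset.sum_eq_zero fun j hj => ?_
      rw [sum_redWords_zero, if_neg (Finset.ne_of_mem_erase hj).symm]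
    simp [this, chebQ]
  | one =>
    have h := trace_redSum (P := P) (tr := tr) 1
    rw [redSum_one hP] at h
    have h0 : ∑ i, tr (wordSum P 1 i i) = 0 := by
      refine Finset.sum_eq_zero fun i _ => ?_
      rw [wordSum_succ, Finset.sum_eq_zero, mul_zero, map_zero]
      intro a ha
      rw [wordSum_zero, if_neg (Finset.ne_of_mem_erase ha)]
    rw [h0, add_zero, map_sub, map_smul, smul_eq_mul] at h
    rw [← h, if_neg (by decide)]
    simp only [chebQ, map_sub, map_mul, Polynomial.aeval_X, Polynomial.aeval_C, map_ofNat,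
      Algebra.algebraMap_eq_smul_one, smul_mul_assoc, one_mul]
    rw [map_smul, ← one_add_one_eq_two, map_add, smul_eq_mul]
    ring
  | more n ih _ =>
    have h := congrArg tr (aeval_chebQ_sub hP n)
    rw [map_sub, map_sub, map_smul, trace_redSum (n + 2), sum_trace_wordSum_add_two hP htr,
      smul_eq_mul] at h
    have h2 := trace_redSum (P := P) (tr := tr) n
    have h3 : (Even (n + 2) ↔ Even n) := by simp [Nat.even_add]
    rw [show n + 2 + 1 = n + 3 by ring]
    simp only [h3]
    linarith

end TraceIdentity

section Matchings

/-- A partially revealed family of matchings, with labels in `Fin D`. -/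
abbrev PState (D : ℕ) (U : Type*) := Fin D → U → Option U

/-- The state is symmetric and loopless. -/
def PState.WF {D : ℕ} {U : Type*} (μ : PState D U) : Prop :=
  ∀ i x y, μ i x = some y → μ i y = some x ∧ x ≠ y

/-- Reveal the pair `x y` with label `i`. -/
def PState.extend {D : ℕ} {U : Type*} (μ : PState D U) (i : Fin D) (x y : U) : PState D U :=
  fun j z => if j = i ∧ z = x then some y else if j = i ∧ z = y then some x else μ j z

lemma PState.WF.extend {D : ℕ} {U : Type*} {μ : PState D U} (h : μ.WF) {i : Fin D} {x y : U}
    (hx : μ i x = none) (hy : μ i y = none) (hxy : x ≠ y) : (μ.extend i x y).WF := by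
  intro j a b hab
  simp only [PState.extend] at hab ⊢
  have := h j a b
  have h2 := h j b a
  split_ifs at hab ⊢ <;> grind

variable {D : ℕ} {U : Type*} [Fintype U]

/-- Families of `D` perfect matchings on `U`, as fixed-point-free involutions. -/
def matchings (D : ℕ) (U : Type*) [Fintype U] : Finset (Fin D → U → U) :=
  Finset.univ.filter fun σ => ∀ i x, σ i (σ i x) = x ∧ σ i x ≠ x

/-- The families of matchings compatible with a partial state. -/
def cyl (μ : PState D U) : Finset (Fin D → U → U) :=
  (matchings D U).filter fun σ => ∀ i x y, μ i x = some y → σ i x = y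

lemma mem_matchings {σ : Fin D → U → U} :
    σ ∈ matchings D U ↔ ∀ i x, σ i (σ i x) = x ∧ σ i x ≠ x := by
  simp [matchings]

lemma mem_cyl {μ : PState D U} {σ : Fin D → U → U} :
    σ ∈ cyl μ ↔ σ ∈ matchings D U ∧ ∀ i x y, μ i x = some y → σ i x = y := by
  simp [cyl]

/-- The possible values of `σ i x` for `σ` compatible with `μ`. -/
def allowed (μ : PState D U) (i : Fin D) (x : U) : Finset U :=
  Finset.univ.filter fun z => z ≠ x ∧ μ i z = none

/-- The vertices matched by label `i`. -/
def dom (μ : PState D U) (i : Fin D) : Finset U :=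
  Finset.univ.filter fun z => μ i z ≠ none

lemma mem_allowed {μ : PState D U} {i : Fin D} {x z : U} :
    z ∈ allowed μ i x ↔ z ≠ x ∧ μ i z = none := by simp [allowed]

lemma mem_dom {μ : PState D U} {i : Fin D} {z : U} : z ∈ dom μ i ↔ μ i z ≠ none := by
  simp [dom]

lemma card_allowed_add {μ : PState D U} {i : Fin D} {x : U} (hx : μ i x = none) :
    (allowed μ i x).card + (dom μ i).card + 1 = Fintype.card U := by
  have h : (Finset.univ : Finset U) = insert x (allowed μ i x ∪ dom μ i) := by
    ext z
    simp only [Finset.mem_univ, Finset.mem_insert, Finset.mem_union, mem_allowed, mem_dom, true_iff]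
    tauto
  have hx' : x ∉ allowed μ i x ∪ dom μ i := by simp [mem_allowed, mem_dom, hx]
  rw [← Finset.card_univ, h, Finset.card_insert_of_notMem hx', Finset.card_union_of_disjoint]
  refine Finset.disjoint_left.2 fun z hz hz' => ?_
  exact (mem_dom.1 hz') (mem_allowed.1 hz).2

lemma card_dom_extend {μ : PState D U} {i : Fin D} {x y : U}
    (hx : μ i x = none) (hy : μ i y = none) (hxy : x ≠ y) (j : Fin D) :
    (dom (μ.extend i x y) j).card = (dom μ j).card + if j = i then 2 else 0 := by
  split_ifs with h
  · subst h
    have : dom (μ.extend j x y) j = insert x (insert y (dom μ j)) := by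
      ext z
      simp only [mem_dom, Finset.mem_insert, PState.extend]
      by_cases h1 : z = x <;> by_cases h2 : z = y <;> simp [h1, h2, hxy.symm]
    rw [this, Finset.card_insert_of_notMem, Finset.card_insert_of_notMem]
    · simp [mem_dom, hy]
    · simp [mem_dom, hx, hxy]
  · congr 1
    ext z
    simp [mem_dom, PState.extend, h]

lemma apply_mem_allowed {μ : PState D U} (hμ : μ.WF) {i : Fin D} {x : U} (hx : μ i x = none)
    {σ : Fin D → U → U} (hσ : σ ∈ cyl μ) : σ i x ∈ allowed μ i x := by
  rw [mem_cyl, mem_matchings] at hσ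
  rw [mem_allowed]
  refine ⟨(hσ.1 i x).2, ?_⟩
  by_contra hne
  obtain ⟨y, hy⟩ := Option.ne_none_iff_exists'.1 hne
  have h1 := hσ.2 i _ _ hy
  rw [(hσ.1 i x).1] at h1
  have := (hμ i _ _ hy).1
  rw [← h1, hx] at this
  simp at this

lemma cyl_extend {μ : PState D U} {i : Fin D} {x z : U} (hx : μ i x = none)
    (hz : z ∈ allowed μ i x) : cyl (μ.extend i x z) = (cyl μ).filter fun σ => σ i x = z := by
  rw [mem_allowed] at hz
  ext σ
  simp only [Finset.mem_filter, mem_cyl, PState.extend]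
  constructor
  · rintro ⟨h1, h2⟩
    refine ⟨⟨h1, fun j a b hab => h2 j a b ?_⟩, h2 i x z (by simp)⟩
    rw [if_neg, if_neg, hab]
    · rintro ⟨rfl, rfl⟩; rw [hz.2] at hab; simp at hab
    · rintro ⟨rfl, rfl⟩; rw [hx] at hab; simp at hab
  · rintro ⟨⟨h1, h2⟩, h3⟩
    refine ⟨h1, fun j a b hab => ?_⟩
    split_ifs at hab with h4 h5
    · simp only [Option.some.injEq] at hab
      rw [h4.1, h4.2, h3, hab]
    · simp only [Option.some.injEq] at hab
      rw [h5.1, h5.2, ← h3, (mem_matchings.1 h1 i x).1, hab]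
    · exact h2 j a b hab

lemma card_cyl_extend_le {μ : PState D U} (hμ : μ.WF) {i : Fin D} {x z z' : U} (hx : μ i x = none)
    (hz : z ∈ allowed μ i x) (hz' : z' ∈ allowed μ i x) :
    (cyl (μ.extend i x z)).card ≤ (cyl (μ.extend i x z')).card := by
  rw [cyl_extend hx hz, cyl_extend hx hz']
  rw [mem_allowed] at hz hz'
  set s := Equiv.swap z z' with hs
  have hss : ∀ u, s (s u) = u := fun u => Equiv.swap_apply_self z z' u
  refine Finset.card_le_card_of_injOn
    (fun σ => Function.update σ i fun u => s (σ i (s u))) ?_ ?_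
  · intro σ hσ
    simp only [Finset.coe_filter, Set.mem_ofPred_eq, mem_cyl, mem_matchings] at hσ ⊢
    obtain ⟨⟨h1, h2⟩, h3⟩ := hσ
    refine ⟨⟨fun j a => ?_, fun j a b hab => ?_⟩, ?_⟩
    · by_cases hj : j = i
      · subst hj
        simp only [Function.update_self, hss, (h1 j _).1, true_and]
        intro h
        have := congrArg s h
        rw [hss] at this
        exact (h1 j (s a)).2 this
      · simpa [Function.update_of_ne hj] using h1 j a
    · by_cases hj : j = i
      · subst hj
        have key : ∀ {a b}, μ j a = some b → s a = a := by
          intro a b hab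
          rw [hs, Equiv.swap_apply_of_ne_of_ne]
          · rintro rfl; rw [hz.2] at hab; simp at hab
          · rintro rfl; rw [hz'.2] at hab; simp at hab
        simp only [Function.update_self]
        rw [key hab, h2 j a b hab, key (hμ j a b hab).1]
      · simpa [Function.update_of_ne hj] using h2 j a b hab
    · simp only [Function.update_self]
      rw [hs, Equiv.swap_apply_of_ne_of_ne hz.1.symm hz'.1.symm, h3, Equiv.swap_apply_left]
  · intro σ _ τ _ h
    funext j u
    have h' := congrFun (congrFun h j)
    by_cases hj : j = i
    · subst hj
      have := h' (s u)
      simp only [Function.update_self, hss] at this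
      exact s.injective this
    · have := h' u
      simpa [Function.update_of_ne hj] using this

/-- Revealing one more pair: every allowed value is equally likely. -/
theorem card_cyl_extend_mul {μ : PState D U} (hμ : μ.WF) {i : Fin D} {x z : U} (hx : μ i x = none)
    (hz : z ∈ allowed μ i x) :
    (cyl (μ.extend i x z)).card * (allowed μ i x).card = (cyl μ).card := by
  rw [Finset.card_eq_sum_card_fiberwise (f := fun σ => σ i x) (t := allowed μ i x)
    fun σ hσ => apply_mem_allowed hμ hx hσ, mul_comm, ← smul_eq_mul, ← Finset.sum_const]
  refine Finset.sum_congr rfl fun z' hz' => ?_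
  rw [← cyl_extend hx hz']
  exact le_antisymm (card_cyl_extend_le hμ hx hz hz') (card_cyl_extend_le hμ hx hz' hz)

/-- Splitting a count over the compatible matchings according to the value of `σ i x`. -/
lemma card_filter_cyl {μ : PState D U} (hμ : μ.WF) {i : Fin D} {x : U} (hx : μ i x = none)
    (p : (Fin D → U → U) → Prop) :
    ((cyl μ).filter p).card = ∑ z ∈ allowed μ i x, ((cyl (μ.extend i x z)).filter p).card := by
  rw [Finset.card_eq_sum_card_fiberwise (f := fun σ => σ i x) (t := allowed μ i x)]
  · refine Finset.sum_congr rfl fun z hz => ?_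
    rw [cyl_extend hx hz, Finset.filter_filter, Finset.filter_filter]
    congr 1
    ext σ
    simp only [Finset.mem_filter]
    tauto
  · intro σ hσ
    exact apply_mem_allowed hμ hx (Finset.mem_filter.1 hσ).1

/-- The state in which nothing is revealed. -/
def emptyState (D : ℕ) (U : Type*) : PState D U := fun _ _ => none

lemma emptyState_wf (D : ℕ) (U : Type*) : (emptyState D U).WF := by
  intro i x y h; simp [emptyState] at h

lemma cyl_emptyState : cyl (emptyState D U) = matchings D U := by
  ext σ; simp [mem_cyl, emptyState]

lemma matchings_nonempty (D k : ℕ) : (matchings D (Fin k × Bool)).Nonempty :=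
  ⟨fun _ x => (x.1, !x.2), by
    rw [mem_matchings]
    rintro _ ⟨a, b⟩
    cases b <;> simp⟩

end Matchings

section ExactCount

open Polynomial

/-- Follow the word `w` from `x`. -/
def run {D : ℕ} {U : Type*} (σ : Fin D → U → U) : List (Fin D) → U → U
  | [], x => x
  | i :: w, x => run σ w (σ i x)

variable {D : ℕ}

/-- Increase the counter of label `i`. -/
def bump (e : Fin D → ℕ) (i : Fin D) : Fin D → ℕ := Function.update e i (e i + 1)

/-- Common denominator of the probabilities of revealing up to `Q` pairs of each label. -/
def den (Q : ℕ) (e : Fin D → ℕ) : ℝ[X] :=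
  ∏ i, ∏ j ∈ Finset.Ico (e i) Q, (1 - C (2 * (j : ℝ) + 1) * X)

/-- The numerator polynomial (in `1 / N`) of the probability that following the given word from
`c` ends in `0`, when the vertices `0, …, v - 1` and the pairs in `m` have been revealed. -/
def pol (Q : ℕ) : List (Fin D) → ℕ → PState D ℕ → (Fin D → ℕ) → ℕ → ℝ[X]
  | [], _, _, e, c => if c = 0 then den Q e else 0
  | i :: w, v, m, e, c =>
    match m i c with
    | some y => pol Q w v m e y
    | none =>
      X * ∑ y ∈ (Finset.range v).filter (fun y => y ≠ c ∧ m i y = none),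
        pol Q w v (m.extend i c y) (bump e i) y +
      (1 - C (v : ℝ) * X) * pol Q w (v + 1) (m.extend i c v) (bump e i) v

lemma den_eq_mul {Q : ℕ} {e : Fin D → ℕ} {i : Fin D} (h : e i < Q) :
    den Q e = (1 - C (2 * (e i : ℝ) + 1) * X) * den Q (bump e i) := by
  unfold den
  rw [← Finset.mul_prod_erase _ _ (Finset.mem_univ i),
    ← Finset.mul_prod_erase _ _ (Finset.mem_univ i), ← mul_assoc,
    Finset.prod_eq_prod_Ico_succ_bot h]
  congr 1
  · simp [bump]
  · refine Finset.prod_congr rfl fun j hj => ?_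
    rw [bump, Function.update_of_ne (Finset.ne_of_mem_erase hj)]

variable {U : Type*} [Fintype U]

/-- `μ` is the image of the abstract state `(v, m, e)` under the embedding `ι`. -/
structure Compat (ι : ℕ → U) (v : ℕ) (m : PState D ℕ) (e : Fin D → ℕ) (μ : PState D U) :
    Prop where
  inj : ∀ x y, x < v → y < v → ι x = ι y → x = y
  map : ∀ j x, x < v → μ j (ι x) = (m j x).map ι
  off : ∀ j u, (∀ x, x < v → ι x ≠ u) → μ j u = none
  lt : ∀ j x y, m j x = some y → x < v ∧ y < v
  card : ∀ j, (dom μ j).card = 2 * e j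
  wf : μ.WF

lemma Compat.extend_old {ι : ℕ → U} {v : ℕ} {m : PState D ℕ} {e : Fin D → ℕ} {μ : PState D U}
    (h : Compat ι v m e μ) {i : Fin D} {c y : ℕ} (hc : c < v) (hy : y < v) (hyc : y ≠ c)
    (mc : m i c = none) (my : m i y = none) :
    Compat ι v (m.extend i c y) (bump e i) (μ.extend i (ι c) (ι y)) := by
  have hc' : μ i (ι c) = none := by rw [h.map i c hc, mc]; rfl
  have hy' : μ i (ι y) = none := by rw [h.map i y hy, my]; rfl
  have hne : ι c ≠ ι y := fun H => hyc (h.inj _ _ hc hy H).symm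
  refine ⟨h.inj, fun j x hx => ?_, fun j u hu => ?_, fun j a b hab => ?_, fun j => ?_,
    h.wf.extend hc' hy' hne⟩
  · have e1 : ι x = ι c ↔ x = c := ⟨h.inj _ _ hx hc, fun H => by rw [H]⟩
    have e2 : ι x = ι y ↔ x = y := ⟨h.inj _ _ hx hy, fun H => by rw [H]⟩
    simp only [PState.extend, e1, e2, h.map j x hx]
    split_ifs <;> rfl
  · simp only [PState.extend]
    rw [if_neg fun H => hu c hc H.2.symm, if_neg fun H => hu y hy H.2.symm, h.off j u hu]
  · simp only [PState.extend] at hab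
    split_ifs at hab with h1 h2
    · simp only [Option.some.injEq] at hab; omega
    · simp only [Option.some.injEq] at hab; omega
    · exact h.lt j a b hab
  · rw [card_dom_extend hc' hy' hne, h.card, bump]
    by_cases hj : j = i
    · subst hj; simp; ring
    · simp [hj]

lemma Compat.extend_new {ι : ℕ → U} {v : ℕ} {m : PState D ℕ} {e : Fin D → ℕ} {μ : PState D U}
    (h : Compat ι v m e μ) {i : Fin D} {c : ℕ} {z : U} (hc : c < v) (hz : ∀ x, x < v → ι x ≠ z)
    (mc : m i c = none) :
    Compat (Function.update ι v z) (v + 1) (m.extend i c v) (bump e i) (μ.extend i (ι c) z) := by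
  have hc' : μ i (ι c) = none := by rw [h.map i c hc, mc]; rfl
  have hz' : μ i z = none := h.off i z hz
  have hne : ι c ≠ z := hz c hc
  have hup : ∀ x, x < v → Function.update ι v z x = ι x := fun x hx =>
    Function.update_of_ne (by omega) _ _
  have hmv : ∀ j, m j v = none := by
    intro j
    by_contra hn
    obtain ⟨b, hb⟩ := Option.ne_none_iff_exists'.1 hn
    exact absurd (h.lt j v b hb).1 (by omega)
  refine ⟨fun x y hx hy hxy => ?_, fun j x hx => ?_, fun j u hu => ?_, fun j a b hab => ?_,
    fun j => ?_, h.wf.extend hc' hz' hne⟩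
  · rcases Nat.lt_succ_iff_lt_or_eq.1 hx with hx | rfl <;>
      rcases Nat.lt_succ_iff_lt_or_eq.1 hy with hy | rfl
    · rw [hup x hx, hup y hy] at hxy; exact h.inj x y hx hy hxy
    · rw [hup x hx, Function.update_self] at hxy; exact absurd hxy (hz x hx)
    · rw [hup y hy, Function.update_self] at hxy; exact absurd hxy.symm (hz y hy)
    · rfl
  · rcases Nat.lt_succ_iff_lt_or_eq.1 hx with hx | rfl
    · have e1 : ι x = ι c ↔ x = c := ⟨h.inj _ _ hx hc, fun H => by rw [H]⟩
      have e2 : ¬ (ι x = z) := hz x hx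
      have e3 : ¬ (x = v) := by omega
      rw [hup x hx]
      simp only [PState.extend, e1, e2, e3, and_false, if_false, h.map j x hx]
      split_ifs
      · simp
      · cases hm : m j x with
        | none => rfl
        | some b => simp [hup b (h.lt j x b hm).2]
    · have e3 : ¬ (x = c) := by omega
      have e4 : ¬ (z = ι c) := fun H => hne H.symm
      simp only [PState.extend, Function.update_self, e3, e4, and_false, if_false, and_true]
      rw [h.off j z hz, hmv]
      split_ifs
      · simp [hup c hc]
      · rfl
  · have h1 : ι c ≠ u := by have := hu c (by omega); rwa [hup c hc] at this
    have h2 : z ≠ u := by have := hu v (by omega); rwa [Function.update_self] at this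
    simp only [PState.extend]
    rw [if_neg fun H => h1 H.2.symm, if_neg fun H => h2 H.2.symm]
    refine h.off j u fun x hx => ?_
    have := hu x (by omega); rwa [hup x hx] at this
  · simp only [PState.extend] at hab
    split_ifs at hab with h1 h2
    · simp only [Option.some.injEq] at hab; omega
    · simp only [Option.some.injEq] at hab; omega
    · have := h.lt j a b hab; omega
  · rw [card_dom_extend hc' hz' hne, h.card, bump]
    by_cases hj : j = i
    · subst hj; simp; ring
    · simp [hj]

lemma allowed_eq {ι : ℕ → U} {v : ℕ} {m : PState D ℕ} {e : Fin D → ℕ} {μ : PState D U}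
    (h : Compat ι v m e μ) {i : Fin D} {c : ℕ} (hc : c < v) :
    allowed μ i (ι c) = ((Finset.range v).filter (fun y => y ≠ c ∧ m i y = none)).image ι ∪
      (Finset.univ \ (Finset.range v).image ι) := by
  ext z
  simp only [mem_allowed, Finset.mem_union, Finset.mem_image, Finset.mem_filter, Finset.mem_range,
    Finset.mem_sdiff, Finset.mem_univ, true_and]
  by_cases hz : ∃ x, x < v ∧ ι x = z
  · obtain ⟨x, hx, rfl⟩ := hz
    have e1 : ι x = ι c ↔ x = c := ⟨h.inj _ _ hx hc, fun H => by rw [H]⟩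
    rw [h.map i x hx, Option.map_eq_none_iff, Ne, e1]
    constructor
    · intro H; exact Or.inl ⟨x, ⟨hx, H⟩, rfl⟩
    · rintro (⟨y, ⟨hy, H⟩, hyx⟩ | H)
      · rw [← h.inj y x hy hx hyx]; exact H
      · exact absurd ⟨x, hx, rfl⟩ H
  · constructor
    · intro; exact Or.inr hz
    · intro _
      exact ⟨fun H => hz ⟨c, hc, H.symm⟩, h.off i z fun x hx H => hz ⟨x, hx, H⟩⟩

/-- The probability that following `w` ends in `ι 0` is a quotient of explicit polynomials
evaluated at `1 / N`. -/
theorem card_run_mul_den (Q : ℕ) (w : List (Fin D)) {ι : ℕ → U} {v : ℕ} {m : PState D ℕ}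
    {e : Fin D → ℕ} {μ : PState D U} (h : Compat ι v m e μ) {c : ℕ} (hc : c < v)
    (hQ : ∀ i, e i + w.length ≤ Q) :
    (((cyl μ).filter fun σ => run σ w (ι c) = ι 0).card : ℝ) *
        (den Q e).eval ((Fintype.card U : ℝ)⁻¹) =
      (pol Q w v m e c).eval ((Fintype.card U : ℝ)⁻¹) * ((cyl μ).card : ℝ) := by
  have hN : (Fintype.card U : ℝ) ≠ 0 := by
    have : 0 < Fintype.card U := Fintype.card_pos_iff.2 ⟨ι 0⟩
    positivity
  set x : ℝ := (Fintype.card U : ℝ)⁻¹ with hx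
  induction w generalizing ι v m e μ c with
  | nil =>
    simp only [run, pol]
    split_ifs with h0
    · subst h0; simp [mul_comm]
    · have : ι c ≠ ι 0 := fun H => h0 (h.inj _ _ hc (by omega) H)
      simp [this]
  | cons i w ih =>
    rw [List.length_cons] at hQ
    have hrun : (cyl μ).filter (fun σ => run σ (i :: w) (ι c) = ι 0) =
        (cyl μ).filter (fun σ => run σ w (σ i (ι c)) = ι 0) :=
      Finset.filter_congr fun _ _ => Iff.rfl
    rw [hrun]
    simp only [pol]
    cases hm : m i c with
    | some y =>
      have hy := h.lt i c y hm
      have hμ : μ i (ι c) = some (ι y) := by rw [h.map i c hc, hm]; rfl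
      have : (cyl μ).filter (fun σ => run σ w (σ i (ι c)) = ι 0) =
          (cyl μ).filter (fun σ => run σ w (ι y) = ι 0) := by
        refine Finset.filter_congr fun σ hσ => ?_
        rw [(mem_cyl.1 hσ).2 i _ _ hμ]
      rw [this]
      exact ih h hy.2 fun j => by have := hQ j; omega
    | none =>
      have hμ : μ i (ι c) = none := by rw [h.map i c hc, hm]; rfl
      have hQ' : ∀ j, bump e i j + w.length ≤ Q := by
        intro j
        have := hQ j
        by_cases hj : j = i
        · subst hj; simp [bump]; omega
        · simp [bump, hj]; omega
      have step : ∀ z ∈ allowed μ i (ι c), ∀ p : ℝ,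
          (((cyl (μ.extend i (ι c) z)).filter fun σ => run σ w z = ι 0).card : ℝ) *
            (den Q (bump e i)).eval x = p * ((cyl (μ.extend i (ι c) z)).card : ℝ) →
          (((cyl (μ.extend i (ι c) z)).filter fun σ => run σ w (σ i (ι c)) = ι 0).card : ℝ) *
            (den Q e).eval x = x * p * ((cyl μ).card : ℝ) := by
        intro z hz p hp
        have h1 : (cyl (μ.extend i (ι c) z)).filter (fun σ => run σ w (σ i (ι c)) = ι 0) =
            (cyl (μ.extend i (ι c) z)).filter (fun σ => run σ w z = ι 0) := by
          refine Finset.filter_congr fun σ hσ => ?_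
          rw [cyl_extend hμ hz, Finset.mem_filter] at hσ
          rw [hσ.2]
        have h2 := card_cyl_extend_mul h.wf hμ hz
        have h3 := card_allowed_add hμ
        rw [h.card] at h3
        have h4 : ((allowed μ i (ι c)).card : ℝ) = Fintype.card U - (2 * e i + 1) := by
          rw [← h3]; push_cast; ring
        have h5 : (Fintype.card U : ℝ) * x = 1 := mul_inv_cancel₀ hN
        rw [h1, den_eq_mul (i := i) (by have := hQ i; omega), eval_mul, ← h2]
        push_cast
        rw [h4]
        simp only [eval_sub, eval_one, eval_mul, eval_C, eval_X]
        linear_combination (1 - (2 * (e i : ℝ) + 1) * x) * hp -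
          p * ((cyl (μ.extend i (ι c) z)).card : ℝ) * h5
      rw [card_filter_cyl h.wf hμ, Nat.cast_sum, Finset.sum_mul, allowed_eq h hc,
        Finset.sum_union, Finset.sum_image]
      · have old : ∀ y ∈ (Finset.range v).filter (fun y => y ≠ c ∧ m i y = none),
            (((cyl (μ.extend i (ι c) (ι y))).filter
              fun σ => run σ w (σ i (ι c)) = ι 0).card : ℝ) * (den Q e).eval x =
            x * (pol Q w v (m.extend i c y) (bump e i) y).eval x * ((cyl μ).card : ℝ) := by
          intro y hy
          simp only [Finset.mem_filter, Finset.mem_range] at hy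
          refine step _ ?_ _ (ih (h.extend_old hc hy.1 hy.2.1 hm hy.2.2) hy.1 hQ')
          rw [mem_allowed, h.map i y hy.1, hy.2.2]
          exact ⟨fun H => hy.2.1 (h.inj _ _ hy.1 hc H), rfl⟩
        have new : ∀ z ∈ Finset.univ \ (Finset.range v).image ι,
            (((cyl (μ.extend i (ι c) z)).filter
              fun σ => run σ w (σ i (ι c)) = ι 0).card : ℝ) * (den Q e).eval x =
            x * (pol Q w (v + 1) (m.extend i c v) (bump e i) v).eval x * ((cyl μ).card : ℝ) := by
          intro z hz
          simp only [Finset.mem_sdiff, Finset.mem_univ, Finset.mem_image, Finset.mem_range,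
            true_and, not_exists, not_and] at hz
          refine step _ ?_ _ ?_
          · rw [mem_allowed]
            exact ⟨fun H => hz c hc H.symm, h.off i z hz⟩
          · have := ih (h.extend_new hc hz hm) (c := v) (by omega) hQ'
            rwa [Function.update_self, Function.update_of_ne (by omega)] at this
        rw [Finset.sum_congr rfl old, Finset.sum_congr rfl new, Finset.sum_const,
          Finset.card_sdiff_of_subset (Finset.subset_univ _), Finset.card_univ,
          Finset.card_image_of_injOn, Finset.card_range, nsmul_eq_mul, Nat.cast_sub,
          ← Finset.sum_mul, ← Finset.mul_sum]
        · have h5 : (Fintype.card U : ℝ) * x = 1 := mul_inv_cancel₀ hN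
          simp only [eval_add, eval_mul, eval_X, eval_finsetSum, eval_sub, eval_one, eval_C]
          linear_combination (pol Q w (v + 1) (m.extend i c v) (bump e i) v).eval x *
            ((cyl μ).card : ℝ) * h5
        · have := Finset.card_le_univ ((Finset.range v).image ι)
          rwa [Finset.card_image_of_injOn, Finset.card_range] at this
          intro a ha b hb hab
          exact h.inj a b (by simpa using ha) (by simpa using hb) hab
        · intro a ha b hb hab
          exact h.inj a b (by simpa using ha) (by simpa using hb) hab
      · intro a ha b hb hab
        simp only [Finset.coe_filter, Finset.mem_range, Set.mem_ofPred_eq] at ha hb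
        exact h.inj a b ha.1 hb.1 hab
      · refine Finset.disjoint_left.2 fun z hz hz' => ?_
        simp only [Finset.mem_sdiff, Finset.mem_image, Finset.mem_filter] at hz hz'
        obtain ⟨y, hy, rfl⟩ := hz
        exact hz'.2 ⟨y, hy.1, rfl⟩

/-- The total number of fixed points of the word `w` over all matching families. -/
theorem sum_fix_mul_den (Q : ℕ) (w : List (Fin D)) (hw : w.length ≤ Q) :
    (∑ σ ∈ matchings D U, (((Finset.univ : Finset U).filter fun x => run σ w x = x).card : ℝ)) *
        (den Q (fun _ : Fin D => 0)).eval ((Fintype.card U : ℝ)⁻¹) =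
      Fintype.card U * (pol Q w 1 (emptyState D ℕ) (fun _ => 0) 0).eval
        ((Fintype.card U : ℝ)⁻¹) * ((matchings D U).card : ℝ) := by
  have key : ∀ x : U, (((matchings D U).filter fun σ => run σ w x = x).card : ℝ) *
        (den Q (fun _ : Fin D => 0)).eval ((Fintype.card U : ℝ)⁻¹) =
      (pol Q w 1 (emptyState D ℕ) (fun _ => 0) 0).eval ((Fintype.card U : ℝ)⁻¹) *
        ((matchings D U).card : ℝ) := by
    intro x
    have h : Compat (fun _ => x) 1 (emptyState D ℕ) (fun _ => 0) (emptyState D U) :=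
      ⟨fun a b ha hb _ => by omega, fun j a _ => rfl, fun j u _ => rfl,
        fun j a b hab => by simp [emptyState] at hab, fun j => by simp [dom, emptyState],
        emptyState_wf D U⟩
    have := card_run_mul_den Q w h (c := 0) (by omega) (fun i => by simpa using hw)
    rwa [cyl_emptyState] at this
  have h2 : (∑ σ ∈ matchings D U,
      (((Finset.univ : Finset U).filter fun x => run σ w x = x).card : ℝ)) =
      ∑ x : U, (((matchings D U).filter fun σ => run σ w x = x).card : ℝ) := by
    simp only [Finset.card_eq_sum_ones, Finset.sum_filter, Nat.cast_sum]
    rw [Finset.sum_comm]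
  rw [h2, Finset.sum_mul, Finset.sum_congr rfl fun x _ => key x, Finset.sum_const,
    Finset.card_univ, nsmul_eq_mul]
  ring

end ExactCount

section Coefficients

open Polynomial

variable {D : ℕ}

lemma coeff_zero_den (Q : ℕ) (e : Fin D → ℕ) : (den Q e).coeff 0 = 1 := by
  rw [coeff_zero_eq_eval_zero, den, eval_prod]
  refine Finset.prod_eq_one fun i _ => ?_
  rw [eval_prod]
  exact Finset.prod_eq_one fun j _ => by simp

lemma pol_cons_some {Q : ℕ} {i : Fin D} {w : List (Fin D)} {v : ℕ} {m : PState D ℕ}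
    {e : Fin D → ℕ} {c y : ℕ} (h : m i c = some y) :
    pol Q (i :: w) v m e c = pol Q w v m e y := by
  simp [pol, h]

lemma pol_cons_none {Q : ℕ} {i : Fin D} {w : List (Fin D)} {v : ℕ} {m : PState D ℕ}
    {e : Fin D → ℕ} {c : ℕ} (h : m i c = none) :
    pol Q (i :: w) v m e c =
      X * ∑ y ∈ (Finset.range v).filter (fun y => y ≠ c ∧ m i y = none),
        pol Q w v (m.extend i c y) (bump e i) y +
      (1 - C (v : ℝ) * X) * pol Q w (v + 1) (m.extend i c v) (bump e i) v := by
  simp [pol, h]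

lemma coeff_zero_pol_cons_none {Q : ℕ} {i : Fin D} {w : List (Fin D)} {v : ℕ} {m : PState D ℕ}
    {e : Fin D → ℕ} {c : ℕ} (h : m i c = none) :
    (pol Q (i :: w) v m e c).coeff 0 =
      (pol Q w (v + 1) (m.extend i c v) (bump e i) v).coeff 0 := by
  rw [pol_cons_none h]
  simp [mul_coeff_zero]

lemma coeff_one_pol_cons_none {Q : ℕ} {i : Fin D} {w : List (Fin D)} {v : ℕ} {m : PState D ℕ}
    {e : Fin D → ℕ} {c : ℕ} (h : m i c = none) :
    (pol Q (i :: w) v m e c).coeff 1 =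
      ∑ y ∈ (Finset.range v).filter (fun y => y ≠ c ∧ m i y = none),
        (pol Q w v (m.extend i c y) (bump e i) y).coeff 0 +
      ((pol Q w (v + 1) (m.extend i c v) (bump e i) v).coeff 1 -
        v * (pol Q w (v + 1) (m.extend i c v) (bump e i) v).coeff 0) := by
  rw [pol_cons_none h, coeff_add, show (1 : ℕ) = 0 + 1 from rfl, coeff_X_mul, sub_mul, one_mul,
    mul_assoc, coeff_sub, coeff_C_mul, coeff_X_mul, finsetSum_coeff]

lemma coeff_zero_pol_mem (Q : ℕ) (w : List (Fin D)) (v : ℕ) (m : PState D ℕ)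
    (e : Fin D → ℕ) (c : ℕ) :
    (pol Q w v m e c).coeff 0 = 0 ∨ (pol Q w v m e c).coeff 0 = 1 := by
  induction w generalizing v m e c with
  | nil =>
    simp only [pol]
    split_ifs
    · right; exact coeff_zero_den Q e
    · left; simp
  | cons i w ih =>
    cases h : m i c with
    | none => rw [coeff_zero_pol_cons_none h]; exact ih _ _ _ _
    | some y => rw [pol_cons_some h]; exact ih _ _ _ _

/-- After stepping to a new vertex, a reduced continuation does not return to first order. -/
lemma coeff_zero_pol_fresh {Q : ℕ} {j : Fin D} {w : List (Fin D)} {v : ℕ} {m : PState D ℕ}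
    {e : Fin D → ℕ} {c : ℕ} (hc : 0 < c) (hcv : c < v) (hlab : ∀ i, m i c ≠ none → i = j)
    (hsupp : ∀ i x, v ≤ x → m i x = none) (hw : (j :: w).IsChain (· ≠ ·)) :
    (pol Q w v m e c).coeff 0 = 0 := by
  induction w generalizing v m e c j with
  | nil => simp [pol, hc.ne']
  | cons i w ih =>
    rw [List.isChain_cons_cons] at hw
    have hm : m i c = none := by
      by_contra h
      exact hw.1 (hlab i h).symm
    rw [coeff_zero_pol_cons_none hm]
    refine ih (j := i) (by omega) (by omega) (fun a ha => ?_) (fun a x hx => ?_) hw.2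
    · by_contra hai
      simp [PState.extend, hai, hsupp a v le_rfl] at ha
    · simp only [PState.extend]
      rw [if_neg (by omega), if_neg (by omega), hsupp a x (by omega)]

/-- The letters `f t, …, f (t + n - 1)`. -/
def seg (f : ℕ → Fin D) (t n : ℕ) : List (Fin D) := (List.range' t n).map f

lemma seg_succ (f : ℕ → Fin D) (t n : ℕ) : seg f t (n + 1) = f t :: seg f (t + 1) n := by
  simp [seg, List.range'_succ]

lemma isChain_seg {f : ℕ → Fin D} {t n : ℕ} (h : ∀ u, t ≤ u → u + 1 < t + n → f u ≠ f (u + 1)) :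
    (seg f t n).IsChain (· ≠ ·) := by
  induction n generalizing t with
  | zero => simp [seg]
  | succ n ih =>
    rw [seg_succ]
    cases n with
    | zero => simp [seg]
    | succ n =>
      have := ih (t := t + 1) fun u hu hu' => h u (by omega) (by omega)
      rw [seg_succ] at this ⊢
      exact List.isChain_cons_cons.2 ⟨h t le_rfl (by omega), this⟩

/-- The state after walking along new vertices with letters `f 0, …, f (s - 1)`. -/
def pathState (f : ℕ → Fin D) (s : ℕ) : PState D ℕ := fun i x =>
  if x < s ∧ f x = i then some (x + 1)
  else if 0 < x ∧ x ≤ s ∧ f (x - 1) = i then some (x - 1) else none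

lemma pathState_extend (f : ℕ → Fin D) (s : ℕ) :
    (pathState f s).extend (f s) s (s + 1) = pathState f (s + 1) := by
  funext j x
  simp only [PState.extend, pathState]
  rcases lt_trichotomy x s with h | rfl | h
  · have h1 : x ≠ s := by omega
    have h2 : x ≠ s + 1 := by omega
    have h3 : x < s + 1 := by omega
    simp only [h1, h2, and_false, if_false, h, h3, true_and, h.le, h3.le]
  · by_cases hj : f x = j
    · simp [hj]
    · have hj' : j ≠ f x := fun H => hj H.symm
      simp [hj, hj']
  · by_cases h2 : x = s + 1
    · subst h2
      by_cases hj : f s = j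
      · simp [hj]
      · have hj' : j ≠ f s := fun H => hj H.symm
        simp [hj, hj']
    · simp [h2, show x ≠ s by omega, show ¬ x < s by omega, show ¬ x < s + 1 by omega,
        show ¬ x ≤ s by omega, show ¬ x ≤ s + 1 by omega]

lemma pathState_none_of_lt {f : ℕ → Fin D} {s x : ℕ} (hx : s < x) (i : Fin D) :
    pathState f s i x = none := by
  simp [pathState, show ¬ x < s by omega, show ¬ x ≤ s by omega]

variable {f : ℕ → Fin D} {ℓ : ℕ}

lemma pathState_self {s : ℕ} (h : 0 < s → f (s - 1) ≠ f s) : pathState f s (f s) s = none := by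
  simp only [pathState, lt_irrefl, false_and, if_false]
  rw [if_neg]
  rintro ⟨h1, -, h2⟩
  exact h h1 h2

/-- A step from the chord state to a new vertex never contributes. -/
lemma coeff_zero_pol_chord_new {Q : ℕ} (hf : ∀ u, u + 1 < ℓ → f u ≠ f (u + 1)) {s y : ℕ}
    {n t c : ℕ} {e : Fin D → ℕ} (hy : y ≤ s) (hc : c ≤ s) (hn : t + (n + 1) = ℓ)
    (hnone : (pathState f s).extend (f s) s y (f t) c = none) :
    (pol Q (seg f t (n + 1)) (s + 1) ((pathState f s).extend (f s) s y) e c).coeff 0 = 0 := by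
  rw [seg_succ, coeff_zero_pol_cons_none hnone]
  have hsupp : ∀ i x, s + 1 ≤ x → (pathState f s).extend (f s) s y i x = none := by
    intro i x hx
    simp only [PState.extend]
    rw [if_neg (by omega), if_neg (by omega), pathState_none_of_lt (by omega)]
  refine coeff_zero_pol_fresh (j := f t) (by omega) (by omega) (fun a ha => ?_)
    (fun a x hx => ?_) ?_
  · by_contra hai
    have h1 := hsupp a (s + 1) le_rfl
    rw [PState.extend, if_neg (by tauto), if_neg (by tauto)] at ha
    exact ha h1
  · rw [PState.extend, if_neg, if_neg, hsupp a x (by omega)]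
    · omega
    · omega
  · rw [← seg_succ]
    exact isChain_seg fun u _ hu => hf u (by omega)

section Chord

variable {s y : ℕ}

lemma chord_label_ne (hy : y < s) (hay : pathState f s (f s) y = none) :
    f y ≠ f s ∧ (0 < y → f (y - 1) ≠ f s) := by
  simp only [pathState] at hay
  split_ifs at hay with h1 h2
  exact ⟨fun H => h1 ⟨hy, H⟩, fun h H => h2 ⟨h, hy.le, H⟩⟩

lemma chord_next (hy : y < s) (hay : pathState f s (f s) y = none) {c : ℕ}
    (hc : c ≤ s) : (pathState f s).extend (f s) s y (f c) c =
    some (if c = s then y else c + 1) := by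
  have := (chord_label_ne hy hay).1
  rcases hc.eq_or_lt with rfl | hc
  · simp [PState.extend]
  · rw [PState.extend, if_neg (by omega), if_neg, pathState, if_pos ⟨hc, rfl⟩, if_neg (by omega)]
    rintro ⟨h1, rfl⟩; exact this h1

lemma chord_none (hy : y < s) (hay : pathState f s (f s) y = none) {c : ℕ}
    (hc : c ≤ s) {i : Fin D} (h1 : i ≠ f c) (h2 : 0 < c → i ≠ f (c - 1))
    (h3 : c = y → i ≠ f s) : (pathState f s).extend (f s) s y i c = none := by
  rw [PState.extend, if_neg, if_neg, pathState, if_neg, if_neg]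
  · rintro ⟨h, -, h'⟩; exact h2 h h'.symm
  · rintro ⟨h, h'⟩; exact h1 h'.symm
  · rintro ⟨h, h'⟩; exact h3 h' h
  · rintro ⟨h, rfl⟩; exact h1 h

lemma chord_prev (hf : ∀ u, u + 1 < ℓ → f u ≠ f (u + 1)) (hs : s < ℓ)
    (hy : y < s) (hay : pathState f s (f s) y = none) {c : ℕ} (hc0 : 0 < c) (hc : c ≤ s) :
    (pathState f s).extend (f s) s y (f (c - 1)) c = some (c - 1) := by
  have h1 := (chord_label_ne hy hay).2
  have h2 : f (c - 1) ≠ f c := by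
    have := hf (c - 1) (by omega)
    rwa [Nat.sub_add_cancel hc0] at this
  rw [PState.extend, if_neg, if_neg, pathState, if_neg, if_pos ⟨hc0, hc, rfl⟩]
  · rintro ⟨-, h⟩; exact h2 h.symm
  · rintro ⟨h, rfl⟩; exact h1 hc0 h
  · rintro ⟨h, rfl⟩; exact h2 h

/-- A chord to an interior vertex of the path does not contribute. -/
lemma coeff_zero_chord_interior (hf : ∀ u, u + 1 < ℓ → f u ≠ f (u + 1)) (hs : s < ℓ)
    (hy : y < s) (hay : pathState f s (f s) y = none)
    (hcyc : f 0 ≠ f (ℓ - 1)) (hy0 : 0 < y) {Q : ℕ} (n : ℕ)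
    {t c : ℕ} (e : Fin D → ℕ) (hn : t + n = ℓ) (ht : 0 < t) (hcs : c ≤ s)
    (hlast : (y = c ∧ f (t - 1) = f s) ∨ (y < c ∧ f (t - 1) = f (c - 1)) ∨
      (c < y ∧ f (t - 1) = f c)) :
    (pol Q (seg f t n) (s + 1) ((pathState f s).extend (f s) s y) e c).coeff 0 = 0 := by
  induction n generalizing t c e with
  | zero =>
    have hc0 : c ≠ 0 := by
      rintro rfl
      rcases hlast with h | h | h
      · omega
      · omega
      · exact hcyc (by rw [← hn]; exact h.2.symm)
    simp [seg, pol, hc0]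
  | succ n ih =>
    have htt : f (t - 1) ≠ f t := by
      have := hf (t - 1) (by omega)
      rwa [Nat.sub_add_cancel ht] at this
    by_cases h1 : f t = f c
    · have hyc : y ≤ c := by
        rcases hlast with h | h | h
        · omega
        · omega
        · exact absurd (h.2.trans h1.symm) htt
      have hst := chord_next hy hay hcs
      rw [← h1] at hst
      rw [seg_succ, pol_cons_some hst]
      refine ih e (by omega) (by omega) (by split_ifs <;> omega) ?_
      rw [Nat.add_sub_cancel]
      split_ifs with hc
      · left; exact ⟨rfl, by rw [h1, hc]⟩
      · right; left; exact ⟨by omega, by rw [h1]; rfl⟩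
    · by_cases h2 : 0 < c ∧ f t = f (c - 1)
      · have hyc : c ≤ y := by
          rcases hlast with h | h | h
          · omega
          · exact absurd (h.2.trans h2.2.symm) htt
          · omega
        have hst := chord_prev hf hs hy hay h2.1 hcs
        rw [← h2.2] at hst
        rw [seg_succ, pol_cons_some hst]
        refine ih e (by omega) (by omega) (by omega) ?_
        rw [Nat.add_sub_cancel]
        right; right
        exact ⟨by omega, h2.2⟩
      · refine coeff_zero_pol_chord_new hf hy.le hcs (by omega) (chord_none hy hay hcs h1
          (fun h h' => h2 ⟨h, h'⟩) ?_)
        rintro rfl h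
        rcases hlast with h' | h' | h'
        · exact htt (h'.2.trans h.symm)
        · omega
        · omega

/-- A chord back to the start contributes only for periodic words. -/
lemma coeff_zero_chord_start (hf : ∀ u, u + 1 < ℓ → f u ≠ f (u + 1)) (hs : s < ℓ)
    (hy : 0 < s) (hay : pathState f s (f s) 0 = none) {Q : ℕ} (n : ℕ)
    {t c : ℕ} (e : Fin D → ℕ) (hn : t + n = ℓ) (ht : 0 < t) (hcs : c = t % (s + 1))
    (hlast : (c = 0 ∧ f (t - 1) = f s) ∨ (0 < c ∧ f (t - 1) = f (c - 1)))
    (hne : (pol Q (seg f t n) (s + 1) ((pathState f s).extend (f s) s 0) e c).coeff 0 ≠ 0) :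
    (∀ u, t ≤ u → u < ℓ → f u = f (u % (s + 1))) ∧ ℓ % (s + 1) = 0 := by
  have hcs' : c ≤ s := by have := Nat.mod_lt t (show 0 < s + 1 by omega); omega
  induction n generalizing t c e with
  | zero =>
    refine ⟨fun u h1 h2 => by omega, ?_⟩
    by_contra h
    have hc0 : c ≠ 0 := by rw [hcs, show t = ℓ by omega]; exact h
    simp [seg, pol, hc0] at hne
  | succ n ih =>
    have htt : f (t - 1) ≠ f t := by
      have := hf (t - 1) (by omega)
      rwa [Nat.sub_add_cancel ht] at this
    by_cases h1 : f t = f c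
    · have hst := chord_next hy hay hcs'
      rw [← h1] at hst
      rw [seg_succ, pol_cons_some hst] at hne
      have hmod : (if c = s then 0 else c + 1) = (t + 1) % (s + 1) := by
        rw [Nat.add_mod, ← hcs]
        split_ifs with h
        · subst h
          rw [Nat.mod_eq_of_lt (show 1 < c + 1 by omega), Nat.mod_self]
        · rw [Nat.mod_eq_of_lt (show 1 < s + 1 by omega), Nat.mod_eq_of_lt (by omega)]
      have := ih e (by omega) (by omega) hmod ?_ hne (by split_ifs <;> omega)
      · refine ⟨fun u hu hu' => ?_, this.2⟩
        rcases hu.eq_or_lt with rfl | hu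
        · rw [h1, hcs]
        · exact this.1 u hu hu'
      · rw [Nat.add_sub_cancel]
        split_ifs with h
        · left; exact ⟨rfl, by rw [h1, h]⟩
        · right; exact ⟨by omega, by rw [h1]; rfl⟩
    · refine absurd (coeff_zero_pol_chord_new hf (Nat.zero_le s) hcs' (by omega)
        (chord_none hy hay hcs' h1 (fun h h' => ?_) ?_)) hne
      · rcases hlast with h2 | h2
        · omega
        · exact htt (h2.2.trans h'.symm)
      · intro hc0 h'
        rcases hlast with h2 | h2
        · exact htt (h2.2.trans h'.symm)
        · omega

end Chord

/-- `f` restricted to `[0, ℓ)` is a proper power of a word of length `k`. -/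
def PeriodicWord (f : ℕ → Fin D) (ℓ k : ℕ) : Prop :=
  (∀ u, u < ℓ → f u = f (u % k)) ∧ ℓ % k = 0

lemma coeff_one_path (hf : ∀ u, u + 1 < ℓ → f u ≠ f (u + 1)) (hcyc : f 0 ≠ f (ℓ - 1))
    (hℓ : 2 ≤ ℓ) {Q : ℕ} (n s : ℕ) (e : Fin D → ℕ) (hn : s + (n + 1) = ℓ) :
    1 ≤ (pol Q (seg f s (n + 1)) (s + 1) (pathState f s) e s).coeff 1 ∧
    (pol Q (seg f s (n + 1)) (s + 1) (pathState f s) e s).coeff 1 ≤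
      1 + ∑ k ∈ Finset.Icc 1 (ℓ / 2), if PeriodicWord f ℓ k ∧ s < k then 1 else 0 := by
  have hself : pathState f s (f s) s = none := pathState_self fun h => by
    have := hf (s - 1) (by omega)
    rwa [Nat.sub_add_cancel h] at this
  have hfresh : (pol Q (seg f (s + 1) n) (s + 1 + 1) (pathState f (s + 1)) (bump e (f s))
      (s + 1)).coeff 0 = 0 := by
    refine coeff_zero_pol_fresh (j := f s) (by omega) (by omega) (fun a ha => ?_)
      (fun a x hx => pathState_none_of_lt (by omega) a) ?_
    · by_contra hai
      simp [pathState, Ne.symm hai] at ha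
    · rw [← seg_succ]
      exact isChain_seg fun u _ hu => hf u (by omega)
  rw [seg_succ, coeff_one_pol_cons_none hself, pathState_extend, hfresh, mul_zero, sub_zero]
  induction n generalizing s e with
  | zero =>
    have h0 : 0 ∈ (Finset.range (s + 1)).filter
        (fun y => y ≠ s ∧ pathState f s (f s) y = none) := by
      simp only [Finset.mem_filter, Finset.mem_range]
      refine ⟨by omega, by omega, ?_⟩
      rw [pathState, if_neg, if_neg (by omega)]
      rintro ⟨-, h⟩
      rw [show ℓ - 1 = s by omega] at hcyc
      exact hcyc h
    rw [← Finset.add_sum_erase _ _ h0, Finset.sum_eq_zero]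
    · have : (0 : ℝ) ≤ ∑ k ∈ Finset.Icc 1 (ℓ / 2),
          if PeriodicWord f ℓ k ∧ s < k then 1 else 0 :=
        Finset.sum_nonneg fun k _ => by split_ifs <;> norm_num
      simp only [seg, List.range'_zero, List.map_nil, pol, if_true, coeff_zero_den, add_zero,
        Nat.add_eq_zero_iff, one_ne_zero, and_false, if_false, coeff_zero]
      exact ⟨le_rfl, by linarith⟩
    · intro y hy
      have : y ≠ 0 := Finset.ne_of_mem_erase hy
      simp [seg, pol, this]
  | succ n ih =>
    have hself' : pathState f (s + 1) (f (s + 1)) (s + 1) = none := pathState_self fun h =>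
      hf s (by omega)
    have hfresh' : (pol Q (seg f (s + 1 + 1) n) (s + 1 + 1 + 1) (pathState f (s + 1 + 1))
        (bump (bump e (f s)) (f (s + 1))) (s + 1 + 1)).coeff 0 = 0 := by
      refine coeff_zero_pol_fresh (j := f (s + 1)) (by omega) (by omega) (fun a ha => ?_)
        (fun a x hx => pathState_none_of_lt (by omega) a) ?_
      · by_contra hai
        simp [pathState, Ne.symm hai] at ha
      · rw [← seg_succ]
        exact isChain_seg fun u _ hu => hf u (by omega)
    have IH := ih (s + 1) (bump e (f s)) (by omega) hself' hfresh'
    rw [seg_succ f (s + 1) n, coeff_one_pol_cons_none hself', pathState_extend, hfresh', mul_zero,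
      sub_zero, ← seg_succ]
    have hS0 : (0 : ℝ) ≤ ∑ y ∈ (Finset.range (s + 1)).filter
        (fun y => y ≠ s ∧ pathState f s (f s) y = none),
        (pol Q (seg f (s + 1) (n + 1)) (s + 1) ((pathState f s).extend (f s) s y)
          (bump e (f s)) y).coeff 0 := by
      refine Finset.sum_nonneg fun y _ => ?_
      rcases coeff_zero_pol_mem Q (seg f (s + 1) (n + 1)) (s + 1)
        ((pathState f s).extend (f s) s y) (bump e (f s)) y with h | h <;> rw [h]
      norm_num
    have hS1 : ∑ y ∈ (Finset.range (s + 1)).filter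
        (fun y => y ≠ s ∧ pathState f s (f s) y = none),
        (pol Q (seg f (s + 1) (n + 1)) (s + 1) ((pathState f s).extend (f s) s y)
          (bump e (f s)) y).coeff 0 ≤
        if PeriodicWord f ℓ (s + 1) ∧ 2 * (s + 1) ≤ ℓ then 1 else 0 := by
      have hinner : ∀ y ∈ (Finset.range (s + 1)).filter
        (fun y => y ≠ s ∧ pathState f s (f s) y = none), y ≠ 0 →
        (pol Q (seg f (s + 1) (n + 1)) (s + 1) ((pathState f s).extend (f s) s y)
          (bump e (f s)) y).coeff 0 = 0 := by
        intro y hy hy0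
        simp only [Finset.mem_filter, Finset.mem_range] at hy
        exact coeff_zero_chord_interior hf (by omega) (by omega) hy.2.2 hcyc (by omega) (n + 1) _
          (by omega) (by omega) (by omega) (Or.inl ⟨rfl, rfl⟩)
      by_cases h0 : 0 ∈ (Finset.range (s + 1)).filter
        (fun y => y ≠ s ∧ pathState f s (f s) y = none)
      · rw [Finset.sum_eq_single_of_mem 0 h0 hinner]
        rcases coeff_zero_pol_mem Q (seg f (s + 1) (n + 1)) (s + 1)
          ((pathState f s).extend (f s) s 0) (bump e (f s)) 0 with h | h
        · rw [h]; split_ifs <;> norm_num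
        · simp only [Finset.mem_filter, Finset.mem_range] at h0
          have hp := coeff_zero_chord_start hf (by omega) (by omega) h0.2.2 (n + 1) (t := s + 1)
            (c := 0) (bump e (f s)) (by omega) (by omega) (Nat.mod_self _).symm
            (Or.inl ⟨rfl, rfl⟩) (by rw [h]; norm_num)
          rw [h, if_pos]
          refine ⟨⟨fun u hu => ?_, hp.2⟩, ?_⟩
          · by_cases hus : u < s + 1
            · rw [Nat.mod_eq_of_lt hus]
            · exact hp.1 u (by omega) hu
          · obtain ⟨k, hk⟩ := Nat.dvd_of_mod_eq_zero hp.2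
            have : 2 ≤ k := by
              by_contra hlt
              have : k = 0 ∨ k = 1 := by omega
              rcases this with rfl | rfl <;> omega
            rw [hk, mul_comm]
            exact Nat.mul_le_mul_left _ this
      · rw [Finset.sum_eq_zero fun y hy => hinner y hy (fun h => h0 (h ▸ hy))]
        split_ifs <;> norm_num
    have hsplit :
        (∑ k ∈ Finset.Icc 1 (ℓ / 2), if PeriodicWord f ℓ k ∧ s + 1 < k then (1 : ℝ) else 0)
        + (if PeriodicWord f ℓ (s + 1) ∧ 2 * (s + 1) ≤ ℓ then 1 else 0) ≤
        ∑ k ∈ Finset.Icc 1 (ℓ / 2), if PeriodicWord f ℓ k ∧ s < k then 1 else 0 := by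
      split_ifs with hp
      · have hmem : s + 1 ∈ Finset.Icc 1 (ℓ / 2) := Finset.mem_Icc.2 ⟨by omega, by omega⟩
        rw [← Finset.add_sum_erase _ _ hmem, ← Finset.add_sum_erase _ _ hmem,
          if_neg (fun h => lt_irrefl _ h.2), if_pos ⟨hp.1, by omega⟩, zero_add, add_comm]
        gcongr with k hk
        split_ifs with h1 h2 <;> norm_num
        exact absurd ⟨h1.1, by omega⟩ h2
      · rw [add_zero]
        gcongr with k hk
        split_ifs with h1 h2 <;> norm_num
        exact absurd ⟨h1.1, by omega⟩ h2
    constructor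
    · linarith [IH.1]
    · linarith [IH.2]

end Coefficients

section CycSums

open Polynomial

variable {D : ℕ}

lemma seg_getD (w : List (Fin D)) (i : Fin D) : seg (fun t => w.getD t i) 0 w.length = w := by
  refine List.ext_getElem (by simp [seg]) fun t h1 h2 => ?_
  simp [seg, h2]

lemma pathState_zero (f : ℕ → Fin D) : pathState f 0 = emptyState D ℕ := by
  funext i x
  simp only [pathState, emptyState]
  rw [if_neg (by omega), if_neg (by omega)]

/-- The numerator polynomial of a word from the empty state. -/
def wordPol (Q : ℕ) (w : List (Fin D)) : ℝ[X] := pol Q w 1 (emptyState D ℕ) (fun _ => 0) 0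

lemma getD_ne_of_isChain {w : List (Fin D)} (h : w.IsChain (· ≠ ·)) (i : Fin D) :
    ∀ u, u + 1 < w.length → w.getD u i ≠ w.getD (u + 1) i := by
  intro u hu
  rw [List.getD_eq_getElem _ _ (by omega), List.getD_eq_getElem _ _ hu]
  exact List.isChain_iff_getElem.1 h u hu

lemma coeff_one_wordPol {Q n : ℕ} {i j : Fin D} (hij : j ≠ i) {w : List (Fin D)}
    (hw : w ∈ redWords D n i j) :
    1 ≤ (wordPol Q w).coeff 1 ∧ (wordPol Q w).coeff 1 ≤
      1 + ∑ k ∈ Finset.Icc 1 ((n + 1) / 2),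
        if PeriodicWord (fun t => w.getD t i) (n + 1) k then 1 else 0 := by
  obtain ⟨h1, h2, h3, h4⟩ := mem_redWords_iff.1 hw
  have hne : w ≠ [] := by rintro rfl; simp at h1
  have h0 : w.getD 0 i = i := by
    cases w with
    | nil => simp
    | cons a w => simpa using h3
  have hl : w.getD (n + 1 - 1) i = j := by
    rw [List.getLast?_eq_getElem?, h1] at h4
    rw [List.getD, h4, Option.getD_some]
  have hn : 1 ≤ n := by
    by_contra hn
    have : n = 0 := by omega
    subst this
    exact hij (hl.symm.trans h0)
  have := coeff_one_path (f := fun t => w.getD t i) (ℓ := n + 1) (Q := Q)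
    (fun u hu => getD_ne_of_isChain h2 i u (by omega)) (by rw [h0, hl]; exact hij.symm)
    (by omega) n 0 (fun _ => 0) (by omega)
  rw [← h1, seg_getD, pathState_zero, h1] at this
  refine ⟨this.1, this.2.trans ?_⟩
  gcongr with k hk
  rw [Finset.mem_Icc] at hk
  split_ifs with a b <;> norm_num
  exact b a.1

lemma coeff_zero_wordPol {Q n : ℕ} {i j : Fin D} {w : List (Fin D)}
    (hw : w ∈ redWords D n i j) : (wordPol Q w).coeff 0 = 0 := by
  obtain ⟨h1, h2, h3, h4⟩ := mem_redWords_iff.1 hw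
  cases w with
  | nil => simp at h1
  | cons a w =>
    rw [wordPol, coeff_zero_pol_cons_none rfl]
    refine coeff_zero_pol_fresh (j := a) (by omega) (by omega) (fun b hb => ?_)
      (fun b x hx => ?_) h2
    · by_contra hba
      simp [PState.extend, hba, emptyState] at hb
    · rw [PState.extend, if_neg (by omega), if_neg (by omega), emptyState]

lemma natDegree_den_le (Q : ℕ) (e : Fin D → ℕ) : (den Q e).natDegree ≤ D * Q := by
  refine (natDegree_prod_le _ _).trans ?_
  refine (Finset.sum_le_card_nsmul _ _ Q fun i _ => ?_).trans (by simp)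
  refine (natDegree_prod_le _ _).trans ?_
  refine (Finset.sum_le_card_nsmul _ _ 1 fun j _ => ?_).trans (by simp)
  compute_degree

lemma natDegree_pol_le (Q : ℕ) (w : List (Fin D)) (v : ℕ) (m : PState D ℕ) (e : Fin D → ℕ)
    (c : ℕ) : (pol Q w v m e c).natDegree ≤ w.length + D * Q := by
  induction w generalizing v m e c with
  | nil =>
    simp only [pol]
    split_ifs
    · simpa using natDegree_den_le Q e
    · simp
  | cons i w ih =>
    rw [List.length_cons]
    cases h : m i c with
    | some y => rw [pol_cons_some h]; exact (ih _ _ _ _).trans (by omega)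
    | none =>
      rw [pol_cons_none h]
      refine natDegree_add_le_of_degree_le ?_ ?_
      · refine natDegree_mul_le.trans ?_
        have := natDegree_sum_le_of_forall_le
          ((Finset.range v).filter (fun y => y ≠ c ∧ m i y = none))
          (fun y => pol Q w v (m.extend i c y) (bump e i) y) (n := w.length + D * Q)
          fun y _ => ih _ _ _ _
        have hX : (X : ℝ[X]).natDegree ≤ 1 := natDegree_X_le
        omega
      · refine natDegree_mul_le.trans ?_
        have := ih (v + 1) (m.extend i c v) (bump e i) v
        have hX : (1 - C (v : ℝ) * X : ℝ[X]).natDegree ≤ 1 := by compute_degree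
        omega

lemma natDegree_wordPol_le (Q : ℕ) (w : List (Fin D)) :
    (wordPol Q w).natDegree ≤ w.length + D * Q := natDegree_pol_le _ _ _ _ _ _

lemma card_periodic_le (d n k : ℕ) (hk : 1 ≤ k) (hkn : k ≤ n) (i : Fin (d + 1)) :
    ∑ j ∈ Finset.univ.erase i, ((redWords (d + 1) n i j).filter fun w =>
      PeriodicWord (fun t => w.getD t i) (n + 1) k).card ≤ d ^ (k - 1) := by
  rw [← sum_card_redWords d (k - 1) i]
  have disj : ∀ n (S : Finset (Fin (d + 1))), (S : Set (Fin (d + 1))).PairwiseDisjoint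
      fun j => redWords (d + 1) n i j := by
    intro n S a _ b _ hab
    refine Finset.disjoint_left.2 fun w hw hw' => hab ?_
    have h1 := (mem_redWords_iff.1 hw).2.2.2
    rw [(mem_redWords_iff.1 hw').2.2.2] at h1
    simpa using h1.symm
  rw [← Finset.card_biUnion (disj _ _), ← Finset.card_biUnion]
  · refine Finset.card_le_card_of_injOn (List.take k) ?_ ?_
    · intro w hw
      simp only [Finset.coe_biUnion, Set.mem_iUnion, Finset.mem_coe, Finset.mem_filter] at hw
      obtain ⟨j, -, hw, -⟩ := hw
      obtain ⟨h1, h2, h3, h4⟩ := mem_redWords_iff.1 hw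
      simp only [Finset.coe_biUnion, Set.mem_iUnion, Finset.mem_coe]
      have hne : w.take k ≠ [] := by
        intro h
        have := congrArg List.length h
        rw [List.length_take, h1, List.length_nil] at this
        omega
      refine ⟨(w.take k).getLast hne, Finset.mem_univ _, mem_redWords_iff.2
        ⟨by simp; omega, h2.take k, ?_, List.getLast?_eq_some_getLast hne⟩⟩
      rw [List.head?_take, if_neg (by omega), h3]
    · intro w hw w' hw' h
      simp only [Finset.coe_biUnion, Set.mem_iUnion, Finset.mem_coe, Finset.mem_filter] at hw hw'
      obtain ⟨j, -, hw, hp⟩ := hw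
      obtain ⟨j', -, hw', hp'⟩ := hw'
      have h1 := (mem_redWords_iff.1 hw).1
      have h1' := (mem_redWords_iff.1 hw').1
      refine List.ext_getElem (by omega) fun t ht ht' => ?_
      have e1 := hp.1 t (by omega)
      have e2 := hp'.1 t (by omega)
      simp only at e1 e2
      have hlt : t % k < k := Nat.mod_lt _ hk
      rw [List.getD_eq_getElem _ _ ht, List.getD_eq_getElem _ _ (by omega)] at e1
      rw [List.getD_eq_getElem _ _ ht', List.getD_eq_getElem _ _ (by omega)] at e2
      rw [e1, e2]
      have e3 := congrArg (fun l => l.getD (t % k) i) h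
      beta_reduce at e3
      rwa [List.getD_eq_getElem _ _ (by simp; omega), List.getD_eq_getElem _ _ (by simp; omega),
        List.getElem_take, List.getElem_take] at e3
  · intro a ha b hb hab
    exact (disj n (Finset.univ.erase i) ha hb hab).mono (Finset.filter_subset _ _)
      (Finset.filter_subset _ _)

lemma sum_coeff_one_wordPol (d n Q : ℕ) (hn : 1 ≤ n) (hd : 1 ≤ d) :
    |cycSum d n (fun w => (wordPol Q w).coeff 1) - cycSum d n (fun _ => (1 : ℝ))| ≤
      (n + 1) * (d + 1) * (d : ℝ) ^ ((n + 1) / 2) := by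
  have hlow : cycSum d n (fun _ => (1 : ℝ)) ≤ cycSum d n (fun w => (wordPol Q w).coeff 1) :=
    Finset.sum_le_sum fun i _ => Finset.sum_le_sum fun j hj => Finset.sum_le_sum fun w hw =>
      (coeff_one_wordPol (Finset.ne_of_mem_erase hj) hw).1
  have hup : cycSum d n (fun w => (wordPol Q w).coeff 1) ≤ cycSum d n (fun _ => (1 : ℝ)) +
      ∑ i : Fin (d + 1), ∑ k ∈ Finset.Icc 1 ((n + 1) / 2), (d : ℝ) ^ ((n + 1) / 2) := by
    unfold cycSum
    rw [← Finset.sum_add_distrib]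
    refine Finset.sum_le_sum fun i _ => ?_
    calc _ ≤ ∑ j ∈ Finset.univ.erase i, ∑ w ∈ redWords (d + 1) n i j,
          (1 + ∑ k ∈ Finset.Icc 1 ((n + 1) / 2),
            if PeriodicWord (fun t => w.getD t i) (n + 1) k then (1 : ℝ) else 0) :=
          Finset.sum_le_sum fun j hj => Finset.sum_le_sum fun w hw =>
            (coeff_one_wordPol (Finset.ne_of_mem_erase hj) hw).2
      _ = ∑ j ∈ Finset.univ.erase i, ∑ w ∈ redWords (d + 1) n i j, (1 : ℝ) +
          ∑ k ∈ Finset.Icc 1 ((n + 1) / 2), ((∑ j ∈ Finset.univ.erase i,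
            ((redWords (d + 1) n i j).filter fun w =>
              PeriodicWord (fun t => w.getD t i) (n + 1) k).card : ℕ) : ℝ) := by
          simp only [Finset.sum_add_distrib]
          congr 1
          rw [Finset.sum_congr rfl fun j _ => Finset.sum_comm, Finset.sum_comm]
          refine Finset.sum_congr rfl fun k _ => ?_
          push_cast
          refine Finset.sum_congr rfl fun j _ => ?_
          rw [Finset.card_filter]
          push_cast
          rfl
      _ ≤ _ := by
          gcongr with k hk
          rw [Finset.mem_Icc] at hk
          calc _ ≤ ((d ^ (k - 1) : ℕ) : ℝ) := by
                exact_mod_cast card_periodic_le d n k hk.1 (by omega) i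
            _ ≤ _ := by
                push_cast
                exact pow_le_pow_right₀ (by exact_mod_cast hd) (by omega)
  have hsum : ∑ i : Fin (d + 1), ∑ k ∈ Finset.Icc 1 ((n + 1) / 2), (d : ℝ) ^ ((n + 1) / 2) ≤
      (n + 1) * (d + 1) * (d : ℝ) ^ ((n + 1) / 2) := by
    simp only [Finset.sum_const, Finset.card_univ, Fintype.card_fin, Nat.card_Icc, nsmul_eq_mul]
    have : (((n + 1) / 2 + 1 - 1 : ℕ) : ℝ) ≤ n + 1 := by
      have : (n + 1) / 2 + 1 - 1 ≤ n + 1 := by omega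
      exact_mod_cast this
    have h0 : (0 : ℝ) ≤ (d : ℝ) ^ ((n + 1) / 2) := by positivity
    calc _ = ((((n + 1) / 2 + 1 - 1 : ℕ) : ℝ) * ((d : ℝ) + 1)) * (d : ℝ) ^ ((n + 1) / 2) := by
          push_cast; ring
      _ ≤ _ := by gcongr
  rw [abs_le]
  constructor <;> nlinarith [hlow, hup, hsum]

end CycSums

section ChebExpansion

open Polynomial

lemma chebQ_monic (d n : ℕ) : (chebQ d (n + 1)).Monic ∧ (chebQ d (n + 1)).natDegree = n + 1 := by
  induction n using Nat.twoStepInduction with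
  | zero => exact ⟨monic_X, natDegree_X⟩
  | one =>
    have : chebQ d 2 = X ^ 2 - C (2 * (d : ℝ)) := by
      simp only [chebQ, map_mul, map_ofNat]; ring
    rw [this]
    exact ⟨monic_X_pow_sub_C _ (by norm_num), natDegree_X_pow_sub_C⟩
  | more n h1 h2 =>
    have hX : (X * chebQ d (n + 2)).natDegree = n + 3 := by
      rw [natDegree_X_mul h2.1.ne_zero, h2.2]
    have hlt : (C (d : ℝ) * chebQ d (n + 1)).natDegree < (X * chebQ d (n + 2)).natDegree := by
      rw [hX]
      exact (natDegree_C_mul_le _ _).trans_lt (by rw [h1.2]; omega)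
    have e : chebQ d (n + 2 + 1) = X * chebQ d (n + 2) - C (d : ℝ) * chebQ d (n + 1) := rfl
    rw [e]
    refine ⟨(monic_X.mul h2.1).sub_of_left (degree_lt_degree hlt), ?_⟩
    rw [natDegree_sub_eq_left_of_natDegree_lt hlt, hX]

lemma exists_chebQ_expansion (d q : ℕ) (h : ℝ[X]) (hh : h.natDegree ≤ q) :
    ∃ γ : ℕ → ℝ, h = ∑ ℓ ∈ Finset.range (q + 1), C (γ ℓ) * chebQ d ℓ := by
  induction q generalizing h with
  | zero =>
    refine ⟨fun _ => h.coeff 0 / 2, ?_⟩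
    rw [eq_C_of_natDegree_eq_zero (by omega : h.natDegree = 0)]
    simp only [zero_add, Finset.range_one, Finset.sum_singleton, chebQ, coeff_C_zero]
    rw [show (2 : ℝ[X]) = C 2 from rfl, ← C_mul]
    congr 1
    ring
  | succ q ih =>
    obtain ⟨hm, hd⟩ := chebQ_monic d q
    have : (h - C (h.coeff (q + 1)) * chebQ d (q + 1)).natDegree ≤ q := by
      refine natDegree_le_iff_coeff_eq_zero.2 fun n hn => ?_
      rw [coeff_sub, coeff_C_mul]
      rcases Nat.lt_or_ge (q + 1) n with h' | h'
      · rw [coeff_eq_zero_of_natDegree_lt (p := h) (by omega),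
          coeff_eq_zero_of_natDegree_lt (p := chebQ d (q + 1)) (by omega)]
        ring
      · obtain rfl : n = q + 1 := by omega
        have := hm.coeff_natDegree
        rw [hd] at this
        rw [this]
        ring
    obtain ⟨γ, hγ⟩ := ih _ this
    refine ⟨Function.update γ (q + 1) (h.coeff (q + 1)), ?_⟩
    rw [Finset.sum_range_succ, Function.update_self]
    rw [sub_eq_iff_eq_add] at hγ
    conv_lhs => rw [hγ]
    congr 1
    refine Finset.sum_congr rfl fun ℓ hℓ => ?_
    rw [Function.update_of_ne (by rw [Finset.mem_range] at hℓ; omega)]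

lemma chebQ_eval (d n : ℕ) (x : ℝ) :
    (chebQ d n).eval (2 * √d * x) = 2 * √d ^ n * (Chebyshev.T ℝ n).eval x := by
  induction n using Nat.twoStepInduction with
  | zero => simp [chebQ]
  | one => simp [chebQ]
  | more n h1 h2 =>
    have hd : (d : ℝ) = √d ^ 2 := (Real.sq_sqrt (Nat.cast_nonneg d)).symm
    have hT := Chebyshev.T_add_two ℝ (n : ℤ)
    push_cast at h1 h2 ⊢
    rw [hT, chebQ]
    simp only [eval_sub, eval_mul, eval_X, eval_C, h1, h2, eval_ofNat]
    conv_lhs => enter [2, 1]; rw [hd]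
    ring

lemma abs_chebQ_coeff_le {d q : ℕ} {γ : ℕ → ℝ} {δ : ℝ}
    (hb : ∀ x, |x| ≤ 2 * √d → |(∑ ℓ ∈ Finset.range (q + 1), C (γ ℓ) * chebQ d ℓ).eval x| ≤ δ)
    {k : ℕ} (hk : k ≤ q) : |γ k| * √d ^ k ≤ δ := by
  set h := ∑ ℓ ∈ Finset.range (q + 1), C (γ ℓ) * chebQ d ℓ with hh
  have hδ : 0 ≤ δ := (abs_nonneg _).trans (hb 0 (by simp))
  have h1 : ∫ x, h.eval (2 * √d * x) * (Chebyshev.T ℝ k).eval x ∂Chebyshev.measureT =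
      ∑ ℓ ∈ Finset.range (q + 1), γ ℓ * (2 * √d ^ ℓ) *
        ∫ x, (Chebyshev.T ℝ ℓ).eval x * (Chebyshev.T ℝ k).eval x ∂Chebyshev.measureT := by
    simp_rw [← MeasureTheory.integral_const_mul]
    rw [← MeasureTheory.integral_finsetSum]
    · refine MeasureTheory.integral_congr_ae (Filter.Eventually.of_forall fun x => ?_)
      simp only [hh, eval_finsetSum, eval_mul, eval_C, chebQ_eval, Finset.sum_mul]
      exact Finset.sum_congr rfl fun ℓ _ => by ring
    · intro ℓ _
      exact Chebyshev.integrable_measureT (by fun_prop)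
  rw [Finset.sum_eq_single_of_mem k (Finset.mem_range.2 (by omega)) (fun ℓ _ hℓ => by
    rw [Chebyshev.integral_eval_T_real_mul_eval_T_real_measureT_of_ne hℓ, mul_zero])] at h1
  have h2 : |∫ x, h.eval (2 * √d * x) * (Chebyshev.T ℝ k).eval x ∂Chebyshev.measureT| ≤
      δ * Real.pi := by
    rw [Chebyshev.integral_measureT_eq_integral_cos
      (f := fun x => h.eval (2 * √d * x) * (Chebyshev.T ℝ k).eval x)]
    have := intervalIntegral.norm_integral_le_of_norm_le_const (a := 0) (b := Real.pi) (C := δ)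
      (f := fun θ => h.eval (2 * √d * Real.cos θ) * (Chebyshev.T ℝ k).eval (Real.cos θ)) ?_
    · rwa [sub_zero, abs_of_pos Real.pi_pos] at this
    · intro θ _
      rw [Real.norm_eq_abs, abs_mul]
      have e1 := hb (2 * √d * Real.cos θ) (by
        rw [abs_mul, abs_of_nonneg (by positivity)]
        exact mul_le_of_le_one_right (by positivity) (Real.abs_cos_le_one θ))
      have e2 := Chebyshev.abs_eval_T_real_le_one k (Real.abs_cos_le_one θ)
      calc _ ≤ δ * 1 := mul_le_mul e1 e2 (abs_nonneg _) hδ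
        _ = δ := mul_one δ
  have h3 : Real.pi / 2 ≤
      ∫ x, (Chebyshev.T ℝ k).eval x * (Chebyshev.T ℝ k).eval x ∂Chebyshev.measureT := by
    rcases eq_or_ne k 0 with rfl | hk0
    · rw [Nat.cast_zero, Chebyshev.integral_eval_T_real_mul_self_measureT_zero]
      linarith [Real.pi_pos]
    · rw [Chebyshev.integral_T_real_mul_self_measureT_of_ne_zero hk0]
  rw [h1, abs_mul, abs_mul, abs_of_nonneg (by positivity : 0 ≤ 2 * √(d : ℝ) ^ k),
    abs_of_nonneg ((by positivity : 0 ≤ Real.pi / 2).trans h3)] at h2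
  have h4 : |γ k| * (2 * √d ^ k) * (Real.pi / 2) ≤ δ * Real.pi :=
    le_trans (by gcongr) h2
  refine le_of_mul_le_mul_right (le_trans (le_of_eq ?_) h4) Real.pi_pos
  ring

end ChebExpansion

section Markov

open Polynomial

lemma iterate_derivative_T_one_nonneg (s k : ℕ) :
    0 ≤ (derivative^[k] (Chebyshev.T ℝ s)).eval 1 :=
  (abs_nonneg _).trans (Chebyshev.abs_iterate_derivative_T_real_le s k (x := 1) (by simp))

lemma iterate_derivative_T_one_le (s k : ℕ) :
    (derivative^[k] (Chebyshev.T ℝ s)).eval 1 ≤ ((s : ℝ) ^ 2) ^ k := by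
  induction k with
  | zero => simp
  | succ k ih =>
    have h := Chebyshev.iterate_derivative_T_eval_one_recurrence (R := ℝ) s k
    have h0 := iterate_derivative_T_one_nonneg s k
    have h1 := iterate_derivative_T_one_nonneg s (k + 1)
    push_cast at h
    calc _ ≤ (2 * (k : ℝ) + 1) * (derivative^[k + 1] (Chebyshev.T ℝ s)).eval 1 := by
            nlinarith [mul_nonneg (Nat.cast_nonneg (α := ℝ) k) h1]
      _ = ((s : ℝ) ^ 2 - k ^ 2) * (derivative^[k] (Chebyshev.T ℝ s)).eval 1 := h
      _ ≤ (s : ℝ) ^ 2 * (derivative^[k] (Chebyshev.T ℝ s)).eval 1 := by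
            gcongr
            nlinarith
      _ ≤ (s : ℝ) ^ 2 * ((s : ℝ) ^ 2) ^ k := by gcongr
      _ = _ := by ring

lemma iterate_derivative_comp_affine (P : ℝ[X]) (a b : ℝ) (k : ℕ) :
    derivative^[k] (P.comp (C a + C b * X)) =
      C (b ^ k) * (derivative^[k] P).comp (C a + C b * X) := by
  induction k with
  | zero => simp
  | succ k ih =>
    rw [Function.iterate_succ_apply', ih, Function.iterate_succ_apply']
    simp only [derivative_mul, derivative_C, derivative_comp, derivative_add, derivative_X,
      zero_mul,
      zero_add, mul_one, pow_succ, C_mul]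
    ring

/-- V. Markov's inequality at the endpoint `e` of the segment with endpoints `e` and `f`. -/
lemma abs_iterate_derivative_endpoint_le {P : ℝ[X]} {s : ℕ} (hs : P.natDegree ≤ s) {e f A : ℝ}
    (hef : e ≠ f) (hA : 0 < A) (hP : ∀ x ∈ Set.uIcc e f, |P.eval x| ≤ A) (k : ℕ) :
    |(derivative^[k] P).eval e| ≤ A * (2 * (s : ℝ) ^ 2 / |f - e|) ^ k := by
  set a := (e + f) / 2 with ha
  set b := (e - f) / 2 with hb
  have hb0 : 0 < |b| := abs_pos.2 (by rw [hb]; exact div_ne_zero (sub_ne_zero.2 hef) two_ne_zero)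
  have key : ∀ c : ℝ, |c| = A⁻¹ →
      c * (b ^ k * (derivative^[k] P).eval e) ≤ ((s : ℝ) ^ 2) ^ k := by
    intro c hc
    refine le_trans ?_ (iterate_derivative_T_one_le s k)
    have := Chebyshev.eval_iterate_derivative_le_of_forall_abs_le_one (n := s) (k := k) (x := 1)
      (P := C c * P.comp (C a + C b * X)) le_rfl ?_ ?_
    · rw [iterate_derivative_C_mul, iterate_derivative_comp_affine] at this
      simp only [eval_mul, eval_C, eval_comp, eval_add, eval_X, mul_one] at this
      rwa [show a + b = e by rw [ha, hb]; ring] at this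
    · refine natDegree_le_iff_degree_le.1 ((natDegree_C_mul_le _ _).trans ?_)
      rw [natDegree_comp]
      have : (C a + C b * X : ℝ[X]).natDegree ≤ 1 := by compute_degree
      calc _ ≤ s * 1 := Nat.mul_le_mul hs this
        _ = s := mul_one s
    · intro x hx
      simp only [eval_mul, eval_C, eval_comp, eval_add, eval_X]
      rw [abs_mul, hc]
      have : |P.eval (a + b * x)| ≤ A := by
        refine hP _ ?_
        rw [Set.mem_Icc] at hx
        rw [Set.mem_uIcc, ha, hb]
        rcases le_total e f with h | h
        · left; constructor <;> nlinarith
        · right; constructor <;> nlinarith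
      calc _ ≤ A⁻¹ * A := by gcongr
        _ = 1 := inv_mul_cancel₀ hA.ne'
  have h1 := key A⁻¹ (abs_of_pos (by positivity))
  have h2 := key (-A⁻¹) (by rw [abs_neg, abs_of_pos (by positivity)])
  have h3 : A⁻¹ * (|b| ^ k * |(derivative^[k] P).eval e|) ≤ ((s : ℝ) ^ 2) ^ k := by
    rw [← abs_pow, ← abs_mul, ← abs_of_pos (inv_pos.2 hA), ← abs_mul, abs_le]
    constructor <;> linarith
  have h4 : |f - e| = 2 * |b| := by
    rw [hb, abs_div, abs_two, abs_sub_comm]; ring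
  have h5 : 2 * (s : ℝ) ^ 2 / |f - e| = (s : ℝ) ^ 2 / |b| := by
    rw [h4]; field_simp
  rw [h5, div_pow]
  rw [inv_mul_le_iff₀ hA] at h3
  rw [← mul_div_assoc, le_div_iff₀ (by positivity)]
  linarith

/-- A polynomial bounded at the points `1 / N`, `N ≥ M` even, is bounded on `[0, 1 / M]`. -/
lemma abs_eval_le_two_of_sample {P : ℝ[X]} {s M : ℕ} (hs : P.natDegree ≤ s) (hM0 : 1 ≤ M)
    (hM : 16 * s ^ 2 ≤ 2 * M) (hP : ∀ N : ℕ, M ≤ N → |P.eval (1 / (2 * N : ℝ))| ≤ 1)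
    {x : ℝ} (hx : x ∈ Set.Icc (0 : ℝ) (1 / (2 * M))) : |P.eval x| ≤ 2 := by
  set b : ℝ := 1 / (2 * M) with hb
  have hM' : (1 : ℝ) ≤ M := by exact_mod_cast hM0
  have hb0 : 0 < b := by positivity
  obtain ⟨x₀, hx₀, hmax⟩ := isCompact_Icc.exists_isMaxOn (s := Set.Icc (0 : ℝ) b)
    (f := fun x => |P.eval x|) ⟨0, by simp [hb0.le]⟩ (by fun_prop)
  refine (hmax hx).trans ?_
  set A := |P.eval x₀| with hA
  change A ≤ 2
  rcases (abs_nonneg _ : 0 ≤ A).eq_or_lt with h0 | hApos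
  · linarith
  have hder : ∀ y ∈ Set.Icc (0 : ℝ) b, |P.derivative.eval y| ≤ A * (4 * (s : ℝ) ^ 2 / b) := by
    intro y hy
    obtain ⟨f, hf, hfy⟩ : ∃ f ∈ Set.Icc (0 : ℝ) b, b / 2 ≤ |f - y| := by
      rcases le_total y (b / 2) with h | h
      · exact ⟨b, ⟨hb0.le, le_rfl⟩, by rw [abs_of_nonneg] <;> linarith⟩
      · refine ⟨0, ⟨le_rfl, hb0.le⟩, ?_⟩
        rw [zero_sub, abs_neg, abs_of_nonneg hy.1]
        exact h
    have hne : y ≠ f := by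
      rintro rfl
      rw [sub_self, abs_zero] at hfy
      linarith
    have := abs_iterate_derivative_endpoint_le hs hne hApos
      (fun z hz => hmax (Set.uIcc_subset_Icc hy hf hz)) 1
    rw [pow_one, Function.iterate_one] at this
    refine this.trans ?_
    have : 2 * (s : ℝ) ^ 2 / |f - y| ≤ 2 * (s : ℝ) ^ 2 / (b / 2) := by gcongr
    calc _ ≤ A * (2 * (s : ℝ) ^ 2 / (b / 2)) := by gcongr
      _ = _ := by ring
  obtain ⟨N, hN, hdist⟩ : ∃ N : ℕ, M ≤ N ∧ |x₀ - 1 / (2 * N : ℝ)| ≤ 2 * b ^ 2 := by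
    rcases le_or_gt x₀ (2 * b ^ 2) with h | h
    · refine ⟨M ^ 2, Nat.le_self_pow (by norm_num) M, ?_⟩
      have : 1 / (2 * ((M ^ 2 : ℕ) : ℝ)) = 2 * b ^ 2 := by
        rw [hb]; push_cast; field_simp
      rw [this, abs_of_nonpos (by linarith)]
      linarith [hx₀.1]
    · have hx0 : 0 < x₀ := lt_of_le_of_lt (by positivity) h
      set N := ⌊1 / (2 * x₀)⌋₊ with hNdef
      have hMN : M ≤ N := by
        refine Nat.le_floor ?_
        rw [le_div_iff₀ (by positivity)]
        have := hx₀.2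
        rw [hb, le_div_iff₀ (by positivity)] at this
        linarith
      have hN1 : (1 : ℝ) ≤ N := by exact_mod_cast hM0.trans hMN
      have hMN' : (M : ℝ) ≤ N := by exact_mod_cast hMN
      have h1 : (N : ℝ) ≤ 1 / (2 * x₀) := Nat.floor_le (by positivity)
      have h2 : 1 / (2 * x₀) < N + 1 := Nat.lt_floor_add_one _
      rw [le_div_iff₀ (by positivity)] at h1
      rw [div_lt_iff₀ (by positivity)] at h2
      refine ⟨N, hMN, ?_⟩
      have h3 : x₀ ≤ 1 / (2 * N) := by
        rw [le_div_iff₀ (by positivity)]; linarith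
      have h4 : 1 / (2 * (N + 1 : ℝ)) ≤ x₀ := by
        rw [div_le_iff₀ (by positivity)]; linarith
      rw [abs_of_nonpos (by linarith)]
      calc -(x₀ - 1 / (2 * N : ℝ)) ≤ 1 / (2 * N) - 1 / (2 * (N + 1 : ℝ)) := by linarith
        _ = 1 / (2 * N * (N + 1)) := by field_simp; ring
        _ ≤ 1 / (2 * M * M) := by
          gcongr
          linarith
        _ = 2 * b ^ 2 := by rw [hb]; field_simp
  have hNmem : 1 / (2 * N : ℝ) ∈ Set.Icc (0 : ℝ) b := by
    refine ⟨by positivity, ?_⟩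
    rw [hb]
    have : (M : ℝ) ≤ N := by exact_mod_cast hN
    gcongr
  have hlip := (convex_Icc (0 : ℝ) b).norm_image_sub_le_of_norm_deriv_le
    (f := fun y => P.eval y) (C := A * (4 * (s : ℝ) ^ 2 / b))
    (fun y _ => P.differentiable.differentiableAt)
    (fun y hy => by rw [Polynomial.deriv]; exact hder y hy) hNmem hx₀
  simp only [Real.norm_eq_abs] at hlip
  have hfin : A * (4 * (s : ℝ) ^ 2 / b) * |x₀ - 1 / (2 * N : ℝ)| ≤ A / 2 := by
    calc _ ≤ A * (4 * (s : ℝ) ^ 2 / b) * (2 * b ^ 2) := by gcongr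
      _ = A / 2 * (16 * s ^ 2 * b) := by field_simp; ring
      _ ≤ A / 2 * 1 := by
        gcongr
        rw [hb, mul_one_div, div_le_one (by positivity)]
        exact_mod_cast hM
      _ = A / 2 := mul_one _
  have := hP N hN
  have h6 : A ≤ |P.eval (1 / (2 * N : ℝ))| + |P.eval x₀ - P.eval (1 / (2 * N : ℝ))| := by
    have := abs_add_le (P.eval (1 / (2 * N : ℝ))) (P.eval x₀ - P.eval (1 / (2 * N : ℝ)))
    rwa [add_sub_cancel] at this
  linarith

lemma abs_coeff_le_of_sample {P : ℝ[X]} {s M : ℕ} (hs : P.natDegree ≤ s) (hM0 : 1 ≤ M)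
    (hM : 16 * s ^ 2 ≤ 2 * M) (hP : ∀ N : ℕ, M ≤ N → |P.eval (1 / (2 * N : ℝ))| ≤ 1) (k : ℕ) :
    |P.coeff k| ≤ 2 * (4 * (M : ℝ) * s ^ 2) ^ k := by
  have hM' : (1 : ℝ) ≤ M := by exact_mod_cast hM0
  have h1 := abs_iterate_derivative_endpoint_le hs (e := 0) (f := 1 / (2 * M)) (A := 2)
    (by positivity) two_pos (fun y hy => abs_eval_le_two_of_sample hs hM0 hM hP
      (by rwa [Set.uIcc_of_le (by positivity)] at hy)) k
  rw [← coeff_zero_eq_eval_zero, coeff_iterate_derivative, zero_add, Nat.descFactorial_self,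
    nsmul_eq_mul, abs_mul, Nat.abs_cast, sub_zero,
    abs_of_pos (by positivity : 0 < 1 / (2 * (M : ℝ)))] at h1
  have h2 : (1 : ℝ) ≤ (k.factorial : ℝ) := by exact_mod_cast k.factorial_pos
  calc |P.coeff k| ≤ k.factorial * |P.coeff k| := le_mul_of_one_le_left (abs_nonneg _) h2
    _ ≤ _ := h1
    _ = _ := by congr 2; field_simp; ring

/-- Second order Taylor bound at `0` for a polynomial bounded at the points `1 / N`. -/
lemma abs_taylor_le_of_sample {P : ℝ[X]} {s M : ℕ} (hs : P.natDegree ≤ s) (hM0 : 1 ≤ M)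
    (hM : 16 * s ^ 2 ≤ 2 * M) (hP : ∀ N : ℕ, M ≤ N → |P.eval (1 / (2 * N : ℝ))| ≤ 1)
    {x : ℝ} (hx : 0 ≤ x) (hxM : 4 * (M : ℝ) * s ^ 2 * x ≤ 1 / 2) :
    |P.eval x - P.coeff 0 - P.coeff 1 * x| ≤ 64 * (M * s ^ 2 * x) ^ 2 := by
  have hM' : (1 : ℝ) ≤ M := by exact_mod_cast hM0
  have hcoef := abs_coeff_le_of_sample hs hM0 hM hP
  set r := 4 * (M : ℝ) * s ^ 2 * x with hr
  have hr0 : 0 ≤ r := by positivity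
  have e1 : P.eval x = ∑ k ∈ Finset.range (s + 2), P.coeff k * x ^ k :=
    eval_eq_sum_range' (by omega) x
  rw [Finset.sum_range_succ', Finset.sum_range_succ'] at e1
  rw [e1]
  have e2 : ∀ a b c : ℝ, a + b * x ^ (0 + 1) + c * x ^ 0 - c - b * x = a := fun a b c => by ring
  rw [show (∑ k ∈ Finset.range s, P.coeff (k + 1 + 1) * x ^ (k + 1 + 1) +
    P.coeff (0 + 1) * x ^ (0 + 1) + P.coeff 0 * x ^ 0 - P.coeff 0 - P.coeff 1 * x) =
    ∑ k ∈ Finset.range s, P.coeff (k + 1 + 1) * x ^ (k + 1 + 1) from e2 _ _ _]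
  calc _ ≤ ∑ k ∈ Finset.range s, |P.coeff (k + 1 + 1) * x ^ (k + 1 + 1)| :=
        Finset.abs_sum_le_sum_abs _ _
    _ ≤ ∑ k ∈ Finset.range s, 2 * r ^ 2 * (1 / 2 : ℝ) ^ k := by
      refine Finset.sum_le_sum fun k _ => ?_
      rw [abs_mul, abs_of_nonneg (pow_nonneg hx _)]
      calc _ ≤ 2 * (4 * (M : ℝ) * s ^ 2) ^ (k + 1 + 1) * x ^ (k + 1 + 1) := by
            gcongr; exact hcoef _
        _ = 2 * r ^ 2 * r ^ k := by rw [hr]; ring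
        _ ≤ _ := by gcongr
    _ = 2 * r ^ 2 * ∑ k ∈ Finset.range s, (1 / 2 : ℝ) ^ k := by rw [Finset.mul_sum]
    _ ≤ 2 * r ^ 2 * 2 := by
      gcongr
      rw [geom_sum_eq (by norm_num)]
      have : 0 < (1 / 2 : ℝ) ^ s := by positivity
      have h3 : ((1 / 2 : ℝ) ^ s - 1) / (1 / 2 - 1) = 2 * (1 - (1 / 2 : ℝ) ^ s) := by ring
      rw [h3]; linarith
    _ = _ := by rw [hr]; ring

end Markov

section SpectralTools

open Polynomial Matrix

variable {n : Type*} [Fintype n] [DecidableEq n] {A : Matrix n n ℝ}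

lemma trace_aeval_eq_sum (hA : A.IsHermitian) (h : ℝ[X]) :
    (aeval A h).trace = ∑ i, h.eval (hA.eigenvalues i) := by
  have e : ∀ v : n → ℝ, aeval (diagonal v) h = diagonal fun i => h.eval (v i) := by
    intro v
    have := aeval_algHom_apply (diagonalAlgHom ℝ (n := n) (α := ℝ)) v h
    rw [diagonalAlgHom_apply, diagonalAlgHom_apply] at this
    rw [this]
    congr 1
    ext i
    simp
  conv_lhs => rw [hA.spectral_theorem]
  have := aeval_algHom_apply (Unitary.conjStarAlgAut ℝ (Matrix n n ℝ) hA.eigenvectorUnitary)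
    (diagonal (RCLike.ofReal ∘ hA.eigenvalues)) h
  rw [this, e, Unitary.conjStarAlgAut_apply, trace_mul_comm, ← mul_assoc]
  simp [trace]

lemma eigenvalue_eq_form (hA : A.IsHermitian) (i : n) :
    ∃ v : n → ℝ, v ⬝ᵥ v = 1 ∧ A *ᵥ v = hA.eigenvalues i • v := by
  refine ⟨hA.eigenvectorBasis i, ?_, hA.mulVec_eigenvectorBasis i⟩
  have := hA.eigenvectorBasis.orthonormal.1 i
  rw [EuclideanSpace.norm_eq, Real.sqrt_eq_one] at this
  rw [← this, dotProduct]
  exact Finset.sum_congr rfl fun j _ => by rw [Real.norm_eq_abs, sq_abs, sq]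

lemma abs_eigenvalues_le_of_form (hA : A.IsHermitian) {c : ℝ}
    (hc : ∀ v, |v ⬝ᵥ A *ᵥ v| ≤ c * (v ⬝ᵥ v)) (i : n) : |hA.eigenvalues i| ≤ c := by
  obtain ⟨v, h1, h2⟩ := eigenvalue_eq_form hA i
  have := hc v
  rwa [h2, dotProduct_smul, h1, smul_eq_mul, mul_one, mul_one] at this

lemma form_le_of_abs_eigenvalues (hA : A.IsHermitian) {c : ℝ}
    (hc : ∀ i, |hA.eigenvalues i| ≤ c) (v : n → ℝ) : |v ⬝ᵥ A *ᵥ v| ≤ c * (v ⬝ᵥ v) := by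
  set Q : Matrix n n ℝ := hA.eigenvectorUnitary.1
  have hQ : Q * star Q = 1 := Unitary.coe_mul_star_self _
  have hA' := hA.spectral_theorem
  rw [Unitary.conjStarAlgAut_apply] at hA'
  change A = Q * diagonal (RCLike.ofReal ∘ hA.eigenvalues) * star Q at hA'
  set u := star Q *ᵥ v with hu
  have hv : v = Q *ᵥ u := by rw [hu, mulVec_mulVec, hQ, one_mulVec]
  have hvQ : v ᵥ* Q = u := by
    rw [hu, star_eq_conjTranspose, conjTranspose_eq_transpose_of_trivial, mulVec_transpose]
  have h1 : v ⬝ᵥ A *ᵥ v = ∑ i, hA.eigenvalues i * u i ^ 2 := by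
    have h0 : A *ᵥ v = Q *ᵥ (diagonal (RCLike.ofReal ∘ hA.eigenvalues) *ᵥ u) := by
      conv_lhs => rw [hA', ← mulVec_mulVec, ← mulVec_mulVec]
    rw [h0, dotProduct_mulVec, hvQ, dotProduct]
    refine Finset.sum_congr rfl fun i _ => ?_
    rw [mulVec_diagonal]
    simp
    ring
  have h2 : v ⬝ᵥ v = ∑ i, u i ^ 2 := by
    conv_lhs => rw [hv, dotProduct_mulVec, ← hv, hvQ]
    exact Finset.sum_congr rfl fun i _ => by ring
  rw [h1, h2, Finset.mul_sum]
  refine (Finset.abs_sum_le_sum_abs _ _).trans (Finset.sum_le_sum fun i _ => ?_)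
  rw [abs_mul, abs_of_nonneg (sq_nonneg (u i))]
  gcongr
  exact hc i

end SpectralTools

section TraceFormula

open Polynomial Matrix

lemma map_cycSum {M M' : Type*} [AddCommMonoid M] [AddCommMonoid M'] (φ : M →+ M') (d n : ℕ)
    (F : List (Fin (d + 1)) → M) : φ (cycSum d n F) = cycSum d n (fun w => φ (F w)) := by
  simp only [cycSum, map_sum]

lemma cycSum_congr {M : Type*} [AddCommMonoid M] {d n : ℕ} {F G : List (Fin (d + 1)) → M}
    (h : ∀ w, w.length = n + 1 → F w = G w) : cycSum d n F = cycSum d n G :=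
  Finset.sum_congr rfl fun _ _ => Finset.sum_congr rfl fun _ _ => Finset.sum_congr rfl fun w hw =>
    h w (mem_redWords_iff.1 hw).1

lemma cycSum_zero_length {M : Type*} [AddCommMonoid M] (d : ℕ) (F : List (Fin (d + 1)) → M) :
    cycSum d 0 F = 0 := by
  refine Finset.sum_eq_zero fun i _ => Finset.sum_eq_zero fun j hj => Finset.sum_eq_zero
    fun w hw => ?_
  obtain ⟨h1, -, h3, h4⟩ := mem_redWords_iff.1 hw
  obtain ⟨a, rfl⟩ := List.length_eq_one_iff.1 h1
  simp only [List.head?_cons, List.getLast?_singleton, Option.some.injEq] at h3 h4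
  exact absurd (h4.symm.trans h3) (Finset.ne_of_mem_erase hj)

variable {D : ℕ} {U : Type*} [Fintype U]

/-- The matrix of the map `f`. -/
def permMat (f : U → U) : Matrix U U ℝ := Matrix.of fun x y => if f x = y then 1 else 0

/-- The adjacency matrix of a union of `D` matchings. -/
def unionMat (σ : Fin D → U → U) : Matrix U U ℝ := ∑ i, permMat (σ i)

lemma permMat_mul (f g : U → U) : permMat f * permMat g = permMat (g ∘ f) := by
  ext x z
  simp only [permMat, mul_apply, of_apply, ite_mul, one_mul, zero_mul]
  rw [Finset.sum_ite_eq, if_pos (Finset.mem_univ _)]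
  rfl

lemma prod_map_permMat (σ : Fin D → U → U) (w : List (Fin D)) :
    (w.map fun i => permMat (σ i)).prod = permMat (run σ w) := by
  induction w with
  | nil =>
    ext x y
    simp only [List.map_nil, List.prod_nil, permMat, run, one_apply, of_apply]
    congr
  | cons i w ih =>
    rw [List.map_cons, List.prod_cons, ih, permMat_mul]
    rfl

lemma trace_permMat (f : U → U) :
    (permMat f).trace = ((Finset.univ.filter fun x => f x = x).card : ℝ) := by
  simp [permMat, trace]

lemma permMat_mulVec (f : U → U) (v : U → ℝ) (x : U) : (permMat f *ᵥ v) x = v (f x) := by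
  simp [permMat, mulVec, dotProduct]

lemma unionMat_mulVec (σ : Fin D → U → U) (v : U → ℝ) (x : U) :
    (unionMat σ *ᵥ v) x = ∑ i, v (σ i x) := by
  rw [unionMat, sum_mulVec, Finset.sum_apply]
  exact Finset.sum_congr rfl fun i _ => permMat_mulVec _ _ _

variable {σ : Fin D → U → U}

lemma unionMat_isHermitian (hσ : σ ∈ matchings D U) : (unionMat σ).IsHermitian := by
  rw [mem_matchings] at hσ
  rw [IsHermitian, conjTranspose_eq_transpose_of_trivial, unionMat, transpose_sum]
  refine Finset.sum_congr rfl fun i _ => ?_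
  ext x y
  simp only [permMat, transpose_apply, of_apply]
  congr 1
  exact propext ⟨fun h => by rw [← h, (hσ i _).1], fun h => by rw [← h, (hσ i _).1]⟩

lemma sum_comp_matching (hσ : σ ∈ matchings D U) (i : Fin D) (f : U → ℝ) :
    ∑ x, f (σ i x) = ∑ x, f x :=
  Equiv.sum_comp (Function.Involutive.toPerm (σ i) fun x => (mem_matchings.1 hσ i x).1) f

lemma abs_unionMat_form_le (hσ : σ ∈ matchings D U) (v : U → ℝ) :
    |v ⬝ᵥ unionMat σ *ᵥ v| ≤ D * (v ⬝ᵥ v) := by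
  have h1 : v ⬝ᵥ unionMat σ *ᵥ v = ∑ i, ∑ x, v x * v (σ i x) := by
    simp only [dotProduct, unionMat_mulVec, Finset.mul_sum]
    exact Finset.sum_comm
  have h2 : ∀ i, |∑ x, v x * v (σ i x)| ≤ v ⬝ᵥ v := by
    intro i
    have h3 : v ⬝ᵥ v = ∑ x, (v x ^ 2 + v (σ i x) ^ 2) / 2 := by
      rw [← Finset.sum_div, Finset.sum_add_distrib, sum_comp_matching hσ i fun x => v x ^ 2,
        dotProduct]
      simp only [← sq]
      ring
    rw [h3]
    refine (Finset.abs_sum_le_sum_abs _ _).trans (Finset.sum_le_sum fun x _ => ?_)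
    rw [abs_le]
    constructor <;> nlinarith [sq_nonneg (v x + v (σ i x)), sq_nonneg (v x - v (σ i x))]
  rw [h1]
  refine (Finset.abs_sum_le_sum_abs _ _).trans ((Finset.sum_le_sum fun i _ => h2 i).trans ?_)
  simp

/-- The constant term of the expansion of the expected trace. -/
def trConst (d q : ℕ) (γ : ℕ → ℝ) : ℝ :=
  2 * γ 0 - ((d : ℝ) - 1) * ∑ n ∈ Finset.range q, if Even n then 0 else γ (n + 1)

/-- The numerator, as a polynomial in `1 / N`, of the expected normalized trace of
`∑ ℓ, γ ℓ * chebQ d ℓ` at a random union of matchings on `N` vertices. -/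
def trPol (d q : ℕ) (γ : ℕ → ℝ) : ℝ[X] :=
  ∑ n ∈ Finset.range q, C (γ (n + 1)) * cycSum d n (wordPol q) +
    C (trConst d q γ) * den q (fun _ : Fin (d + 1) => 0)

theorem sum_trace_mul_den (d q : ℕ) (γ : ℕ → ℝ) :
    (∑ σ ∈ matchings (d + 1) U,
      (aeval (unionMat σ) (∑ ℓ ∈ Finset.range (q + 1), C (γ ℓ) * chebQ d ℓ)).trace) *
        (den q (fun _ : Fin (d + 1) => 0)).eval ((Fintype.card U : ℝ)⁻¹) =
      Fintype.card U * (trPol d q γ).eval ((Fintype.card U : ℝ)⁻¹) *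
        ((matchings (d + 1) U).card : ℝ) := by
  set N : ℝ := (Fintype.card U : ℝ) with hN
  set fixc : List (Fin (d + 1)) → (Fin (d + 1) → U → U) → ℝ := fun w σ =>
    ((Finset.univ.filter fun x => run σ w x = x).card : ℝ) with hfix
  have htr : ∀ σ ∈ matchings (d + 1) U,
      (aeval (unionMat σ) (∑ ℓ ∈ Finset.range (q + 1), C (γ ℓ) * chebQ d ℓ)).trace =
        ∑ n ∈ Finset.range q, γ (n + 1) * cycSum d n (fun w => fixc w σ) + N * trConst d q γ := by
    intro σ hσ
    have hs := mem_matchings.1 hσ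
    have h1 : ∀ n, (aeval (unionMat σ) (chebQ d (n + 1))).trace =
        cycSum d n (fun w => fixc w σ) + if Even n then 0 else -((d : ℝ) - 1) * N := by
      intro n
      have := trace_chebQ (P := fun i => permMat (σ i)) (tr := traceLinearMap U ℝ ℝ)
        (fun i => by
          rw [permMat_mul]
          ext x y
          simp [permMat, (hs i _).1, one_apply]) (fun a b => trace_mul_comm a b) n
      simp only [traceLinearMap_apply, prod_map_permMat, trace_permMat, trace_one] at this
      have h0 : (∑ i, permMat (σ i)).trace = 0 := by
        rw [trace_sum]
        refine Finset.sum_eq_zero fun i _ => ?_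
        rw [trace_permMat, Finset.filter_false_of_mem fun x _ => (hs i x).2]
        simp
      rw [h0] at this
      exact this
    have h2 : (aeval (unionMat σ) (chebQ d 0)).trace = 2 * N := by
      simp only [chebQ, map_ofNat]
      rw [← Nat.cast_ofNat, ← nsmul_one, trace_smul, trace_one]
      simp [hN]
    simp only [map_sum, map_mul, aeval_C, Algebra.algebraMap_eq_smul_one, smul_mul_assoc, one_mul,
      trace_sum, trace_smul, smul_eq_mul]
    rw [Finset.sum_range_succ', h2]
    simp only [h1, trConst, mul_add, Finset.sum_add_distrib, add_assoc]
    congr 1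
    have e : (∑ n ∈ Finset.range q, γ (n + 1) * if Even n then 0 else -((d : ℝ) - 1) * N) =
        -((d : ℝ) - 1) * N * ∑ n ∈ Finset.range q, if Even n then 0 else γ (n + 1) := by
      rw [Finset.mul_sum]
      refine Finset.sum_congr rfl fun n _ => ?_
      split_ifs <;> ring
    rw [e]
    ring
  rw [Finset.sum_congr rfl htr, Finset.sum_add_distrib, Finset.sum_const, nsmul_eq_mul,
    Finset.sum_comm, add_mul, Finset.sum_mul, trPol, eval_add, eval_finsetSum, mul_add, add_mul,
    Finset.mul_sum, Finset.sum_mul]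
  congr 1
  · refine Finset.sum_congr rfl fun n hn => ?_
    rw [Finset.mem_range] at hn
    rw [eval_mul, eval_C, ← Finset.mul_sum]
    set c := (den q (fun _ : Fin (d + 1) => 0)).eval N⁻¹
    have e1 : (∑ σ ∈ matchings (d + 1) U, cycSum d n fun w => fixc w σ) * c =
        cycSum d n fun w => (∑ σ ∈ matchings (d + 1) U, fixc w σ) * c := by
      have := map_cycSum (M := (Fin (d + 1) → U → U) → ℝ) (M' := ℝ)
        { toFun := fun f => (∑ σ ∈ matchings (d + 1) U, f σ) * c
          map_zero' := by simp
          map_add' := fun f g => by simp [Finset.sum_add_distrib, add_mul] } d n fixc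
      simp only [AddMonoidHom.coe_mk, ZeroHom.coe_mk] at this
      rw [← this]
      congr 1
      refine Finset.sum_congr rfl fun σ _ => ?_
      exact (map_cycSum (Pi.evalAddMonoidHom (fun _ => ℝ) σ) d n fixc).symm
    have e2 : N * (cycSum d n (wordPol q)).eval N⁻¹ * ((matchings (d + 1) U).card : ℝ) =
        cycSum d n fun w => N * (wordPol q w).eval N⁻¹ * ((matchings (d + 1) U).card : ℝ) := by
      have := map_cycSum (M := ℝ[X]) (M' := ℝ)
        { toFun := fun f => N * f.eval N⁻¹ * ((matchings (d + 1) U).card : ℝ)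
          map_zero' := by simp
          map_add' := fun f g => by simp [mul_add, add_mul] } d n (wordPol q)
      simpa using this
    have e3 := cycSum_congr (d := d) (n := n)
      (F := fun w => (∑ σ ∈ matchings (d + 1) U, fixc w σ) * c)
      (G := fun w => N * (wordPol q w).eval N⁻¹ * ((matchings (d + 1) U).card : ℝ))
      (fun w hw => sum_fix_mul_den q w (by omega))
    rw [← e1, ← e2] at e3
    linear_combination γ (n + 1) * e3
  · rw [eval_mul, eval_C]
    ring

lemma chebQ_eval_degree (d n : ℕ) : (chebQ d (n + 1)).eval ((d : ℝ) + 1) =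
    cycSum d n (fun _ => (1 : ℝ)) + if Even n then (d : ℝ) + 1 else -((d : ℝ) - 1) := by
  have := trace_chebQ (A := ℝ) (P := fun _ : Fin (d + 1) => (1 : ℝ)) (tr := LinearMap.id)
    (fun _ => one_mul 1) (fun a b => mul_comm a b) n
  simpa [coe_aeval_eq_eval] using this

end TraceFormula

section ExpectedTrace

open Polynomial Matrix

lemma eval_den_mem (d q : ℕ) {x : ℝ} (hx : 0 ≤ x) (hxq : 2 * q * x ≤ 1) :
    1 - (d + 1) * q * (2 * q * x) ≤ (den q (fun _ : Fin (d + 1) => 0)).eval x ∧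
      0 ≤ (den q (fun _ : Fin (d + 1) => 0)).eval x ∧
      (den q (fun _ : Fin (d + 1) => 0)).eval x ≤ 1 := by
  have hf : ∀ j ∈ Finset.Ico 0 q, 1 - 2 * q * x ≤ 1 - (2 * (j : ℝ) + 1) * x ∧
      1 - (2 * (j : ℝ) + 1) * x ≤ 1 := by
    intro j hj
    have : (j : ℝ) + 1 ≤ q := by exact_mod_cast (Finset.mem_Ico.1 hj).2
    constructor
    · gcongr; linarith
    · have : 0 ≤ (2 * (j : ℝ) + 1) * x := by positivity
      linarith
  have e : (den q (fun _ : Fin (d + 1) => 0)).eval x =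
      ∏ _i : Fin (d + 1), ∏ j ∈ Finset.Ico 0 q, (1 - (2 * (j : ℝ) + 1) * x) := by
    simp [den, eval_prod]
  have h0 : 0 ≤ 1 - 2 * q * x := by linarith
  have hp0 : 0 ≤ ∏ j ∈ Finset.Ico 0 q, (1 - (2 * (j : ℝ) + 1) * x) :=
    Finset.prod_nonneg fun j hj => h0.trans (hf j hj).1
  rw [e]
  refine ⟨?_, Finset.prod_nonneg fun _ _ => hp0, Finset.prod_le_one (fun _ _ => hp0) fun _ _ =>
    Finset.prod_le_one (fun j hj => h0.trans (hf j hj).1) fun j hj => (hf j hj).2⟩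
  have hlow : (1 - 2 * q * x) ^ q ≤ ∏ j ∈ Finset.Ico 0 q, (1 - (2 * (j : ℝ) + 1) * x) := by
    have := Finset.prod_le_prod (s := Finset.Ico 0 q) (f := fun _ => 1 - 2 * (q : ℝ) * x)
      (fun _ _ => h0) (fun j hj => (hf j hj).1)
    simpa using this
  have hlow2 : ((1 - 2 * q * x) ^ q) ^ (d + 1) ≤
      ∏ _i : Fin (d + 1), ∏ j ∈ Finset.Ico 0 q, (1 - (2 * (j : ℝ) + 1) * x) := by
    rw [Finset.prod_const, Finset.card_univ, Fintype.card_fin]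
    gcongr
  refine le_trans ?_ hlow2
  have := one_add_mul_le_pow (a := -(2 * (q : ℝ) * x)) (by linarith) (q * (d + 1))
  rw [← pow_mul]
  push_cast at this
  calc _ = 1 + (q : ℝ) * (d + 1) * -(2 * q * x) := by ring
    _ ≤ _ := this
    _ = _ := by rw [← sub_eq_add_neg]

lemma abs_trace_aeval_le {D : ℕ} {U : Type*} [Fintype U] {σ : Fin D → U → U}
    (hσ : σ ∈ matchings D U) {h : ℝ[X]} (hh : ∀ x : ℝ, |x| ≤ D → |h.eval x| ≤ 1) :
    |(aeval (unionMat σ) h).trace| ≤ Fintype.card U := by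
  rw [trace_aeval_eq_sum (unionMat_isHermitian hσ)]
  refine (Finset.abs_sum_le_sum_abs _ _).trans ((Finset.sum_le_sum fun i _ => hh _
    (abs_eigenvalues_le_of_form _ (abs_unionMat_form_le hσ) i)).trans ?_)
  simp

lemma natDegree_cycSum_wordPol_le (d q : ℕ) {n : ℕ} (hn : n < q) :
    (cycSum d n (wordPol q)).natDegree ≤ (d + 2) * q := by
  refine natDegree_sum_le_of_forall_le _ _ fun i _ => natDegree_sum_le_of_forall_le _ _
    fun j _ => natDegree_sum_le_of_forall_le _ _ fun w hw => ?_
  refine (natDegree_wordPol_le q w).trans ?_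
  rw [(mem_redWords_iff.1 hw).1]
  nlinarith

lemma natDegree_trPol_le (d q : ℕ) (γ : ℕ → ℝ) : (trPol d q γ).natDegree ≤ (d + 2) * q := by
  refine natDegree_add_le_of_degree_le (natDegree_sum_le_of_forall_le _ _ fun n hn =>
    (natDegree_C_mul_le _ _).trans (natDegree_cycSum_wordPol_le d q (Finset.mem_range.1 hn)))
    ((natDegree_C_mul_le _ _).trans ((natDegree_den_le _ _).trans ?_))
  nlinarith

lemma coeff_cycSum_wordPol (d q n k : ℕ) : (cycSum d n (wordPol q)).coeff k =
    cycSum d n (fun w => (wordPol q w).coeff k) :=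
  map_cycSum (Polynomial.lcoeff ℝ k).toAddMonoidHom d n (wordPol q)

lemma coeff_zero_trPol (d q : ℕ) (γ : ℕ → ℝ) : (trPol d q γ).coeff 0 = trConst d q γ := by
  rw [trPol, coeff_add, finsetSum_coeff, coeff_C_mul, coeff_zero_den, mul_one, Finset.sum_eq_zero,
    zero_add]
  intro n _
  rw [coeff_C_mul, coeff_cycSum_wordPol]
  refine mul_eq_zero_of_right _ (Finset.sum_eq_zero fun i _ => Finset.sum_eq_zero fun j _ =>
    Finset.sum_eq_zero fun w hw => coeff_zero_wordPol hw)

/-- The polynomial `trPol` is bounded by `1` at inverse even integers. -/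
lemma abs_eval_trPol_le_of_card (U : Type*) [Fintype U] {d q : ℕ} {γ : ℕ → ℝ} {h : ℝ[X]}
    (hh : h = ∑ ℓ ∈ Finset.range (q + 1), C (γ ℓ) * chebQ d ℓ)
    (hb : ∀ x, |x| ≤ (d : ℝ) + 1 → |h.eval x| ≤ 1) {k : ℕ} (hk : 1 ≤ k) (hqk : q ≤ k)
    (hU : Fintype.card U = 2 * k) (hne : (matchings (d + 1) U).Nonempty) :
    |(trPol d q γ).eval (1 / (2 * k : ℝ))| ≤ 1 := by
  have key := sum_trace_mul_den (U := U) d q γ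
  have hcard : ((Fintype.card U : ℕ) : ℝ) = 2 * k := by
    rw [hU]; push_cast; rfl
  rw [hcard, ← one_div, ← hh] at key
  have hk' : (1 : ℝ) ≤ k := by exact_mod_cast hk
  have hqk' : (q : ℝ) ≤ k := by exact_mod_cast hqk
  obtain ⟨-, hd0, hd1⟩ := eval_den_mem d q (x := 1 / (2 * k : ℝ)) (by positivity) (by
    rw [mul_one_div, div_le_one (by positivity)]; linarith)
  set m : ℝ := ((matchings (d + 1) U).card : ℝ) with hm
  have hm0 : 0 < m := by
    rw [hm]; exact_mod_cast hne.card_pos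
  have hT : |∑ σ ∈ matchings (d + 1) U, (aeval (unionMat σ) h).trace| ≤
      m * (2 * k) := by
    refine (Finset.abs_sum_le_sum_abs _ _).trans ((Finset.sum_le_sum fun σ hσ =>
      abs_trace_aeval_le hσ (by push_cast; exact hb)).trans ?_)
    rw [Finset.sum_const, nsmul_eq_mul, hcard]
  have h1 : |2 * k * (trPol d q γ).eval (1 / (2 * k : ℝ)) * m| ≤ m * (2 * k) := by
    rw [← key, abs_mul, abs_of_nonneg hd0]
    exact (mul_le_of_le_one_right (abs_nonneg _) hd1).trans hT
  rw [abs_mul, abs_mul, abs_of_pos hm0, abs_of_pos (by positivity : (0 : ℝ) < 2 * k)] at h1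
  have h2 : (2 * k * m) * |(trPol d q γ).eval (1 / (2 * k : ℝ))| ≤ (2 * k * m) * 1 := by linarith
  exact le_of_mul_le_mul_left h2 (by positivity)

lemma abs_eval_trPol_le {d q : ℕ} {γ : ℕ → ℝ} {h : ℝ[X]}
    (hh : h = ∑ ℓ ∈ Finset.range (q + 1), C (γ ℓ) * chebQ d ℓ)
    (hb : ∀ x, |x| ≤ (d : ℝ) + 1 → |h.eval x| ≤ 1) {k : ℕ} (hk : 1 ≤ k) (hqk : q ≤ k) :
    |(trPol d q γ).eval (1 / (2 * k : ℝ))| ≤ 1 :=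
  abs_eval_trPol_le_of_card (Fin k × Bool) hh hb hk hqk (by simp [mul_comm])
    (matchings_nonempty (d + 1) k)

end ExpectedTrace

section ExpectedTraceBound

open Polynomial Matrix

variable {d q : ℕ} {γ : ℕ → ℝ} {δ : ℝ}

lemma abs_trConst_le (hd : 1 ≤ d) (hq : 1 ≤ q) (hγ : ∀ k ≤ q, |γ k| * √d ^ k ≤ δ) :
    |trConst d q γ| ≤ (d + 2) * q * δ := by
  have hd1 : (1 : ℝ) ≤ d := by exact_mod_cast hd
  have hq1 : (1 : ℝ) ≤ q := by exact_mod_cast hq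
  have hγ' : ∀ k ≤ q, |γ k| ≤ δ := fun k hk =>
    (le_mul_of_one_le_right (abs_nonneg _) (one_le_pow₀ (Real.one_le_sqrt.2 hd1))).trans (hγ k hk)
  have hδ : 0 ≤ δ := (abs_nonneg _).trans (hγ' 0 (Nat.zero_le _))
  have h1 : |∑ n ∈ Finset.range q, if Even n then 0 else γ (n + 1)| ≤ q * δ := by
    refine (Finset.abs_sum_le_sum_abs _ _).trans ((Finset.sum_le_sum (g := fun _ => δ)
      fun n hn => ?_).trans (by simp))
    split_ifs
    · simpa using hδ
    · exact hγ' _ (Finset.mem_range.1 hn)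
  have h0 := hγ' 0 (Nat.zero_le _)
  rw [trConst]
  refine (abs_sub _ _).trans ?_
  rw [abs_mul, abs_mul, abs_two, abs_of_nonneg (by linarith : (0 : ℝ) ≤ d - 1)]
  calc 2 * |γ 0| + ((d : ℝ) - 1) * |∑ n ∈ Finset.range q, if Even n then 0 else γ (n + 1)|
      ≤ 2 * δ + ((d : ℝ) - 1) * (q * δ) := by
        gcongr
    _ ≤ 2 * (q * δ) + ((d : ℝ) - 1) * (q * δ) := by
        gcongr
        exact le_mul_of_one_le_left hδ hq1
    _ ≤ _ := by nlinarith [mul_nonneg (by positivity : (0 : ℝ) ≤ q) hδ]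

lemma abs_coeff_one_trPol_sub_le (hd : 1 ≤ d) (hq : 1 ≤ q) (hγ : ∀ k ≤ q, |γ k| * √d ^ k ≤ δ) :
    |(trPol d q γ).coeff 1 - (∑ ℓ ∈ Finset.range (q + 1), C (γ ℓ) * chebQ d ℓ).eval ((d : ℝ) + 1)|
      ≤ 68 * (((d : ℝ) + 2) * q) ^ 5 * δ := by
  set s : ℝ := ((d : ℝ) + 2) * q with hs
  have hd1 : (1 : ℝ) ≤ d := by exact_mod_cast hd
  have hq1 : (1 : ℝ) ≤ q := by exact_mod_cast hq
  have hs1 : 1 ≤ s := by rw [hs]; nlinarith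
  have hγ' : ∀ k ≤ q, |γ k| ≤ δ := fun k hk =>
    (le_mul_of_one_le_right (abs_nonneg _) (one_le_pow₀ (Real.one_le_sqrt.2 hd1))).trans (hγ k hk)
  have hδ : 0 ≤ δ := (abs_nonneg _).trans (hγ' 0 (Nat.zero_le _))
  have hA := abs_trConst_le hd hq hγ
  have hden : |(den q (fun _ : Fin (d + 1) => 0)).coeff 1| ≤ 64 * s ^ 4 := by
    have := abs_coeff_le_of_sample (P := den q (fun _ : Fin (d + 1) => 0)) (s := (d + 2) * q)
      (M := 8 * ((d + 2) * q) ^ 2) ((natDegree_den_le _ _).trans (by nlinarith))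
      (Nat.succ_le_of_lt (by positivity)) (by linarith) (fun N hN => by
        have hqN : q ≤ N := by nlinarith [Nat.zero_le (d * q)]
        have hN1 : 1 ≤ N := hq.trans hqN
        have hN1' : (1 : ℝ) ≤ N := by exact_mod_cast hN1
        have hqN' : (q : ℝ) ≤ N := by exact_mod_cast hqN
        obtain ⟨-, h0, h1⟩ := eval_den_mem d q (x := 1 / (2 * N : ℝ)) (by positivity) (by
          rw [mul_one_div, div_le_one (by positivity)]; linarith)
        rwa [abs_of_nonneg h0]) 1
    refine this.trans (le_of_eq ?_)
    rw [hs]; push_cast; ring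
  have e1 : (trPol d q γ).coeff 1 = ∑ n ∈ Finset.range q, γ (n + 1) *
      cycSum d n (fun w => (wordPol q w).coeff 1) +
      trConst d q γ * (den q (fun _ : Fin (d + 1) => 0)).coeff 1 := by
    rw [trPol, coeff_add, finsetSum_coeff, coeff_C_mul]
    simp only [coeff_C_mul, coeff_cycSum_wordPol]
  have e2 : (∑ ℓ ∈ Finset.range (q + 1), C (γ ℓ) * chebQ d ℓ).eval ((d : ℝ) + 1) =
      ∑ n ∈ Finset.range q, γ (n + 1) * (cycSum d n (fun _ => (1 : ℝ)) +
        if Even n then (d : ℝ) + 1 else -((d : ℝ) - 1)) + 2 * γ 0 := by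
    rw [eval_finsetSum, Finset.sum_range_succ']
    simp only [eval_mul, eval_C, chebQ_eval_degree, chebQ, eval_ofNat]
    ring
  have e3 : (trPol d q γ).coeff 1 -
      (∑ ℓ ∈ Finset.range (q + 1), C (γ ℓ) * chebQ d ℓ).eval ((d : ℝ) + 1) =
      ∑ n ∈ Finset.range q, γ (n + 1) * ((cycSum d n (fun w => (wordPol q w).coeff 1) -
        cycSum d n (fun _ => (1 : ℝ))) - if Even n then (d : ℝ) + 1 else -((d : ℝ) - 1)) +
      (trConst d q γ * (den q (fun _ : Fin (d + 1) => 0)).coeff 1 - 2 * γ 0) := by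
    rw [e1, e2]
    simp only [mul_sub, mul_add, Finset.sum_sub_distrib, Finset.sum_add_distrib]
    ring
  have hterm : ∀ n ∈ Finset.range q,
      |γ (n + 1) * ((cycSum d n (fun w => (wordPol q w).coeff 1) -
        cycSum d n (fun _ => (1 : ℝ))) - if Even n then (d : ℝ) + 1 else -((d : ℝ) - 1))| ≤
      (s + (d + 1)) * δ := by
    intro n hn
    rw [Finset.mem_range] at hn
    have hn1 : ((n : ℝ) + 1) ≤ q := by exact_mod_cast hn
    have h1 : |cycSum d n (fun w => (wordPol q w).coeff 1) - cycSum d n (fun _ => (1 : ℝ))| ≤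
        s * √d ^ (n + 1) := by
      rcases Nat.eq_zero_or_pos n with rfl | hn0
      · rw [cycSum_zero_length, cycSum_zero_length, sub_zero, abs_zero]
        positivity
      refine (sum_coeff_one_wordPol d n q hn0 hd).trans ?_
      have h2 : (d : ℝ) ^ ((n + 1) / 2) ≤ √d ^ (n + 1) := by
        conv_lhs => rw [← Real.sq_sqrt (Nat.cast_nonneg (α := ℝ) d), ← pow_mul]
        exact pow_le_pow_right₀ (Real.one_le_sqrt.2 hd1) (by omega)
      have h3 : ((n : ℝ) + 1) * (d + 1) ≤ s := by rw [hs]; nlinarith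
      gcongr
    have h4 : |if Even n then (d : ℝ) + 1 else -((d : ℝ) - 1)| ≤ d + 1 := by
      split_ifs
      · rw [abs_of_nonneg (by positivity)]
      · rw [abs_neg, abs_of_nonneg (by linarith)]; linarith
    rw [abs_mul]
    calc _ ≤ |γ (n + 1)| * (s * √d ^ (n + 1) + (d + 1)) := by
          gcongr
          exact (abs_sub _ _).trans (add_le_add h1 h4)
      _ = s * (|γ (n + 1)| * √d ^ (n + 1)) + (d + 1) * |γ (n + 1)| := by ring
      _ ≤ s * δ + (d + 1) * δ := by
          gcongr
          · exact hγ _ hn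
          · exact hγ' _ hn
      _ = _ := by ring
  have hsum : |∑ n ∈ Finset.range q, γ (n + 1) *
      ((cycSum d n (fun w => (wordPol q w).coeff 1) - cycSum d n (fun _ => (1 : ℝ))) -
        if Even n then (d : ℝ) + 1 else -((d : ℝ) - 1))| ≤ q * ((s + (d + 1)) * δ) := by
    refine (Finset.abs_sum_le_sum_abs _ _).trans ((Finset.sum_le_sum hterm).trans ?_)
    rw [Finset.sum_const, nsmul_eq_mul, Finset.card_range]
  have h0 := hγ' 0 (Nat.zero_le _)
  have hrest : |trConst d q γ * (den q (fun _ : Fin (d + 1) => 0)).coeff 1 - 2 * γ 0| ≤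
      s * δ * (64 * s ^ 4) + 2 * δ := by
    refine (abs_sub _ _).trans ?_
    rw [abs_mul, abs_mul, abs_two]
    gcongr
  rw [e3]
  refine (abs_add_le _ _).trans ((add_le_add hsum hrest).trans ?_)
  have hqs : (q : ℝ) ≤ s := by rw [hs]; nlinarith
  have hqds : (q : ℝ) * (d + 1) ≤ s := by rw [hs]; nlinarith
  have hs5 : s ≤ s ^ 5 := le_self_pow₀ hs1 (by norm_num)
  have hs25 : s ^ 2 ≤ s ^ 5 := pow_le_pow_right₀ hs1 (by norm_num)
  calc _ = ((q * s + q * (d + 1)) + 64 * s ^ 5 + 2) * δ := by ring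
    _ ≤ 68 * s ^ 5 * δ := by
      gcongr
      nlinarith

lemma main_term_le {s k x δ Δ H c A E : ℝ} (hs1 : 1 ≤ s) (hk1 : 1 ≤ 2 * k) (hδ0 : 0 ≤ δ)
    (hx0 : 0 ≤ x) (hkx : 2 * k * x = 1) (t1 : E - A - c * x ≤ 64 * (8 * s ^ 2 * s ^ 2 * x) ^ 2)
    (t2 : A ≤ s * δ) (t3 : c - H ≤ 68 * s ^ 5 * δ) (t4 : H * (1 - Δ) ≤ 1 * (2 * s ^ 2 * x)) :
    2 * k * E - H * Δ ≤ 5000 * s ^ 8 * (2 * k * δ + x) := by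
  have hk0 : 0 ≤ k := by linarith
  have t5 : 2 * k * E - H * Δ = 2 * k * (E - A - c * x) + 2 * k * A + (c - H) + H * (1 - Δ) := by
    linear_combination c * hkx
  have t6 : 2 * k * (E - A - c * x) ≤ 4096 * (s ^ 8 * x) := by
    calc _ ≤ 2 * k * (64 * (8 * s ^ 2 * s ^ 2 * x) ^ 2) := by gcongr
      _ = 4096 * (s ^ 8 * x) * (2 * k * x) := by ring
      _ = _ := by rw [hkx, mul_one]
  have t7 : 2 * k * A ≤ s ^ 8 * (2 * k * δ) := by
    have : s ≤ s ^ 8 := le_self_pow₀ hs1 (by norm_num)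
    calc _ ≤ 2 * k * (s * δ) := by gcongr
      _ = s * (2 * k * δ) := by ring
      _ ≤ _ := by gcongr
  have t8 : c - H ≤ 68 * (s ^ 8 * (2 * k * δ)) := by
    have : s ^ 5 ≤ s ^ 8 := pow_le_pow_right₀ hs1 (by norm_num)
    have h2 : δ ≤ 2 * k * δ := le_mul_of_one_le_left hδ0 hk1
    refine t3.trans ?_
    rw [mul_assoc]
    gcongr
  have t9 : s ^ 2 * x ≤ s ^ 8 * x := by
    have : s ^ 2 ≤ s ^ 8 := pow_le_pow_right₀ hs1 (by norm_num)
    gcongr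
  have t10 : 0 ≤ s ^ 8 * (2 * k * δ) := by positivity
  have t11 : 0 ≤ s ^ 8 * x := by positivity
  have t12 : 5000 * s ^ 8 * (2 * k * δ + x) =
      5000 * (s ^ 8 * (2 * k * δ)) + 5000 * (s ^ 8 * x) := by
    ring
  rw [t5, t12]
  linarith

/-- The expected trace of `h` at a random union of matchings exceeds the contribution of the
trivial eigenvalue by little. -/
theorem sum_trace_sub_le {U : Type*} [Fintype U] (hd : 1 ≤ d) (hq : 1 ≤ q) {h : ℝ[X]}
    (hdeg : h.natDegree ≤ q) (hb : ∀ x, |x| ≤ (d : ℝ) + 1 → |h.eval x| ≤ 1)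
    (hδ : ∀ x, |x| ≤ 2 * √d → |h.eval x| ≤ δ) {k : ℕ} (hk : 32 * ((d + 2) * q) ^ 4 ≤ k)
    (hU : Fintype.card U = 2 * k) :
    ∑ σ ∈ matchings (d + 1) U, ((aeval (unionMat σ) h).trace - h.eval ((d : ℝ) + 1)) ≤
      10000 * (((d : ℝ) + 2) * q) ^ 8 * (2 * k * δ + 1 / (2 * k)) *
        ((matchings (d + 1) U).card : ℝ) := by
  obtain ⟨γ, hγh⟩ := exists_chebQ_expansion d q h hdeg
  have hγ : ∀ k ≤ q, |γ k| * √d ^ k ≤ δ := fun k hk => abs_chebQ_coeff_le (hγh ▸ hδ) hk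
  set s : ℝ := ((d : ℝ) + 2) * q with hs
  set m : ℝ := ((matchings (d + 1) U).card : ℝ) with hm
  have hd1 : (1 : ℝ) ≤ d := by exact_mod_cast hd
  have hq1 : (1 : ℝ) ≤ q := by exact_mod_cast hq
  have hs1 : 1 ≤ s := by rw [hs]; nlinarith
  have hδ0 : 0 ≤ δ := (abs_nonneg _).trans (hδ 0 (by simp))
  have hk' : 32 * s ^ 4 ≤ k := by rw [hs]; exact_mod_cast hk
  have hs4 : 1 ≤ s ^ 4 := one_le_pow₀ hs1
  have hk1 : (1 : ℝ) ≤ k := by linarith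
  set x : ℝ := 1 / (2 * k) with hx
  have hx0 : 0 < x := by positivity
  have hkx : 2 * k * x = 1 := by rw [hx]; field_simp
  have hsx : 64 * s ^ 4 * x ≤ 1 := by
    calc 64 * s ^ 4 * x = 2 * (32 * s ^ 4) * x := by ring
      _ ≤ 2 * k * x := by gcongr
      _ = 1 := hkx
  have hqs : (q : ℝ) ≤ s := by rw [hs]; nlinarith
  have hdqs : ((d : ℝ) + 1) * q ≤ s := by rw [hs]; nlinarith
  have hss4 : s ^ 2 ≤ s ^ 4 := pow_le_pow_right₀ hs1 (by norm_num)
  have hs4' : s ≤ s ^ 4 := le_self_pow₀ hs1 (by norm_num)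
  obtain ⟨hden, hden0, hden1⟩ := eval_den_mem d q hx0.le (by nlinarith : 2 * (q : ℝ) * x ≤ 1)
  set Δ := (den q (fun _ : Fin (d + 1) => 0)).eval x with hΔ
  have hdenl : 1 - 2 * s ^ 2 * x ≤ Δ := by
    refine le_trans ?_ hden
    have : (d + 1) * q * (2 * q * x) ≤ s * (2 * s * x) := by gcongr
    nlinarith
  have hdenh : 1 / 2 ≤ Δ := by
    have : 2 * s ^ 2 * x ≤ 2 * s ^ 4 * x := by gcongr
    linarith
  have key := sum_trace_mul_den (U := U) d q γ
  rw [hU, ← hγh, ← one_div] at key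
  push_cast at key
  rw [← hx, ← hΔ, ← hm] at key
  set P := trPol d q γ with hP
  have htay := abs_taylor_le_of_sample (P := P) (s := (d + 2) * q) (M := 8 * ((d + 2) * q) ^ 2)
    (natDegree_trPol_le d q γ) (Nat.succ_le_of_lt (by positivity)) (by linarith)
    (fun N hN => by
      have hqN : q ≤ N := by nlinarith [Nat.zero_le (d * q)]
      exact abs_eval_trPol_le hγh hb (hq.trans hqN) hqN) hx0.le (by
        push_cast
        rw [← hs]
        calc _ = (64 * s ^ 4 * x) / 2 := by ring
          _ ≤ 1 / 2 := by linarith)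
  push_cast at htay
  rw [← hs, coeff_zero_trPol] at htay
  have hA := abs_trConst_le hd hq hγ
  rw [← hs] at hA
  have h1 := abs_coeff_one_trPol_sub_le hd hq hγ
  rw [← hγh, ← hs, ← hP] at h1
  have hhD := hb ((d : ℝ) + 1) (by rw [abs_of_nonneg (by positivity)])
  set H := h.eval ((d : ℝ) + 1) with hH
  rw [Finset.sum_sub_distrib, Finset.sum_const, nsmul_eq_mul, ← hm]
  set T := ∑ σ ∈ matchings (d + 1) U, (aeval (unionMat σ) h).trace with hT
  have hm0 : 0 ≤ m := by rw [hm]; positivity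
  set B := 5000 * s ^ 8 * (2 * k * δ + x) with hB
  have hB0 : 0 ≤ B := by positivity
  have hmain : 2 * k * P.eval x - H * Δ ≤ B :=
    main_term_le hs1 (by linarith) hδ0 hx0.le hkx (abs_le.1 htay).2 (abs_le.1 hA).2 (abs_le.1 h1).2
      (mul_le_mul (abs_le.1 hhD).2 (by linarith) (by linarith) zero_le_one)
  have hfin : (T - m * H) * Δ ≤ B * m := by
    have : (T - m * H) * Δ = (2 * k * P.eval x - H * Δ) * m := by linear_combination key
    rw [this]
    gcongr
  rcases le_or_gt (T - m * H) 0 with h0 | h0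
  · refine h0.trans ?_
    positivity
  · have : (T - m * H) * (1 / 2) ≤ B * m := (mul_le_mul_of_nonneg_left hdenh h0.le).trans hfin
    rw [hB] at this
    linarith

end ExpectedTraceBound

section SpectralEvent

open Polynomial Matrix

/-- A polynomial separating `[-ρ, ρ]` from `ρ + 1 ≤ |x| ≤ M`. -/
lemma exists_separating_polynomial (ρ M : ℝ) : ∃ h : ℝ[X],
    (∀ x, |x| ≤ M → 0 ≤ h.eval x ∧ h.eval x ≤ 1) ∧
    (∀ x, |x| ≤ M → |x| ≤ ρ → h.eval x ≤ 1 / 4) ∧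
    ∀ x, |x| ≤ M → ρ + 1 ≤ |x| → 3 / 4 ≤ h.eval x := by
  obtain ⟨h, hh⟩ := exists_polynomial_near_of_continuousOn (-M) M
    (fun x => max (1 / 8) (min (7 / 8) (|x| - ρ))) (by fun_prop) (1 / 8) (by norm_num)
  refine ⟨h, fun x hx => ?_, fun x hx hx' => ?_, fun x hx hx' => ?_⟩ <;>
    have h1 := abs_lt.1 (hh x (abs_le.1 hx))
  · have h2 : (1 / 8 : ℝ) ≤ max (1 / 8) (min (7 / 8) (|x| - ρ)) := le_max_left _ _
    have h3 : max (1 / 8) (min (7 / 8) (|x| - ρ)) ≤ (7 / 8 : ℝ) :=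
      max_le (by norm_num) (min_le_left _ _)
    constructor <;> linarith
  · have h3 : max (1 / 8) (min (7 / 8) (|x| - ρ)) ≤ (1 / 8 : ℝ) :=
      max_le (by norm_num) ((min_le_right _ _).trans (by linarith))
    linarith
  · have h3 : (7 / 8 : ℝ) ≤ max (1 / 8) (min (7 / 8) (|x| - ρ)) :=
      le_max_of_le_right (le_min le_rfl (by linarith))
    linarith

variable {D : ℕ} {U : Type*} [Fintype U] {σ : Fin D → U → U}

/-- The all-ones matrix. -/
def onesMat (U : Type*) : Matrix U U ℝ := Matrix.of fun _ _ => 1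

lemma onesMat_mulVec (v : U → ℝ) (x : U) : (onesMat U *ᵥ v) x = ∑ y, v y := by
  simp [onesMat, mulVec, dotProduct]

lemma onesMat_form (v : U → ℝ) : v ⬝ᵥ onesMat U *ᵥ v = (∑ y, v y) ^ 2 := by
  simp only [dotProduct, onesMat_mulVec]
  rw [← Finset.sum_mul, sq]

lemma onesMat_isHermitian : (onesMat U).IsHermitian := by
  ext x y; simp [onesMat]

lemma unionMat_mul_onesMat (σ : Fin D → U → U) : unionMat σ * onesMat U = (D : ℝ) • onesMat U := by
  ext x y
  have : (unionMat σ * onesMat U) x y = (unionMat σ *ᵥ fun _ => (1 : ℝ)) x := by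
    simp [mul_apply, mulVec, dotProduct, onesMat]
  rw [this, unionMat_mulVec]
  simp [onesMat]

lemma onesMat_mul_onesMat : onesMat U * onesMat U = (Fintype.card U : ℝ) • onesMat U := by
  ext x y
  simp [mul_apply, onesMat]

lemma onesMat_mul_unionMat (hσ : σ ∈ matchings D U) :
    onesMat U * unionMat σ = (D : ℝ) • onesMat U := by
  have := congrArg conjTranspose (unionMat_mul_onesMat σ)
  rwa [conjTranspose_mul, (unionMat_isHermitian hσ).eq, conjTranspose_smul,
    (onesMat_isHermitian (U := U)).eq, star_trivial] at this

/-- The adjacency matrix with the trivial eigenvalue removed. -/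
def centredMat (σ : Fin D → U → U) : Matrix U U ℝ :=
  unionMat σ - ((D : ℝ) / Fintype.card U) • onesMat U

lemma centredMat_isHermitian (hσ : σ ∈ matchings D U) : (centredMat σ).IsHermitian := by
  rw [centredMat]
  refine (unionMat_isHermitian hσ).sub ?_
  rw [IsHermitian, conjTranspose_smul, onesMat_isHermitian.eq, star_trivial]

lemma centredMat_form (σ : Fin D → U → U) (v : U → ℝ) : v ⬝ᵥ centredMat σ *ᵥ v =
    v ⬝ᵥ unionMat σ *ᵥ v - (D : ℝ) / Fintype.card U * (∑ y, v y) ^ 2 := by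
  rw [centredMat, sub_mulVec, dotProduct_sub, smul_mulVec, dotProduct_smul, onesMat_form,
    smul_eq_mul]

lemma centredMat_pow [Nonempty U] (hσ : σ ∈ matchings D U) (n : ℕ) : centredMat σ ^ (n + 1) =
    unionMat σ ^ (n + 1) - ((D : ℝ) ^ (n + 1) / Fintype.card U) • onesMat U := by
  induction n with
  | zero => simp [centredMat]
  | succ n ih =>
    have hJ : ∀ n, onesMat U * unionMat σ ^ n = (D : ℝ) ^ n • onesMat U := by
      intro n
      induction n with
      | zero => simp
      | succ n ih => rw [pow_succ, ← mul_assoc, ih, smul_mul_assoc, onesMat_mul_unionMat hσ,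
          smul_smul, pow_succ]
    have hN : (Fintype.card U : ℝ) ≠ 0 := by positivity
    rw [pow_succ', ih, centredMat, sub_mul, mul_sub, mul_sub, ← pow_succ', mul_smul_comm,
      unionMat_mul_onesMat, smul_mul_assoc, hJ, smul_mul_smul_comm, onesMat_mul_onesMat]
    simp only [smul_smul]
    rw [sub_sub, ← add_sub_assoc, ← add_smul, ← sub_smul]
    congr 2
    field_simp
    ring

lemma aeval_centredMat [Nonempty U] (hσ : σ ∈ matchings D U) (h : ℝ[X]) :
    aeval (centredMat σ) h =
      aeval (unionMat σ) h - ((h.eval (D : ℝ) - h.eval 0) / Fintype.card U) • onesMat U := by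
  induction h using Polynomial.induction_on' with
  | add p q hp hq =>
    rw [map_add, map_add, hp, hq, eval_add, eval_add]
    have : (p.eval (D : ℝ) + q.eval (D : ℝ) - (p.eval 0 + q.eval 0)) / (Fintype.card U : ℝ) =
      (p.eval (D : ℝ) - p.eval 0) / Fintype.card U +
        (q.eval (D : ℝ) - q.eval 0) / Fintype.card U := by ring
    rw [this, add_smul]
    abel
  | monomial n a =>
    rw [aeval_monomial, aeval_monomial, eval_monomial, eval_monomial]
    cases n with
    | zero => simp
    | succ n =>
      rw [centredMat_pow hσ, mul_sub, zero_pow n.succ_ne_zero, mul_zero, sub_zero,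
        ← Algebra.smul_def, ← Algebra.smul_def, smul_smul, mul_div_assoc]

lemma trace_aeval_centredMat [Nonempty U] (hσ : σ ∈ matchings D U) (h : ℝ[X]) :
    (aeval (centredMat σ) h).trace =
      (aeval (unionMat σ) h).trace - h.eval (D : ℝ) + h.eval 0 := by
  have hN : (Fintype.card U : ℝ) ≠ 0 := by positivity
  have hJ : (onesMat U).trace = Fintype.card U := by simp [trace, onesMat]
  rw [aeval_centredMat hσ, trace_sub, trace_smul, hJ, smul_eq_mul, div_mul_cancel₀ _ hN]
  ring

lemma abs_centredMat_eigenvalues_le (hσ : σ ∈ matchings D U) (i : U) :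
    |(centredMat_isHermitian hσ).eigenvalues i| ≤ 2 * D := by
  have : Nonempty U := ⟨i⟩
  have hN : (0 : ℝ) < Fintype.card U := by positivity
  refine abs_eigenvalues_le_of_form _ (fun v => ?_) i
  rw [centredMat_form]
  have h1 := abs_unionMat_form_le hσ v
  have h2 : (∑ y, v y) ^ 2 ≤ Fintype.card U * (v ⬝ᵥ v) := by
    have := sq_sum_le_card_mul_sum_sq (s := Finset.univ) (f := v)
    simpa [dotProduct, sq] using this
  have h3 : (D : ℝ) / Fintype.card U * (∑ y, v y) ^ 2 ≤ D * (v ⬝ᵥ v) := by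
    calc _ ≤ (D : ℝ) / Fintype.card U * (Fintype.card U * (v ⬝ᵥ v)) := by gcongr
      _ = _ := by field_simp
  refine (abs_sub _ _).trans ?_
  rw [abs_of_nonneg (by positivity : 0 ≤ (D : ℝ) / Fintype.card U * (∑ y, v y) ^ 2)]
  linarith

/-- Up to the trivial eigenvalue, the union of the matchings has spectrum in
`[-(2√d + 1), 2√d + 1]`. -/
def NearlyRamanujan {d : ℕ} (σ : Fin (d + 1) → U → U) : Prop :=
  ∀ v : U → ℝ, |v ⬝ᵥ unionMat σ *ᵥ v| ≤
    (2 * √d + 1) * (v ⬝ᵥ v) + ((d : ℝ) + 1) / Fintype.card U * (∑ x, v x) ^ 2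

lemma card_not_nearlyRamanujan_le {d : ℕ} (hd : 1 ≤ d) : ∃ b₀ : ℕ, ∀ b ≥ b₀,
    ∀ (U : Type) [Fintype U], Fintype.card U = 2 ^ b →
      4 * ((matchings (d + 1) U).filter fun σ => ¬ NearlyRamanujan σ).card ≤
        (matchings (d + 1) U).card := by
  obtain ⟨h₁, hr, hl, hu⟩ := exists_separating_polynomial (2 * √d) (2 * ((d : ℝ) + 1))
  set e := h₁.natDegree + 1 with he
  have hd1 : (1 : ℝ) ≤ d := by exact_mod_cast hd
  have hsd : √(d : ℝ) ≤ d := Real.sqrt_le_iff.2 ⟨by linarith, by nlinarith⟩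
  have hev1 : ∀ᶠ b : ℕ in Filter.atTop, 64 * ((d + 2) * (b * e)) ^ 4 ≤ 2 ^ b := by
    have h1 := tendsto_pow_const_div_const_pow_of_one_lt 4 (r := 2) (by norm_num)
    have h2 : (0 : ℝ) < 1 / (64 * ((d + 2) * e) ^ 4) := by positivity
    filter_upwards [h1.eventually_lt_const h2] with b hb
    rw [div_lt_div_iff₀ (by positivity) (by positivity)] at hb
    have : (64 * ((d + 2) * (b * e)) ^ 4 : ℝ) ≤ 2 ^ b := by
      calc _ = (b : ℝ) ^ 4 * (64 * ((d + 2) * e) ^ 4) := by ring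
        _ ≤ 1 * 2 ^ b := hb.le
        _ = _ := one_mul _
    exact_mod_cast this
  have hev2 : ∀ᶠ b : ℕ in Filter.atTop, 4 * (20001 * (((d : ℝ) + 2) * (b * e)) ^ 8) ≤
      (3 / 2 : ℝ) ^ b := by
    have h1 := tendsto_pow_const_div_const_pow_of_one_lt 8 (r := 3 / 2) (by norm_num)
    have h2 : (0 : ℝ) < 1 / (4 * (20001 * (((d : ℝ) + 2) * e) ^ 8)) := by positivity
    filter_upwards [h1.eventually_lt_const h2] with b hb
    rw [div_lt_div_iff₀ (by positivity) (by positivity)] at hb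
    calc _ = (b : ℝ) ^ 8 * (4 * (20001 * (((d : ℝ) + 2) * e) ^ 8)) := by ring
      _ ≤ 1 * (3 / 2 : ℝ) ^ b := hb.le
      _ = _ := one_mul _
  obtain ⟨b₀, hb₀⟩ := Filter.eventually_atTop.1 (hev1.and (hev2.and (Filter.eventually_ge_atTop 1)))
  refine ⟨b₀, fun b hb U _ hU => ?_⟩
  obtain ⟨hb1, hb2, hb3⟩ := hb₀ b hb
  have : Nonempty U := Fintype.card_pos_iff.1 (by rw [hU]; positivity)
  set N : ℝ := 2 ^ b with hN
  have hN0 : 0 < N := by positivity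
  have hUN : (Fintype.card U : ℝ) = N := by rw [hU, hN]; norm_cast
  set q := b * e with hq
  set s : ℝ := ((d : ℝ) + 2) * q with hs
  have hq1 : 1 ≤ q := Nat.mul_pos hb3 (Nat.succ_pos _)
  have hq1' : (1 : ℝ) ≤ q := by exact_mod_cast hq1
  have hs1 : 1 ≤ s := by rw [hs]; nlinarith
  set m : ℝ := ((matchings (d + 1) U).card : ℝ) with hm
  set h := h₁ ^ b with hh
  have hev : ∀ x, h.eval x = h₁.eval x ^ b := fun x => eval_pow _
  have hδ : ∀ x, |x| ≤ 2 * √d → |h.eval x| ≤ (1 / 4) ^ b := by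
    intro x hx
    have hx' : |x| ≤ 2 * ((d : ℝ) + 1) := by linarith
    rw [hev, abs_pow, abs_of_nonneg (hr x hx').1]
    exact pow_le_pow_left₀ (hr x hx').1 (hl x hx' hx) b
  have hb' : ∀ x, |x| ≤ (d : ℝ) + 1 → |h.eval x| ≤ 1 := by
    intro x hx
    have hx' : |x| ≤ 2 * ((d : ℝ) + 1) := by linarith
    rw [hev, abs_pow, abs_of_nonneg (hr x hx').1]
    exact pow_le_one₀ (hr x hx').1 (hr x hx').2
  have hdeg : h.natDegree ≤ q := by
    refine natDegree_pow_le.trans ?_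
    rw [hq, he]; gcongr; omega
  have hNδ : N * (1 / 4) ^ b = 1 / N := by
    rw [hN, eq_div_iff (by positivity), mul_right_comm, ← mul_pow, ← mul_pow]; norm_num
  obtain ⟨c, rfl⟩ : ∃ c, b = c + 1 := ⟨b - 1, by omega⟩
  have htr := sum_trace_sub_le (U := U) hd hq1 hdeg hb' hδ (k := 2 ^ c)
    (by rw [pow_succ 2] at hb1; omega) (by rw [hU]; ring)
  have hk : 2 * ((2 ^ c : ℕ) : ℝ) = N := by rw [hN]; push_cast; ring
  rw [hk, hNδ, ← hs, ← hm] at htr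
  have hsum : ∑ σ ∈ matchings (d + 1) U, (aeval (centredMat σ) h).trace ≤
      20001 * s ^ 8 / N * m := by
    have h0 : h.eval 0 ≤ 1 / N := by
      rw [← hNδ]
      refine (le_abs_self _).trans ((hδ 0 (by simp)).trans ?_)
      exact le_mul_of_one_le_left (by positivity) (one_le_pow₀ (by norm_num))
    calc _ = ∑ σ ∈ matchings (d + 1) U, ((aeval (unionMat σ) h).trace - h.eval ((d : ℝ) + 1)) +
          m * h.eval 0 := by
          rw [Finset.sum_congr rfl fun σ hσ => trace_aeval_centredMat hσ h,
            Finset.sum_add_distrib, Finset.sum_const, nsmul_eq_mul]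
          push_cast
          rfl
      _ ≤ 10000 * s ^ 8 * (1 / N + 1 / N) * m + m * (1 / N) := by gcongr
      _ = (20000 * s ^ 8 + 1) / N * m := by ring
      _ ≤ _ := by
        have : 1 ≤ s ^ 8 := one_le_pow₀ hs1
        gcongr
        linarith
  have hpos : ∀ σ ∈ matchings (d + 1) U, ∀ i : U, ∀ hσ : σ ∈ matchings (d + 1) U,
      0 ≤ h.eval ((centredMat_isHermitian hσ).eigenvalues i) := by
    intro σ _ i hσ
    rw [hev]
    refine pow_nonneg (hr _ ?_).1 _
    have := abs_centredMat_eigenvalues_le hσ i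
    push_cast at this
    exact this
  have hlow : ((matchings (d + 1) U).filter fun σ => ¬ NearlyRamanujan σ).card *
      (3 / 4 : ℝ) ^ (c + 1) ≤ ∑ σ ∈ matchings (d + 1) U, (aeval (centredMat σ) h).trace := by
    rw [← nsmul_eq_mul]
    refine (Finset.card_nsmul_le_sum _ (fun σ => (aeval (centredMat σ) h).trace) _
      fun σ hσ => ?_).trans (Finset.sum_le_sum_of_subset_of_nonneg (Finset.filter_subset _ _)
        fun σ hσ _ => ?_)
    · rw [Finset.mem_filter] at hσ
      obtain ⟨hσ, hbad⟩ := hσ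
      rw [trace_aeval_eq_sum (centredMat_isHermitian hσ)]
      have : ∃ i, 2 * √d + 1 < |(centredMat_isHermitian hσ).eigenvalues i| := by
        by_contra hcon
        push Not at hcon
        refine hbad fun v => ?_
        have h1 := form_le_of_abs_eigenvalues (centredMat_isHermitian hσ) hcon v
        rw [centredMat_form] at h1
        push_cast at h1
        have h2 : 0 ≤ ((d : ℝ) + 1) / Fintype.card U * (∑ x, v x) ^ 2 := by positivity
        rw [abs_le] at h1 ⊢
        constructor <;> linarith [h1.1, h1.2]
      obtain ⟨i, hi⟩ := this
      refine le_trans ?_ (Finset.single_le_sum (fun j _ => hpos σ hσ j hσ) (Finset.mem_univ i))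
      rw [hev]
      have h3 := abs_centredMat_eigenvalues_le hσ i
      push_cast at h3
      exact pow_le_pow_left₀ (by norm_num) (hu _ h3 hi.le) _
    · rw [trace_aeval_eq_sum (centredMat_isHermitian hσ)]
      exact Finset.sum_nonneg fun i _ => hpos σ hσ i hσ
  have hm0 : 0 ≤ m := by positivity
  have hfin := hlow.trans hsum
  have h5 : 4 * (20001 * s ^ 8 / N) ≤ (3 / 4 : ℝ) ^ (c + 1) := by
    rw [← mul_div_assoc, div_le_iff₀ hN0, hN, ← mul_pow]
    refine le_trans (le_of_eq ?_) (hb2.trans (le_of_eq ?_))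
    · rw [hs, hq]; push_cast; ring
    · norm_num
  have h6 : 4 * (((matchings (d + 1) U).filter fun σ => ¬ NearlyRamanujan σ).card : ℝ) ≤ m := by
    have h7 : (0 : ℝ) < (3 / 4) ^ (c + 1) := by positivity
    refine le_of_mul_le_mul_right ?_ h7
    calc _ = 4 * ((((matchings (d + 1) U).filter fun σ => ¬ NearlyRamanujan σ).card : ℝ) *
          (3 / 4) ^ (c + 1)) := by ring
      _ ≤ 4 * (20001 * s ^ 8 / N * m) := by gcongr
      _ = 4 * (20001 * s ^ 8 / N) * m := by ring
      _ ≤ (3 / 4) ^ (c + 1) * m := by gcongr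
      _ = _ := mul_comm _ _
  rw [hm] at h6
  exact_mod_cast h6

end SpectralEvent

section RelationalWalks

variable {α : Type*}

/-- `Rw r n x y`: there is an `r`-walk of length `n` from `x` to `y`. -/
inductive Rw (r : α → α → Prop) : ℕ → α → α → Prop
  | nil (x : α) : Rw r 0 x x
  | snoc {n : ℕ} {x y z : α} : Rw r n x y → r y z → Rw r (n + 1) x z

/-- The relation `r` with the edge `xy` removed. -/
def avoid (r : α → α → Prop) (x y : α) : α → α → Prop :=
  fun a b => r a b ∧ ¬ ((a = x ∧ b = y) ∨ (a = y ∧ b = x))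

/-- The relation `r` with the edge `xy` added. -/
def addEdge (r : α → α → Prop) (x y : α) : α → α → Prop :=
  fun a b => r a b ∨ (a = x ∧ b = y) ∨ (a = y ∧ b = x)

/-- No edge of `r` lies on a closed walk of length less than `g` using that edge just once. -/
def NoShort (r : α → α → Prop) (g : ℕ) : Prop :=
  ∀ x y, r x y → ∀ n, Rw (avoid r x y) n x y → g ≤ n + 1

variable {r r' : α → α → Prop} {n m g : ℕ} {x y z a b : α}

lemma Rw.mono (h : ∀ a b, r a b → r' a b) (hw : Rw r n x y) : Rw r' n x y := by
  induction hw with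
  | nil => exact .nil _
  | snoc _ h' ih => exact ih.snoc (h _ _ h')

lemma Rw.eq_of_zero (h : Rw r 0 x y) : x = y := by cases h; rfl

lemma Rw.single (h : r x y) : Rw r 1 x y := (Rw.nil x).snoc h

lemma Rw.append (h : Rw r n x y) (h' : Rw r m y z) : Rw r (n + m) x z := by
  induction h' with
  | nil => exact h
  | snoc _ e ih => exact (ih h).snoc e

lemma Rw.cons (h : r x y) (h' : Rw r n y z) : Rw r (n + 1) x z := by
  rw [add_comm]; exact (Rw.single h).append h'

lemma Rw.symm (hr : ∀ a b, r a b → r b a) (h : Rw r n x y) : Rw r n y x := by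
  induction h with
  | nil => exact .nil _
  | snoc _ e ih => exact ih.cons (hr _ _ e)

lemma Rw.cons_inv (h : Rw r (n + 1) x z) : ∃ y, r x y ∧ Rw r n y z := by
  induction n generalizing z with
  | zero =>
    obtain _ | ⟨h1, h2⟩ := h
    obtain rfl := h1.eq_of_zero
    exact ⟨_, h2, .nil _⟩
  | succ n ih =>
    obtain _ | ⟨h1, h2⟩ := h
    obtain ⟨y, h3, h4⟩ := ih h1
    exact ⟨y, h3, h4.snoc h2⟩

lemma avoid_symm (hr : ∀ a b, r a b → r b a) : ∀ a b, avoid r x y a b → avoid r x y b a := by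
  rintro a b ⟨h1, h2⟩
  exact ⟨hr _ _ h1, by tauto⟩

lemma avoid_le : ∀ a b, avoid r x y a b → r a b := fun _ _ h => h.1

lemma addEdge_symm (hr : ∀ a b, r a b → r b a) : ∀ a b, addEdge r x y a b → addEdge r x y b a := by
  rintro a b (h | h)
  · exact Or.inl (hr _ _ h)
  · exact Or.inr (by tauto)

lemma NoShort.mono (h : NoShort r g) (hr : ∀ a b, r' a b → r a b) : NoShort r' g :=
  fun x y hxy n hn => h x y (hr _ _ hxy) n (hn.mono fun _ _ h => ⟨hr _ _ h.1, h.2⟩)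

lemma NoShort.of_le (h : NoShort r g) {g' : ℕ} (hg : g' ≤ g) : NoShort r g' :=
  fun x y hxy n hn => hg.trans (h x y hxy n hn)

/-- A walk in `r` plus an edge either avoids the edge or uses it (at least) once. -/
lemma Rw.addEdge_cases (h : Rw (addEdge r x y) n a b) :
    (∃ k ≤ n, Rw r k a b) ∨ ∃ k l, k + l + 1 ≤ n ∧
      ((Rw r k a x ∧ Rw r l y b) ∨ (Rw r k a y ∧ Rw r l x b)) := by
  induction h with
  | nil => exact Or.inl ⟨0, le_rfl, .nil _⟩
  | @snoc n c d e _ hr ih =>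
    rcases hr with hr | ⟨rfl, rfl⟩ | ⟨rfl, rfl⟩
    · rcases ih with ⟨k, hk, h1⟩ | ⟨k, l, hkl, ⟨h1, h2⟩ | ⟨h1, h2⟩⟩
      · exact Or.inl ⟨k + 1, by omega, h1.snoc hr⟩
      · exact Or.inr ⟨k, l + 1, by omega, Or.inl ⟨h1, h2.snoc hr⟩⟩
      · exact Or.inr ⟨k, l + 1, by omega, Or.inr ⟨h1, h2.snoc hr⟩⟩
    · rcases ih with ⟨k, hk, h1⟩ | ⟨k, l, hkl, ⟨h1, h2⟩ | ⟨h1, h2⟩⟩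
      · exact Or.inr ⟨k, 0, by omega, Or.inl ⟨h1, .nil _⟩⟩
      · exact Or.inr ⟨k, 0, by omega, Or.inl ⟨h1, .nil _⟩⟩
      · exact Or.inl ⟨k, by omega, h1⟩
    · rcases ih with ⟨k, hk, h1⟩ | ⟨k, l, hkl, ⟨h1, h2⟩ | ⟨h1, h2⟩⟩
      · exact Or.inr ⟨k, 0, by omega, Or.inr ⟨h1, .nil _⟩⟩
      · exact Or.inl ⟨k, by omega, h1⟩
      · exact Or.inr ⟨k, 0, by omega, Or.inr ⟨h1, .nil _⟩⟩

lemma NoShort.addEdge (hr : ∀ a b, r a b → r b a) (h : NoShort r g)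
    (hxy : ∀ n, Rw r n x y → g ≤ n + 1) : NoShort (addEdge r x y) g := by
  intro a b hab n hn
  by_cases he : (a = x ∧ b = y) ∨ (a = y ∧ b = x)
  · have h1 : Rw r n a b := hn.mono fun c e hce => by
      rcases hce with ⟨hce | hce, h2⟩
      · exact hce
      · rcases he with ⟨rfl, rfl⟩ | ⟨rfl, rfl⟩ <;> tauto
    rcases he with ⟨rfl, rfl⟩ | ⟨rfl, rfl⟩
    · exact hxy n h1
    · exact hxy n (h1.symm hr)
  · have hab' : r a b := hab.resolve_right he
    have h1 : Rw (Formal.addEdge (avoid r a b) x y) n a b := hn.mono fun c e hce => by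
      rcases hce with ⟨hce | hce, h2⟩
      · exact Or.inl ⟨hce, h2⟩
      · exact Or.inr hce
    rcases h1.addEdge_cases with ⟨k, hk, h2⟩ | ⟨k, l, hkl, ⟨h2, h3⟩ | ⟨h2, h3⟩⟩
    · exact (h a b hab' k h2).trans (by omega)
    · have := ((h2.mono avoid_le).symm hr).append (Rw.cons hab' ((h3.mono avoid_le).symm hr))
      exact (hxy _ this).trans (by omega)
    · have := (h3.mono avoid_le).append (Rw.cons (hr _ _ hab') (h2.mono avoid_le))
      exact (hxy _ this).trans (by omega)

lemma rw_of_walk {G : SimpleGraph α} {x y : α} (p : G.Walk x y) {r : α → α → Prop}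
    (h : ∀ a b, G.Adj a b → s(a, b) ∈ p.edges → r a b) : Rw r p.length x y := by
  induction p with
  | nil => exact .nil _
  | cons hadj p ih =>
    rw [SimpleGraph.Walk.length_cons]
    refine Rw.cons (h _ _ hadj (by simp)) (ih fun a b hab he => h a b hab ?_)
    rw [SimpleGraph.Walk.edges_cons]
    exact List.mem_cons_of_mem _ he

/-- The absence of short cycles in the relational sense bounds the length of cycles. -/
lemma NoShort.le_length_of_isCycle {G : SimpleGraph α} (h : NoShort G.Adj g) {x : α}
    {c : G.Walk x x} (hc : c.IsCycle) : g ≤ c.length := by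
  cases c with
  | nil => exact absurd hc (by simp)
  | cons hadj p =>
    rename_i y
    rw [SimpleGraph.Walk.cons_isCycle_iff] at hc
    rw [SimpleGraph.Walk.length_cons]
    refine h _ _ hadj _ (Rw.symm (avoid_symm fun a b h => h.symm)
      (rw_of_walk p fun a b hab he => ?_))
    refine ⟨hab, fun hcon => hc.2 ?_⟩
    rcases hcon with ⟨rfl, rfl⟩ | ⟨rfl, rfl⟩
    · exact he
    · rwa [Sym2.eq_swap]

/-- The number of vertices reachable by walks of length at most `n` in a relation enumerated by
`D` functions. -/
lemma exists_ball_card_le {D : ℕ} (f : Fin D → α → α) (hr : ∀ a b, r a b → ∃ i, f i a = b) (n : ℕ)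
    (x : α) : ∃ B : Finset α, B.card ≤ (D + 1) ^ n ∧ ∀ m ≤ n, ∀ y, Rw r m x y → y ∈ B := by
  induction n with
  | zero => 
    refine ⟨{x}, by simp, fun m hm y h => ?_⟩
    obtain rfl : m = 0 := by omega
    simp [h.eq_of_zero]
  | succ n ih =>
    obtain ⟨B, hB, h⟩ := ih
    refine ⟨B ∪ B.biUnion fun a => Finset.univ.image fun i => f i a, ?_, ?_⟩
    · refine (Finset.card_union_le _ _).trans ?_
      have : (B.biUnion fun a => Finset.univ.image fun i => f i a).card ≤ B.card * D :=
        Finset.card_biUnion_le_card_mul _ _ _ fun a _ =>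
          Finset.card_image_le.trans (by simp)
      rw [pow_succ]
      nlinarith
    · intro m hm y hw
      cases hw with
      | nil => exact Finset.mem_union_left _ (h 0 (Nat.zero_le _) _ (.nil _))
      | snoc h1 h2 =>
        obtain ⟨i, rfl⟩ := hr _ _ h2
        refine Finset.mem_union_right _ (Finset.mem_biUnion.2 ⟨_, h _ (by omega) _ h1, ?_⟩)
        exact Finset.mem_image_of_mem _ (Finset.mem_univ i)

end RelationalWalks

section Exploration

variable {D : ℕ} {U : Type*}

/-- The state of an exploration: the revealed pairs, the visited vertices, the current position
and the number of coincidences. -/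
structure EState (D : ℕ) (U : Type*) where
  μ : PState D U
  B : Finset U
  pos : U
  κ : ℕ

/-- Follow the label `i` from the current position. -/
def EState.step (σ : Fin D → U → U) (s : EState D U) (i : Fin D) : EState D U :=
  if s.μ i s.pos = none then
    ⟨s.μ.extend i s.pos (σ i s.pos), insert (σ i s.pos) s.B, σ i s.pos,
      s.κ + if σ i s.pos ∈ s.B then 1 else 0⟩
  else ⟨s.μ, s.B, σ i s.pos, s.κ⟩

/-- Follow a word. -/
def explore (σ : Fin D → U → U) (s : EState D U) (w : List (Fin D)) : EState D U :=
  w.foldl (EState.step σ) s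

lemma le_step_κ (σ : Fin D → U → U) (s : EState D U) (i : Fin D) : s.κ ≤ (s.step σ i).κ := by
  unfold EState.step
  split_ifs <;> simp

lemma le_explore_κ (σ : Fin D → U → U) (s : EState D U) (w : List (Fin D)) :
    s.κ ≤ (explore σ s w).κ := by
  induction w generalizing s with
  | nil => exact le_rfl
  | cons i w ih => exact (le_step_κ σ s i).trans (ih _)

lemma explore_append (σ : Fin D → U → U) (s : EState D U) (w w' : List (Fin D)) :
    explore σ s (w ++ w') = explore σ (explore σ s w) w' := List.foldl_append

variable [Fintype U]

lemma card_coincidences_le {A β : ℕ} (hA : 0 < A) (w : List (Fin D)) (s : EState D U) (k : ℕ)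
    (hμ : s.μ.WF) (hβ : s.B.card + w.length ≤ β)
    (hdom : ∀ i, (dom s.μ i).card + 2 * w.length + 1 + A ≤ Fintype.card U) :
    (((cyl s.μ).filter fun σ => s.κ + k ≤ (explore σ s w).κ).card : ℝ) ≤
      (w.length.choose k : ℝ) * ((β : ℝ) / A) ^ k * (cyl s.μ).card := by
  induction w generalizing s k with
  | nil =>
    cases k with
    | zero => simp [explore]
    | succ k => simp [explore]
  | cons i w ih =>
    cases k with
    | zero =>
      simp only [Nat.choose_zero_right, Nat.cast_one, pow_zero, mul_one, one_mul, Nat.cast_le]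
      exact Finset.card_filter_le _ _
    | succ k =>
      rw [List.length_cons] at hβ
      simp only [List.length_cons] at hdom ⊢
      have hp : (0 : ℝ) ≤ (β : ℝ) / A := by positivity
      set p := (β : ℝ) / A with hpdef
      cases hx : s.μ i s.pos with
      | some y =>
        have e : (cyl s.μ).filter (fun σ => s.κ + (k + 1) ≤ (explore σ s (i :: w)).κ) =
            (cyl s.μ).filter (fun σ => s.κ + (k + 1) ≤
              (explore σ ⟨s.μ, s.B, y, s.κ⟩ w).κ) := by
          refine Finset.filter_congr fun σ hσ => ?_
          have h1 := (mem_cyl.1 hσ).2 i _ _ hx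
          have h2 : s.step σ i = ⟨s.μ, s.B, y, s.κ⟩ := by
            rw [EState.step, if_neg (by simp [hx]), h1]
          change _ ≤ (explore σ (s.step σ i) w).κ ↔ _
          rw [h2]
        rw [e]
        refine (ih ⟨s.μ, s.B, y, s.κ⟩ (k + 1) hμ (by simp only; omega)
          fun j => by simp only; have := hdom j; omega).trans ?_
        gcongr
        exact Nat.le_succ _
      | none =>
        have hall := card_allowed_add hx
        have hallA : A ≤ (allowed s.μ i s.pos).card := by have := hdom i; omega
        have hsplit : ((cyl s.μ).filter fun σ => s.κ + (k + 1) ≤ (explore σ s (i :: w)).κ).card =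
            ∑ z ∈ allowed s.μ i s.pos, ((cyl (s.μ.extend i s.pos z)).filter
              fun σ => s.κ + (k + 1) ≤ (explore σ s (i :: w)).κ).card := by
          convert card_filter_cyl hμ hx fun σ => s.κ + (k + 1) ≤ (explore σ s (i :: w)).κ
        rw [hsplit]
        push_cast
        set a : ℝ := ((allowed s.μ i s.pos).card : ℝ) with ha
        set c : ℝ := ((cyl s.μ).card : ℝ) with hc
        have ha0 : 0 < a := by rw [ha]; exact_mod_cast hA.trans_le hallA
        have hAa : (A : ℝ) ≤ a := by rw [ha]; exact_mod_cast hallA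
        have hA' : (0 : ℝ) < A := by exact_mod_cast hA
        have hterm : ∀ z ∈ allowed s.μ i s.pos,
            (((cyl (s.μ.extend i s.pos z)).filter
              fun σ => s.κ + (k + 1) ≤ (explore σ s (i :: w)).κ).card : ℝ) ≤
            ((if z ∈ s.B then (w.length.choose k : ℝ) * p ^ k else 0) +
              (w.length.choose (k + 1) : ℝ) * p ^ (k + 1)) * (c / a) := by
          intro z hz
          have hz' := mem_allowed.1 hz
          have hcard : ((cyl (s.μ.extend i s.pos z)).card : ℝ) = c / a := by
            rw [eq_div_iff ha0.ne', ha, hc]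
            exact_mod_cast card_cyl_extend_mul hμ hx hz
          have e : (cyl (s.μ.extend i s.pos z)).filter
              (fun σ => s.κ + (k + 1) ≤ (explore σ s (i :: w)).κ) =
              (cyl (s.μ.extend i s.pos z)).filter (fun σ => s.κ + (k + 1) ≤
                (explore σ ⟨s.μ.extend i s.pos z, insert z s.B, z,
                  s.κ + if z ∈ s.B then 1 else 0⟩ w).κ) := by
            refine Finset.filter_congr fun σ hσ => ?_
            have h1 := (mem_cyl.1 hσ).2 i s.pos z (by simp [PState.extend])
            have h2 : s.step σ i = ⟨s.μ.extend i s.pos z, insert z s.B, z,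
                s.κ + if z ∈ s.B then 1 else 0⟩ := by
              rw [EState.step, if_pos hx, h1]
            change _ ≤ (explore σ (s.step σ i) w).κ ↔ _
            rw [h2]
          have hWF := hμ.extend hx hz'.2 hz'.1.symm
          have hd : ∀ j, (dom (s.μ.extend i s.pos z) j).card + 2 * w.length + 1 + A ≤
              Fintype.card U := by
            intro j
            rw [card_dom_extend hx hz'.2 hz'.1.symm j]
            have := hdom j
            split_ifs <;> omega
          have hB' : (insert z s.B).card + w.length ≤ β := by
            have := Finset.card_insert_le z s.B
            omega
          rw [e, ← hcard]
          by_cases hzB : z ∈ s.B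
          · have := ih ⟨s.μ.extend i s.pos z, insert z s.B, z,
              s.κ + if z ∈ s.B then 1 else 0⟩ k hWF hB' hd
            simp only [hzB, if_true] at this ⊢
            rw [add_assoc, add_comm 1 k] at this
            refine this.trans ?_
            gcongr
            have : (0 : ℝ) ≤ (w.length.choose (k + 1) : ℝ) * p ^ (k + 1) := by positivity
            linarith
          · have := ih ⟨s.μ.extend i s.pos z, insert z s.B, z,
              s.κ + if z ∈ s.B then 1 else 0⟩ (k + 1) hWF hB' hd
            simp only [hzB, if_false, add_zero, zero_add] at this ⊢
            exact this
        refine (Finset.sum_le_sum hterm).trans ?_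
        rw [← Finset.sum_mul, Finset.sum_add_distrib, Finset.sum_const, nsmul_eq_mul, ← ha,
          ← Finset.sum_filter, Finset.sum_const, nsmul_eq_mul]
        have hq : (((allowed s.μ i s.pos).filter fun z => z ∈ s.B).card : ℝ) ≤ p * a := by
          have h1 : ((allowed s.μ i s.pos).filter fun z => z ∈ s.B).card ≤ β := by
            refine (Finset.card_le_card (t := s.B) fun z hz => (Finset.mem_filter.1 hz).2).trans ?_
            omega
          calc _ ≤ (β : ℝ) := by exact_mod_cast h1
            _ = p * A := by rw [hpdef]; field_simp
            _ ≤ p * a := by gcongr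
        calc _ ≤ (p * a * ((w.length.choose k : ℝ) * p ^ k) +
              a * ((w.length.choose (k + 1) : ℝ) * p ^ (k + 1))) * (c / a) := by gcongr
          _ = ((w.length.choose k : ℝ) + w.length.choose (k + 1)) * p ^ (k + 1) * c := by
            field_simp
            ring
          _ = _ := by rw [Nat.choose_succ_succ]; push_cast; rfl

end Exploration

section Tours

variable {D : ℕ} {U : Type*} {σ : Fin D → U → U}

/-- Adjacency along edges other than the edge of label `i` at `x`. -/
def offEdge (σ : Fin D → U → U) (x : U) (i : Fin D) (a b : U) : Prop :=
  ∃ j, σ j a = b ∧ ¬ (j = i ∧ (a = x ∨ b = x))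

/-- The edge of label `i` at `x` lies on a short cycle. -/
def BadHalf (σ : Fin D → U → U) (g : ℕ) (x : U) (i : Fin D) : Prop :=
  ∃ n ≤ g, Rw (offEdge σ x i) n (σ i x) x

/-- The revealed pairs agree with `σ` and have been visited. -/
def EState.Sound (σ : Fin D → U → U) (s : EState D U) : Prop :=
  (∀ j a b, s.μ j a = some b → σ j a = b ∧ a ∈ s.B ∧ b ∈ s.B) ∧ s.pos ∈ s.B

lemma EState.Sound.step (hσ : ∀ i x, σ i (σ i x) = x ∧ σ i x ≠ x) {s : EState D U}
    (h : s.Sound σ) (i : Fin D) : (s.step σ i).Sound σ := by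
  unfold EState.step
  by_cases h1 : s.μ i s.pos = none
  · rw [if_pos h1]
    refine ⟨fun j a b hab => ?_, Finset.mem_insert_self _ _⟩
    simp only [PState.extend] at hab
    have := h.1 j a b
    have h2 := h.2
    have h3 := hσ i s.pos
    simp only [Finset.mem_insert]
    split_ifs at hab <;> grind
  · rw [if_neg h1]
    obtain ⟨y, hy⟩ := Option.ne_none_iff_exists'.1 h1
    refine ⟨h.1, ?_⟩
    have := h.1 _ _ _ hy
    simp only
    rw [this.1]
    exact this.2.2

/-- Closing a walk around the edge of label `i` at `x` produces a coincidence. -/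
lemma exists_tour (hσ : ∀ i x, σ i (σ i x) = x ∧ σ i x ≠ x) {x : U} {i : Fin D} {B₁ : Finset U}
    (hx : x ∈ B₁) (n : ℕ) (s : EState D U) (hs : s.Sound σ) (hB : B₁ ⊆ s.B) (hpos : s.pos ∉ B₁)
    (hinv : ∀ j a b, s.μ j a = some b → ((a ∈ B₁ ↔ b ∈ B₁) ∨ (j = i ∧ (a = x ∨ b = x))))
    (hw : Rw (offEdge σ x i) n s.pos x) :
    ∃ w : List (Fin D), w.length ≤ n ∧ s.κ + 1 ≤ (explore σ s w).κ ∧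
      (explore σ s w).pos ∈ B₁ ∧ (explore σ s w).Sound σ ∧ ∃ j₁, ∀ j a b,
        (explore σ s w).μ j a = some b →
          ((a ∈ B₁ ↔ b ∈ B₁) ∨ (j = i ∧ (a = x ∨ b = x)) ∨ j = j₁) := by
  induction n generalizing s with
  | zero => rw [hw.eq_of_zero] at hpos; exact absurd hx hpos
  | succ n ih =>
    obtain ⟨y, ⟨j, hj, hne⟩, hw'⟩ := hw.cons_inv
    have hs' := hs.step hσ j
    by_cases hy : y ∈ B₁
    · have hnone : s.μ j s.pos = none := by
        by_contra hc
        obtain ⟨z, hz⟩ := Option.ne_none_iff_exists'.1 hc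
        have h1 := (hs.1 _ _ _ hz).1
        have h2 := hinv _ _ _ hz
        grind
      refine ⟨[j], by simp, ?_, ?_, hs', j, ?_⟩
      · simp [explore, EState.step, hnone, hj, hB hy]
      · simp [explore, EState.step, hnone, hj, hy]
      · intro k a b hab
        simp only [explore, List.foldl, EState.step, hnone, if_true, PState.extend] at hab
        have := hinv k a b
        split_ifs at hab <;> grind
    · have hp : (s.step σ j).pos = y := by
        unfold EState.step; split_ifs <;> exact hj
      obtain ⟨w, h1, h2, h3, h4, h5⟩ := ih (s.step σ j) hs' (by
          unfold EState.step
          by_cases hc : s.μ j s.pos = none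
          · rw [if_pos hc]; exact hB.trans (Finset.subset_insert _ _)
          · rw [if_neg hc]; exact hB) (by rwa [hp]) (by
          intro k a b hab
          have := hinv k a b
          unfold EState.step at hab
          by_cases hc : s.μ j s.pos = none
          · rw [if_pos hc] at hab
            simp only [PState.extend] at hab
            split_ifs at hab <;> grind
          · rw [if_neg hc] at hab; exact this hab) (by rwa [hp])
      refine ⟨j :: w, by simpa using h1, ?_, h3, h4, h5⟩
      exact (Nat.add_le_add_right (le_step_κ σ s j) 1).trans h2

/-- A tour that starts with the unrevealed edge of label `i` at the current position `x`. -/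
lemma exists_tour_of_badHalf (hσ : ∀ i x, σ i (σ i x) = x ∧ σ i x ≠ x) {g : ℕ} {i : Fin D}
    (s : EState D U) (hs : s.Sound σ) (hnone : s.μ i s.pos = none)
    (hbad : BadHalf σ g s.pos i) :
    ∃ w : List (Fin D), w.length ≤ g + 1 ∧ s.κ + 1 ≤ (explore σ s w).κ ∧
      (explore σ s w).pos ∈ s.B ∧ (explore σ s w).Sound σ ∧ ∃ j₁, ∀ j a b,
        (explore σ s w).μ j a = some b →
          ((a ∈ s.B ↔ b ∈ s.B) ∨ (j = i ∧ (a = s.pos ∨ b = s.pos)) ∨ j = j₁) := by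
  obtain ⟨n, hn, hw⟩ := hbad
  have hs' := hs.step hσ i
  by_cases hy : σ i s.pos ∈ s.B
  · refine ⟨[i], by simp, ?_, ?_, hs', i, ?_⟩
    · simp [explore, EState.step, hnone, hy]
    · simp [explore, EState.step, hnone, hy]
    · intro k a b hab
      simp only [explore, List.foldl, EState.step, hnone, if_true, PState.extend] at hab
      have := hs.1 k a b
      split_ifs at hab <;> grind
  · have hp : (s.step σ i).pos = σ i s.pos := by
      unfold EState.step; rw [if_pos hnone]
    obtain ⟨w, h1, h2, h3, h4, h5⟩ := exists_tour hσ (i := i) hs.2 n (s.step σ i) hs' (by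
      unfold EState.step; rw [if_pos hnone]
      exact Finset.subset_insert _ _) (by rwa [hp]) (by
      intro k a b hab
      have := hs.1 k a b
      simp only [EState.step, hnone, if_true, PState.extend] at hab
      split_ifs at hab <;> grind) (by rwa [hp])
    refine ⟨i :: w, by simp; omega, ?_, h3, h4, h5⟩
    exact (Nat.add_le_add_right (le_step_κ σ s i) 1).trans h2

/-- The initial state of an exploration from `x`. -/
def startAt (D : ℕ) (x : U) : EState D U := ⟨emptyState D U, {x}, x, 0⟩

lemma startAt_sound (x : U) : (startAt D x).Sound σ :=
  ⟨fun j a b h => by simp [startAt, emptyState] at h, by simp [startAt]⟩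

lemma exists_word_length {s : EState D U} {k m : ℕ} (i : Fin D)
    (h : ∃ w : List (Fin D), w.length ≤ m ∧ k ≤ (explore σ s w).κ) :
    ∃ w : List (Fin D), w.length = m ∧ k ≤ (explore σ s w).κ := by
  obtain ⟨w, h1, h2⟩ := h
  refine ⟨w ++ List.replicate (m - w.length) i, by simp; omega, ?_⟩
  rw [explore_append]
  exact h2.trans (le_explore_κ _ _ _)

lemma exists_word_of_badHalf (hσ : ∀ i x, σ i (σ i x) = x ∧ σ i x ≠ x) {g : ℕ} {x : U} {i : Fin D}
    (h : BadHalf σ g x i) :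
    ∃ w : List (Fin D), w.length = g + 1 ∧ 1 ≤ (explore σ (startAt D x) w).κ := by
  obtain ⟨w, h1, h2, -⟩ := exists_tour_of_badHalf hσ (startAt D x) (startAt_sound x)
    (i := i) rfl h
  exact exists_word_length i ⟨w, h1, by simpa [startAt] using h2⟩

lemma exists_word_of_three_badHalf (hσ : ∀ i x, σ i (σ i x) = x ∧ σ i x ≠ x) {g : ℕ} {x : U}
    (h : 3 ≤ (Finset.univ.filter fun i => BadHalf σ g x i).card) :
    ∃ w : List (Fin D), w.length = 2 * (g + 1) ∧ 2 ≤ (explore σ (startAt D x) w).κ := by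
  obtain ⟨i, hi⟩ : (Finset.univ.filter fun i => BadHalf σ g x i).Nonempty := by
    rw [← Finset.card_pos]; omega
  have hi := (Finset.mem_filter.1 hi).2
  obtain ⟨w, h1, h2, h3, h4, j₁, h5⟩ := exists_tour_of_badHalf hσ (startAt D x) (startAt_sound x)
    (i := i) rfl hi
  obtain ⟨i', hi', hne⟩ : ∃ i' ∈ (Finset.univ.filter fun i => BadHalf σ g x i),
      i' ∉ ({i, j₁} : Finset (Fin D)) := by
    by_contra hc
    push Not at hc
    have := Finset.card_le_card (Finset.subset_iff.2 hc)
    have := Finset.card_le_two (a := i) (b := j₁)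
    omega
  have hi' := (Finset.mem_filter.1 hi').2
  simp only [Finset.mem_insert, Finset.mem_singleton, not_or] at hne
  have hp : (explore σ (startAt D x) w).pos = x := by simpa [startAt] using h3
  obtain ⟨w', h1', h2', -⟩ := exists_tour_of_badHalf hσ (g := g) (i := i') _ h4 (by
    by_contra hc
    obtain ⟨b, hb⟩ := Option.ne_none_iff_exists'.1 hc
    rw [hp] at hb
    have e := (h4.1 _ _ _ hb).1
    have := h5 _ _ _ hb
    have hf := (hσ i' x).2
    simp only [startAt, Finset.mem_singleton] at this
    grind) (by rwa [hp])
  refine exists_word_length i ⟨w ++ w', by simp; omega, ?_⟩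
  rw [explore_append]
  simp only [startAt] at h2 h2' ⊢
  omega

lemma BadHalf.partner (hσ : ∀ i x, σ i (σ i x) = x ∧ σ i x ≠ x) {g : ℕ} {x : U} {i : Fin D}
    (h : BadHalf σ g x i) : BadHalf σ g (σ i x) i := by
  obtain ⟨n, hn, hw⟩ := h
  refine ⟨n, hn, ?_⟩
  rw [(hσ i x).1]
  refine (hw.symm ?_).mono ?_
  · rintro a b ⟨j, rfl, h⟩
    exact ⟨j, (hσ j a).1, by tauto⟩
  · rintro a b ⟨j, rfl, h⟩
    refine ⟨j, rfl, ?_⟩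
    rintro ⟨rfl, rfl | h'⟩
    · exact h ⟨rfl, Or.inr (hσ j x).1⟩
    · have := (hσ j a).1
      rw [h', (hσ j x).1] at this
      exact h ⟨rfl, Or.inl this.symm⟩

end Tours

section FirstMoment

variable {D : ℕ} {U : Type*} [Fintype U]

lemma card_exists_word_le {A : ℕ} (hA : 0 < A) (ℓ k : ℕ) (x : U)
    (hU : 2 * ℓ + 1 + A ≤ Fintype.card U) :
    (((matchings D U).filter fun σ => ∃ w : List (Fin D), w.length = ℓ ∧
      k ≤ (explore σ (startAt D x) w).κ).card : ℝ) ≤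
      (D : ℝ) ^ ℓ * ((ℓ.choose k : ℝ) * (((ℓ + 1 : ℕ) : ℝ) / A) ^ k * (matchings D U).card) := by
  have hsub : ((matchings D U).filter fun σ => ∃ w : List (Fin D), w.length = ℓ ∧
      k ≤ (explore σ (startAt D x) w).κ) ⊆
      Finset.univ.biUnion fun w : Fin ℓ → Fin D => (matchings D U).filter fun σ =>
        k ≤ (explore σ (startAt D x) (List.ofFn w)).κ := by
    intro σ hσ
    obtain ⟨h1, w, rfl, h2⟩ := Finset.mem_filter.1 hσ
    refine Finset.mem_biUnion.2 ⟨w.get, Finset.mem_univ _, Finset.mem_filter.2 ⟨h1, ?_⟩⟩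
    rwa [List.ofFn_get]
  have h1 := (Finset.card_le_card hsub).trans Finset.card_biUnion_le
  calc _ ≤ ((∑ w : Fin ℓ → Fin D, ((matchings D U).filter fun σ =>
        k ≤ (explore σ (startAt D x) (List.ofFn w)).κ).card : ℕ) : ℝ) := by exact_mod_cast h1
    _ ≤ ∑ w : Fin ℓ → Fin D, (ℓ.choose k : ℝ) * (((ℓ + 1 : ℕ) : ℝ) / A) ^ k *
        (matchings D U).card := by
      push_cast
      refine Finset.sum_le_sum fun w _ => ?_
      have := card_coincidences_le hA (List.ofFn w) (startAt D x) k (β := ℓ + 1)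
        (emptyState_wf D U) (by simp [startAt, add_comm]) (fun i => by
          have : dom (startAt D x).μ i = ∅ := by
            ext y; simp [dom, startAt, emptyState]
          simp only [this, List.length_ofFn, Finset.card_empty]
          omega)
      simp only [startAt, cyl_emptyState, List.length_ofFn, zero_add] at this ⊢
      push_cast at this
      exact this
    _ = _ := by simp

lemma card_three_badHalf_le {A g : ℕ} (hA : 0 < A)
    (hU : 2 * (2 * (g + 1)) + 1 + A ≤ Fintype.card U) :
    (((matchings D U).filter fun σ => ∃ x, 3 ≤ (Finset.univ.filter
      fun i => BadHalf σ g x i).card).card : ℝ) ≤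
      Fintype.card U * ((D : ℝ) ^ (2 * (g + 1)) * ((((2 * (g + 1)).choose 2 : ℕ) : ℝ) *
        (((2 * (g + 1) + 1 : ℕ) : ℝ) / A) ^ 2 * (matchings D U).card)) := by
  have hsub : ((matchings D U).filter fun σ => ∃ x, 3 ≤ (Finset.univ.filter
      fun i => BadHalf σ g x i).card) ⊆
      Finset.univ.biUnion fun x : U => (matchings D U).filter fun σ =>
        ∃ w : List (Fin D), w.length = 2 * (g + 1) ∧ 2 ≤ (explore σ (startAt D x) w).κ := by
    intro σ hσ
    obtain ⟨h1, x, h2⟩ := Finset.mem_filter.1 hσ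
    exact Finset.mem_biUnion.2 ⟨x, Finset.mem_univ _, Finset.mem_filter.2 ⟨h1,
      exists_word_of_three_badHalf (mem_matchings.1 h1) h2⟩⟩
  have h1 := (Finset.card_le_card hsub).trans Finset.card_biUnion_le
  calc _ ≤ ((∑ x : U, ((matchings D U).filter fun σ =>
        ∃ w : List (Fin D), w.length = 2 * (g + 1) ∧
          2 ≤ (explore σ (startAt D x) w).κ).card : ℕ) : ℝ) := by exact_mod_cast h1
    _ ≤ ∑ x : U, ((D : ℝ) ^ (2 * (g + 1)) * ((((2 * (g + 1)).choose 2 : ℕ) : ℝ) *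
        (((2 * (g + 1) + 1 : ℕ) : ℝ) / A) ^ 2 * (matchings D U).card)) := by
      push_cast
      refine Finset.sum_le_sum fun x _ => ?_
      exact_mod_cast card_exists_word_le hA _ 2 x hU
    _ = _ := by simp

lemma sum_card_badHalf_le {A g : ℕ} (hA : 0 < A) (hU : 2 * (g + 1) + 1 + A ≤ Fintype.card U) :
    (∑ σ ∈ matchings D U, ((Finset.univ.filter
      fun h : U × Fin D => BadHalf σ g h.1 h.2).card : ℝ)) ≤
      Fintype.card U * D * ((D : ℝ) ^ (g + 1) * ((g + 1 : ℕ) *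
        (((g + 1 + 1 : ℕ) : ℝ) / A) * (matchings D U).card)) := by
  have e : ∀ σ ∈ matchings D U, ((Finset.univ.filter
      fun h : U × Fin D => BadHalf σ g h.1 h.2).card : ℝ) =
      ∑ h : U × Fin D, if BadHalf σ g h.1 h.2 then (1 : ℝ) else 0 := by
    intro σ _
    rw [Finset.sum_boole]
  rw [Finset.sum_congr rfl e, Finset.sum_comm]
  calc _ ≤ ∑ _h : U × Fin D, ((D : ℝ) ^ (g + 1) * ((g + 1 : ℕ) *
        (((g + 1 + 1 : ℕ) : ℝ) / A) * (matchings D U).card)) := by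
        refine Finset.sum_le_sum fun h _ => ?_
        rw [Finset.sum_boole]
        have h1 := card_exists_word_le (D := D) hA (g + 1) 1 h.1 hU
        rw [Nat.choose_one_right, pow_one] at h1
        refine le_trans ?_ h1
        rw [Nat.cast_le]
        refine Finset.card_le_card fun σ hσ => ?_
        obtain ⟨h2, h3⟩ := Finset.mem_filter.1 hσ
        exact Finset.mem_filter.2 ⟨h2, exists_word_of_badHalf (mem_matchings.1 h2) h3⟩
    _ = _ := by simp [Fintype.card_prod]

/-- A nearly Ramanujan union of matchings with few and sparse half-edges on short cycles. -/
theorem exists_good_matchings {d : ℕ} {A g : ℕ} {J : ℝ} (hJ : 0 < J) (hA : 0 < A)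
    (hne : (matchings (d + 1) U).Nonempty)
    (hU : 2 * (2 * (g + 1)) + 1 + A ≤ Fintype.card U)
    (hram : 4 * ((matchings (d + 1) U).filter fun σ => ¬NearlyRamanujan σ).card ≤
      (matchings (d + 1) U).card)
    (h3 : Fintype.card U * (((d : ℝ) + 1) ^ (2 * (g + 1)) * ((((2 * (g + 1)).choose 2 : ℕ) : ℝ) *
        (((2 * (g + 1) + 1 : ℕ) : ℝ) / A) ^ 2)) ≤ 1 / 4)
    (h1 : Fintype.card U * ((d : ℝ) + 1) * (((d : ℝ) + 1) ^ (g + 1) * ((g + 1 : ℕ) *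
        (((g + 1 + 1 : ℕ) : ℝ) / A))) ≤ J / 4) :
    ∃ σ ∈ matchings (d + 1) U, NearlyRamanujan σ ∧
      (∀ x, (Finset.univ.filter fun i => BadHalf σ g x i).card ≤ 2) ∧
      ((Finset.univ.filter fun h : U × Fin (d + 1) => BadHalf σ g h.1 h.2).card : ℝ) ≤ J := by
  set M := matchings (d + 1) U with hM
  have hMpos : (0 : ℝ) < M.card := by exact_mod_cast hne.card_pos
  set F1 := M.filter fun σ => ¬NearlyRamanujan σ with hF1
  set F2 := M.filter fun σ => ∃ x, 3 ≤ (Finset.univ.filter fun i => BadHalf σ g x i).card with hF2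
  set F3 := M.filter fun σ => J < ((Finset.univ.filter
    fun h : U × Fin (d + 1) => BadHalf σ g h.1 h.2).card : ℝ) with hF3
  have c1 : (F1.card : ℝ) ≤ 1 / 4 * M.card := by
    have : (4 : ℝ) * F1.card ≤ M.card := by exact_mod_cast hram
    linarith
  have c2 : (F2.card : ℝ) ≤ 1 / 4 * M.card := by
    have := card_three_badHalf_le (D := d + 1) (U := U) hA hU
    refine this.trans ?_
    have h := mul_le_mul_of_nonneg_right h3 hMpos.le
    refine le_trans (le_of_eq ?_) h
    push_cast
    ring
  have c3 : (F3.card : ℝ) ≤ 1 / 4 * M.card := by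
    have := sum_card_badHalf_le (D := d + 1) (U := U) (g := g) hA (by omega)
    have h := mul_le_mul_of_nonneg_right h1 hMpos.le
    have h' : J * F3.card ≤ ∑ σ ∈ M, ((Finset.univ.filter
        fun h : U × Fin (d + 1) => BadHalf σ g h.1 h.2).card : ℝ) := by
      calc J * F3.card = ∑ σ ∈ F3, J := by simp [mul_comm]
        _ ≤ ∑ σ ∈ F3, ((Finset.univ.filter
            fun h : U × Fin (d + 1) => BadHalf σ g h.1 h.2).card : ℝ) :=
          Finset.sum_le_sum fun σ hσ => (Finset.mem_filter.1 hσ).2.le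
        _ ≤ _ := Finset.sum_le_sum_of_subset_of_nonneg (Finset.filter_subset _ _)
          fun _ _ _ => by positivity
    have h2 : J * F3.card ≤ J * (1 / 4 * M.card) := by
      refine (h'.trans this).trans ?_
      refine le_trans (le_of_eq ?_) (h.trans (le_of_eq ?_))
      · push_cast; ring
      · ring
    exact le_of_mul_le_mul_left h2 hJ
  obtain ⟨σ, hσ, hσ'⟩ : ∃ σ ∈ M, σ ∉ F1 ∪ F2 ∪ F3 := by
    by_contra hc
    push Not at hc
    have hle := Finset.card_le_card (Finset.subset_iff.2 hc)
    have hu := (Finset.card_union_le (F1 ∪ F2) F3)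
    have hu' := (Finset.card_union_le F1 F2)
    have : (M.card : ℝ) ≤ F1.card + F2.card + F3.card := by
      exact_mod_cast (by omega : M.card ≤ F1.card + F2.card + F3.card)
    linarith
  simp only [Finset.mem_union, not_or, hF1, hF2, hF3, Finset.mem_filter, hσ, true_and, not_not,
    not_exists, not_le, not_lt] at hσ'
  exact ⟨σ, hσ, hσ'.1.1, fun x => Nat.lt_succ_iff.1 (hσ'.1.2 x), hσ'.2⟩

end FirstMoment

section Gadget

/-- Vertices of the gadget on its two sides. -/
abbrev GS (N₁ L : ℕ) := Bool × Fin N₁ × ZMod L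

/-- Middle vertices of the gadget. -/
abbrev GW (N₁ L e : ℕ) := (ZMod L × Fin e) × Fin N₁

variable {N₁ L e : ℕ} {Q Q' : ZMod L × Fin e → Fin N₁ → Fin N₁ → Prop}

/-- Incidence between side vertices and middle vertices. -/
def ginc (Q : ZMod L × Fin e → Fin N₁ → Fin N₁ → Prop) (s : GS N₁ L) (w : GW N₁ L e) : Prop :=
  w.1.1 = s.2.2 ∧ ((s.1 = true ∧ s.2.1 = w.2) ∨ (s.1 = false ∧ Q w.1 w.2 s.2.1))

/-- Adjacency along the cycles. -/
def gcyc (s s' : GS N₁ L) : Prop :=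
  s.1 = s'.1 ∧ s.2.1 = s'.2.1 ∧ (s'.2.2 = s.2.2 + 1 ∨ s.2.2 = s'.2.2 + 1)

/-- Two families of disjoint cycles joined through middle vertices according to `Q`. -/
def gadget (Q : ZMod L × Fin e → Fin N₁ → Fin N₁ → Prop) :
    GS N₁ L ⊕ GW N₁ L e → GS N₁ L ⊕ GW N₁ L e → Prop
  | .inl s, .inl s' => gcyc s s'
  | .inl s, .inr w => ginc Q s w
  | .inr w, .inl s => ginc Q s w
  | .inr _, .inr _ => False

lemma gadget_symm : ∀ x y, gadget Q x y → gadget Q y x := by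
  rintro (s | w) (s' | w') h
  · exact ⟨h.1.symm, h.2.1.symm, h.2.2.symm⟩
  · exact h
  · exact h
  · exact h

lemma gadget_mono (h : ∀ c a b, Q c a b → Q' c a b) : ∀ x y, gadget Q x y → gadget Q' x y := by
  rintro (s | w) (s' | w') h'
  · exact h'
  · exact ⟨h'.1, h'.2.imp_right fun h'' => ⟨h''.1, h _ _ _ h''.2⟩⟩
  · exact ⟨h'.1, h'.2.imp_right fun h'' => ⟨h''.1, h _ _ _ h''.2⟩⟩
  · assumption

/-- `Q` consists of partial matchings. -/
def PMatch (Q : ZMod L × Fin e → Fin N₁ → Fin N₁ → Prop) : Prop :=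
  (∀ c a b b', Q c a b → Q c a b' → b = b') ∧ (∀ c a a' b, Q c a b → Q c a' b → a = a')

lemma exists_across (hQ : PMatch Q) (r : Fin e) (s : GS N₁ L) :
    ∃ s' : GS N₁ L, ∀ w, ginc Q s w → w.1.2 = r → ∀ z, gadget Q (.inr w) z →
      z = .inl s ∨ z = .inl s' := by
  obtain ⟨b, a, i⟩ := s
  cases b with
  | true =>
    by_cases h : ∃ b, Q (i, r) a b
    · obtain ⟨b, hb⟩ := h
      refine ⟨(false, b, i), ?_⟩
      rintro ⟨⟨i', r'⟩, a'⟩ ⟨h1, h2⟩ rfl (⟨b', a'', i''⟩ | z) hz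
      · obtain ⟨h3, h4⟩ := hz
        have := hQ.1 (i, r') a b a''
        simp at h1 h2 h3 h4 ⊢
        grind
      · exact hz.elim
    · refine ⟨(true, a, i), ?_⟩
      rintro ⟨⟨i', r'⟩, a'⟩ ⟨h1, h2⟩ rfl (⟨b', a'', i''⟩ | z) hz
      · obtain ⟨h3, h4⟩ := hz
        simp at h h1 h2 h3 h4 ⊢
        grind
      · exact hz.elim
  | false =>
    by_cases h : ∃ a', Q (i, r) a' a
    · obtain ⟨a', ha'⟩ := h
      refine ⟨(true, a', i), ?_⟩
      rintro ⟨⟨i', r'⟩, a₁⟩ ⟨h1, h2⟩ rfl (⟨b', a'', i''⟩ | z) hz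
      · obtain ⟨h3, h4⟩ := hz
        have := hQ.1 (i, r') a₁ a a''
        have := hQ.2 (i, r') a' a₁ a
        simp at h1 h2 h3 h4 ⊢
        grind
      · exact hz.elim
    · refine ⟨(true, a, i), ?_⟩
      rintro ⟨⟨i', r'⟩, a'⟩ ⟨h1, h2⟩ rfl (⟨b', a'', i''⟩ | z) hz
      · obtain ⟨h3, h4⟩ := hz
        simp at h h1 h2 h3 h4 ⊢
        grind
      · exact hz.elim

/-- Balls in the gadget grow slowly since middle vertices have few neighbours. -/
lemma exists_gadget_ball (hQ : PMatch Q) {lam : ℝ} (hlam : 3 ≤ lam)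
    (hlam2 : 2 * lam + (e + 1) ≤ lam ^ 2) (n : ℕ) (s : GS N₁ L) :
    ∃ B : Finset (GS N₁ L), (B.card : ℝ) ≤ lam ^ n ∧
      ∀ m ≤ n, ∀ s', Rw (gadget Q) m (.inl s) (.inl s') → s' ∈ B := by
  induction n using Nat.strong_induction_on generalizing s with
  | _ n ih =>
    choose acr hacr using exists_across hQ
    have hstep : ∀ s s', gadget Q (.inl s) (.inl s') →
        s' = (s.1, s.2.1, s.2.2 + 1) ∨ s' = (s.1, s.2.1, s.2.2 - 1) := by
      rintro ⟨b, a, i⟩ ⟨b', a', i'⟩ ⟨h1, h2, h3 | h3⟩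
      · left; simp at h1 h2 h3 ⊢; exact ⟨h1.symm, h2.symm, h3⟩
      · right; simp at h1 h2 h3 ⊢; exact ⟨h1.symm, h2.symm, by rw [h3]; ring⟩
    match n, ih with
    | 0, _ =>
      refine ⟨{s}, by simp, fun m hm s' h => ?_⟩
      obtain rfl : m = 0 := by omega
      have := h.eq_of_zero
      simp at this ⊢
      exact this.symm
    | 1, _ =>
      refine ⟨{s, (s.1, s.2.1, s.2.2 + 1), (s.1, s.2.1, s.2.2 - 1)}, ?_, fun m hm s' h => ?_⟩
      · have : (({s, (s.1, s.2.1, s.2.2 + 1), (s.1, s.2.1, s.2.2 - 1)} :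
            Finset (GS N₁ L)).card : ℝ) ≤ 3 := by exact_mod_cast Finset.card_le_three
        rw [pow_one]
        exact this.trans hlam
      · match m, h with
        | 0, h => have := h.eq_of_zero; simp at this ⊢; exact Or.inl this.symm
        | 1, h =>
          obtain ⟨y, h1, h2⟩ := h.cons_inv
          rw [h2.eq_of_zero] at h1
          have := hstep _ _ h1
          simp only [Finset.mem_insert, Finset.mem_singleton]
          tauto
        | m + 2, _ => omega
    | n + 2, ih =>
      choose B1 hB1 hB1' using ih (n + 1) (by omega)
      choose B0 hB0 hB0' using ih n (by omega)
      refine ⟨(B1 (s.1, s.2.1, s.2.2 + 1) ∪ B1 (s.1, s.2.1, s.2.2 - 1)) ∪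
        (B0 s ∪ Finset.univ.biUnion fun r => B0 (acr r s)), ?_, fun m hm s' h => ?_⟩
      · have h1 : (((B1 (s.1, s.2.1, s.2.2 + 1) ∪ B1 (s.1, s.2.1, s.2.2 - 1)) ∪
            (B0 s ∪ Finset.univ.biUnion fun r => B0 (acr r s))).card : ℝ) ≤
            ((B1 (s.1, s.2.1, s.2.2 + 1)).card + (B1 (s.1, s.2.1, s.2.2 - 1)).card) +
            ((B0 s).card + ∑ r, (B0 (acr r s)).card) := by
          norm_cast
          refine (Finset.card_union_le _ _).trans (Nat.add_le_add (Finset.card_union_le _ _) ?_)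
          exact (Finset.card_union_le _ _).trans (Nat.add_le_add_left Finset.card_biUnion_le _)
        have h2 : (∑ r, ((B0 (acr r s)).card : ℝ)) ≤ e * lam ^ n := by
          refine (Finset.sum_le_sum fun r _ => hB0 (acr r s)).trans ?_
          simp
        have h3 := hB1 (s.1, s.2.1, s.2.2 + 1)
        have h4 := hB1 (s.1, s.2.1, s.2.2 - 1)
        have h5 := hB0 s
        have h6 : lam ^ n * (2 * lam + (e + 1)) ≤ lam ^ n * lam ^ 2 := by gcongr
        rw [pow_succ] at h3 h4
        rw [pow_add]
        push_cast at h1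
        linarith
      · simp only [Finset.mem_union, Finset.mem_biUnion, Finset.mem_univ, true_and]
        match m, h with
        | 0, h =>
          exact Or.inr (Or.inl (hB0' s 0 (by omega) s' h))
        | m + 1, h =>
          obtain ⟨y, h1, h2⟩ := h.cons_inv
          match y, h1, h2 with
          | .inl y, h1, h2 =>
            left
            rcases hstep _ _ h1 with rfl | rfl
            · exact Or.inl (hB1' _ m (by omega) s' h2)
            · exact Or.inr (hB1' _ m (by omega) s' h2)
          | .inr w, h1, h2 =>
            match m, h2 with
            | 0, h2 => exact absurd h2.eq_of_zero (by simp)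
            | m + 1, h2 =>
              obtain ⟨z, h3, h4⟩ := h2.cons_inv
              right
              rcases hacr w.1.2 s w h1 rfl z h3 with rfl | rfl
              · exact Or.inl (hB0' s m (by omega) s' h4)
              · exact Or.inr ⟨w.1.2, hB0' _ m (by omega) s' h4⟩

end Gadget

section GadgetGirth

variable {N₁ L e : ℕ} {Q Q' : ZMod L × Fin e → Fin N₁ → Fin N₁ → Prop}

/-- The side vertex below a vertex of the gadget without crossing edges. -/
def gproj : GS N₁ L ⊕ GW N₁ L e → GS N₁ L
  | .inl s => s
  | .inr w => (true, w.2, w.1.1)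

lemma val_sub_one_le [NeZero L] (x : ZMod L) (hx : x ≠ 0) : (x - 1).val ≤ x.val := by
  have h1 : (1 : ZMod L).val ≤ x.val := by
    rw [ZMod.val_one_eq_one_mod]
    refine (Nat.mod_le _ _).trans ?_
    rw [Nat.one_le_iff_ne_zero]
    simpa using hx
  rw [ZMod.val_sub h1]
  omega

lemma gcyc_walk [NeZero L] {b : Bool} {a : Fin N₁} {i : ZMod L} {n : ℕ}
    {x y : GS N₁ L ⊕ GW N₁ L e} (hx : x = .inl (b, a, i + 1))
    (h : Rw (avoid (gadget fun _ _ _ => False) (.inl (b, a, i)) (.inl (b, a, i + 1))) n x y) :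
    (gproj y).1 = b ∧ (gproj y).2.1 = a ∧ ((gproj y).2.2 - (i + 1)).val ≤ n := by
  induction h with
  | nil => subst hx; simp [gproj]
  | @snoc n x y z h hyz ih =>
    obtain ⟨h1, h2, h3⟩ := ih hx
    obtain ⟨hyz, hne⟩ := hyz
    match y, z, hyz, hne, h1, h2, h3 with
    | .inl y, .inl z, hyz, hne, h1, h2, h3 =>
      simp only [gproj] at *
      obtain ⟨h4, h5, h6 | h6⟩ := hyz
      · refine ⟨by rw [← h4, h1], by rw [← h5, h2], ?_⟩
        rw [h6, show y.2.2 + 1 - (i + 1) = y.2.2 - (i + 1) + 1 by ring]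
        refine (ZMod.val_add_le _ _).trans (Nat.add_le_add h3 ?_)
        rw [ZMod.val_one_eq_one_mod]
        exact Nat.mod_le _ _
      · refine ⟨by rw [← h4, h1], by rw [← h5, h2], ?_⟩
        rw [show z.2.2 - (i + 1) = y.2.2 - (i + 1) - 1 by rw [h6]; ring]
        refine (val_sub_one_le _ ?_).trans (h3.trans (Nat.le_succ _))
        intro h0
        have hy : y.2.2 = i + 1 := sub_eq_zero.1 h0
        have hz : z.2.2 = i := by
          rw [hy] at h6; exact (add_right_cancel h6).symm
        apply hne
        right
        simp only [Sum.inl.injEq, Prod.ext_iff]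
        exact ⟨⟨h1, h2, hy⟩, by rw [← h4, h1], by rw [← h5, h2], hz⟩
    | .inl y, .inr z, hyz, hne, h1, h2, h3 =>
      simp only [gproj, gadget, ginc, and_false, or_false] at *
      obtain ⟨h4, h5, h6⟩ := hyz
      rw [h4, ← h6, ← h5]
      exact ⟨h1, h2, h3.trans (Nat.le_succ _)⟩
    | .inr y, .inl z, hyz, hne, h1, h2, h3 =>
      simp only [gproj, gadget, ginc, and_false, or_false] at *
      obtain ⟨h4, h5, h6⟩ := hyz
      rw [← h4, h6, h5]
      exact ⟨h1, h2, h3.trans (Nat.le_succ _)⟩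

lemma noShort_gadget_empty [NeZero L] :
    NoShort (gadget (N₁ := N₁) (L := L) (e := e) fun _ _ _ => False) L := by
  have hsymm := gadget_symm (N₁ := N₁) (L := L) (e := e) (Q := fun _ _ _ => False)
  have key : ∀ (b : Bool) (a : Fin N₁) (i : ZMod L) n,
      Rw (avoid (gadget (e := e) fun _ _ _ => False) (.inl (b, a, i)) (.inl (b, a, i + 1))) n
        (.inl (b, a, i + 1)) (.inl (b, a, i)) → L ≤ n + 1 := by
    intro b a i n h
    have := (gcyc_walk rfl h).2.2
    simp only [gproj] at this
    rw [show i - (i + 1) = -1 by ring] at this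
    have h2 : ((-1 : ZMod L)).val = L - 1 := by
      obtain ⟨k, rfl⟩ := Nat.exists_eq_succ_of_ne_zero (NeZero.ne L)
      rw [ZMod.val_neg_one]; simp
    omega
  have key2 : ∀ (s : GS N₁ L) (w : GW N₁ L e) n, ginc (fun _ _ _ => False) s w →
      ¬ Rw (avoid (gadget fun _ _ _ => False) (.inl s) (.inr w)) n (.inl s) (.inr w) := by
    intro s w n hsw h
    cases n with
    | zero => exact absurd h.eq_of_zero (by simp)
    | succ n =>
      obtain _ | ⟨h1, h2⟩ := h
      rename_i y
      match y, h2 with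
      | .inl y, h2 =>
        obtain ⟨h3, h4⟩ := h2
        simp only [gadget, ginc, and_false, or_false] at h3 hsw
        apply h4
        left
        refine ⟨?_, rfl⟩
        rw [Sum.inl.injEq]
        refine Prod.ext_iff.2 ⟨by rw [h3.2.1, hsw.2.1], Prod.ext_iff.2 ⟨?_, ?_⟩⟩
        · rw [h3.2.2, hsw.2.2]
        · rw [← h3.1, hsw.1]
      | .inr y, h2 => exact h2.1
  have hav : ∀ (x y : GS N₁ L ⊕ GW N₁ L e), avoid (gadget (e := e) fun _ _ _ => False) x y =
      avoid (gadget fun _ _ _ => False) y x := by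
    intro x y; funext a b; simp only [avoid]; rw [or_comm]
  intro x y hxy n hn
  match x, y, hxy, hn with
  | .inl x, .inl y, hxy, hn =>
    obtain ⟨b, a, i⟩ := x
    obtain ⟨b', a', i'⟩ := y
    obtain ⟨h1, h2, h3⟩ := hxy
    simp only at h1 h2 h3
    subst h1 h2
    rcases h3 with rfl | rfl
    · exact key b a i n (hn.symm (avoid_symm hsymm))
    · rw [hav] at hn
      exact key b a i' n hn
  | .inl x, .inr y, hxy, hn => exact absurd hn (key2 _ _ _ hxy)
  | .inr x, .inl y, hxy, hn =>
    rw [hav] at hn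
    exact absurd (hn.symm (avoid_symm hsymm)) (key2 _ _ _ hxy)

end GadgetGirth

section GadgetExists

variable {N₁ L e : ℕ} [NeZero L] {Q Q' : ZMod L × Fin e → Fin N₁ → Fin N₁ → Prop}

lemma gadget_le_addEdge {c : ZMod L × Fin e} {a b : Fin N₁}
    (h : ∀ c' a' b', Q' c' a' b' → Q c' a' b' ∨ (c' = c ∧ a' = a ∧ b' = b)) :
    ∀ x y, gadget Q' x y → addEdge (gadget Q) (.inr (c, a)) (.inl (false, b, c.1)) x y := by
  rintro (s | w) (s' | w') hxy
  · exact Or.inl hxy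
  · obtain ⟨h1, h2 | h2⟩ := hxy
    · exact Or.inl ⟨h1, Or.inl h2⟩
    · rcases h _ _ _ h2.2 with h3 | ⟨h3, h4, h5⟩
      · exact Or.inl ⟨h1, Or.inr ⟨h2.1, h3⟩⟩
      · refine Or.inr (Or.inr ⟨?_, ?_⟩)
        · rw [Sum.inl.injEq]
          exact Prod.ext h2.1 (Prod.ext h5 (by rw [← h1, h3]))
        · rw [Sum.inr.injEq]
          exact Prod.ext h3 h4
  · obtain ⟨h1, h2 | h2⟩ := hxy
    · exact Or.inl ⟨h1, Or.inl h2⟩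
    · rcases h _ _ _ h2.2 with h3 | ⟨h3, h4, h5⟩
      · exact Or.inl ⟨h1, Or.inr ⟨h2.1, h3⟩⟩
      · refine Or.inr (Or.inl ⟨?_, ?_⟩)
        · rw [Sum.inr.injEq]
          exact Prod.ext h3 h4
        · rw [Sum.inl.injEq]
          exact Prod.ext h2.1 (Prod.ext h5 (by rw [← h1, h3]))
  · exact hxy.elim

lemma rw_of_middle {n : ℕ} {c : ZMod L × Fin e} {a : Fin N₁} {z : GS N₁ L ⊕ GW N₁ L e}
    (h : Rw (gadget Q) n (.inr (c, a)) z) : Rw (gadget Q) (n + 1) (.inl (true, a, c.1)) z :=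
  Rw.cons (show gadget Q (.inl (true, a, c.1)) (.inr (c, a)) from ⟨rfl, Or.inl ⟨rfl, rfl⟩⟩) h

lemma exists_larger_matching {g : ℕ} {lam : ℝ} (hlam : 3 ≤ lam)
    (hlam2 : 2 * lam + (e + 1) ≤ lam ^ 2) (hN : 4 * lam ^ (g + 2) < N₁)
    (P : Finset ((ZMod L × Fin e) × Fin N₁ × Fin N₁))
    (hP : PMatch fun c a b => (c, a, b) ∈ P) (hns : NoShort (gadget fun c a b => (c, a, b) ∈ P) g)
    (c : ZMod L × Fin e) (a : Fin N₁) (ha : ∀ b, (c, a, b) ∉ P) :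
    ∃ P' : Finset ((ZMod L × Fin e) × Fin N₁ × Fin N₁), (PMatch fun c a b => (c, a, b) ∈ P') ∧
      NoShort (gadget fun c a b => (c, a, b) ∈ P') g ∧ P.card < P'.card := by
  set K := gadget fun c a b => (c, a, b) ∈ P with hK
  have hKs : ∀ x y, K x y → K y x := gadget_symm
  set M := P.filter fun p => p.1 = c with hM
  have hMP : ∀ a' b', (c, a', b') ∈ M ↔ (c, a', b') ∈ P := fun a' b' => by simp [hM]
  have hM1 : ∀ p ∈ M, p.1 = c ∧ p ∈ P := fun p hp => by simpa [hM, and_comm] using hp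
  have inj1 : Set.InjOn (fun p : (ZMod L × Fin e) × Fin N₁ × Fin N₁ => p.2.1) M := by
    rintro ⟨c₁, a₁, b₁⟩ h₁ ⟨c₂, a₂, b₂⟩ h₂ h
    obtain ⟨rfl, h₁'⟩ := hM1 _ h₁
    obtain ⟨h₃, h₂'⟩ := hM1 _ h₂
    simp only at h h₃
    subst h h₃
    have := hP.1 _ a₁ b₁ b₂ h₁' h₂'
    subst this; rfl
  have inj2 : Set.InjOn (fun p : (ZMod L × Fin e) × Fin N₁ × Fin N₁ => p.2.2) M := by
    rintro ⟨c₁, a₁, b₁⟩ h₁ ⟨c₂, a₂, b₂⟩ h₂ h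
    obtain ⟨rfl, h₁'⟩ := hM1 _ h₁
    obtain ⟨h₃, h₂'⟩ := hM1 _ h₂
    simp only at h h₃
    subst h h₃
    have := hP.2 _ a₁ a₂ b₁ h₁' h₂'
    subst this; rfl
  obtain ⟨Ba, hBa, hBa'⟩ := exists_gadget_ball hP hlam hlam2 (g + 2) (true, a, c.1)
  have hfar : ∀ s, s ∉ Ba → ∀ n, Rw K n (.inr (c, a)) (.inl s) → g ≤ n + 1 := by
    intro s hs n hn
    by_contra hc
    exact hs (hBa' (n + 1) (by omega) s (rw_of_middle hn))
  set Bu := Finset.univ \ M.image (fun p => p.2.2) with hBu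
  have hBu1 : ∀ b, b ∈ Bu ↔ ∀ a', (c, a', b) ∉ P := by
    intro b
    simp only [hBu, Finset.mem_sdiff, Finset.mem_univ, true_and, Finset.mem_image, not_exists,
      not_and]
    constructor
    · intro h a' ha'
      exact h _ ((hMP _ _).2 ha') rfl
    · rintro h ⟨c₁, a₁, b₁⟩ hp rfl
      obtain ⟨rfl, hp'⟩ := hM1 _ hp
      exact h _ hp'
  have hBuc : Bu.card + M.card = N₁ := by
    have := Finset.card_sdiff_add_card_eq_card (Finset.subset_univ (M.image (fun p => p.2.2)))
    rw [Finset.card_image_of_injOn inj2] at this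
    simpa using this
  by_cases h1 : ∃ b ∈ Bu, ((false, b, c.1) : GS N₁ L) ∉ Ba
  · obtain ⟨b, hb, hbB⟩ := h1
    rw [hBu1] at hb
    refine ⟨insert (c, a, b) P, ⟨?_, ?_⟩, ?_, ?_⟩
    · intro c' a' b₁ b₂ h1 h2
      have := hP.1 c' a' b₁ b₂
      simp only [Finset.mem_insert, Prod.mk.injEq] at h1 h2
      grind
    · intro c' a₁ a₂ b' h1 h2
      have := hP.2 c' a₁ a₂ b'
      simp only [Finset.mem_insert, Prod.mk.injEq] at h1 h2
      grind
    · refine (NoShort.addEdge hKs hns (hfar _ hbB)).mono (gadget_le_addEdge ?_)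
      intro c' a' b' h
      simpa [or_comm] using h
    · rw [Finset.card_insert_of_notMem (ha b)]
      omega
  · push Not at h1
    have hle : Bu.card ≤ Ba.card :=
      Finset.card_le_card_of_injOn (fun b => (false, b, c.1)) h1 fun b₁ _ b₂ _ h => by
        simpa using h
    have hMlt : M.card < N₁ := by
      have : (M.image fun p => p.2.1).card < (Finset.univ : Finset (Fin N₁)).card := by
        refine Finset.card_lt_card (Finset.ssubset_univ_iff.2 fun h => ?_)
        have h2 : a ∈ M.image fun p => p.2.1 := by rw [h]; simp
        obtain ⟨⟨c₁, a₁, b₁⟩, hp, rfl⟩ := Finset.mem_image.1 h2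
        obtain ⟨rfl, hp'⟩ := hM1 _ hp
        exact ha _ hp'
      rw [Finset.card_image_of_injOn inj1] at this
      simpa using this
    obtain ⟨b, hb⟩ : Bu.Nonempty := by rw [← Finset.card_pos]; omega
    rw [hBu1] at hb
    obtain ⟨Bb, hBb, hBb'⟩ := exists_gadget_ball hP hlam hlam2 (g + 2) (false, b, c.1)
    have hMbig : Ba.card + Bb.card + Ba.card < M.card := by
      have h2 : (N₁ : ℝ) ≤ Ba.card + M.card := by
        exact_mod_cast (by omega : N₁ ≤ Ba.card + M.card)
      have : ((Ba.card : ℝ) + Bb.card + Ba.card) < M.card := by linarith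
      exact_mod_cast this
    obtain ⟨p, hp, hp1, hp2, hp3⟩ : ∃ p ∈ M, ((true, p.2.1, c.1) : GS N₁ L) ∉ Ba ∧
        ((true, p.2.1, c.1) : GS N₁ L) ∉ Bb ∧ ((false, p.2.2, c.1) : GS N₁ L) ∉ Ba := by
      by_contra hc
      push Not at hc
      have hsub : M ⊆ (M.filter fun p => ((true, p.2.1, c.1) : GS N₁ L) ∈ Ba) ∪
          (M.filter fun p => ((true, p.2.1, c.1) : GS N₁ L) ∈ Bb) ∪
          (M.filter fun p => ((false, p.2.2, c.1) : GS N₁ L) ∈ Ba) := by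
        intro p hp
        have := hc p hp
        simp only [Finset.mem_union, Finset.mem_filter, hp, true_and]
        tauto
      have hcc := (Finset.card_le_card hsub).trans (Finset.card_union_le _ _)
      have hc2 := Finset.card_union_le (M.filter fun p => ((true, p.2.1, c.1) : GS N₁ L) ∈ Ba)
        (M.filter fun p => ((true, p.2.1, c.1) : GS N₁ L) ∈ Bb)
      have i1 : ∀ B : Finset (GS N₁ L),
          (M.filter fun p => ((true, p.2.1, c.1) : GS N₁ L) ∈ B).card ≤ B.card := fun B =>
        Finset.card_le_card_of_injOn (fun p => (true, p.2.1, c.1))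
          (fun p hp => (Finset.mem_filter.1 hp).2) fun p₁ h₁ p₂ h₂ h =>
            inj1 (Finset.mem_filter.1 h₁).1 (Finset.mem_filter.1 h₂).1 (by simpa using h)
      have i2 : (M.filter fun p => ((false, p.2.2, c.1) : GS N₁ L) ∈ Ba).card ≤ Ba.card :=
        Finset.card_le_card_of_injOn (fun p => (false, p.2.2, c.1))
          (fun p hp => (Finset.mem_filter.1 hp).2) fun p₁ h₁ p₂ h₂ h =>
            inj2 (Finset.mem_filter.1 h₁).1 (Finset.mem_filter.1 h₂).1 (by simpa using h)
      have := i1 Ba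
      have := i1 Bb
      omega
    obtain ⟨c', a', b'⟩ := p
    obtain ⟨rfl, hpP⟩ := hM1 _ hp
    simp only at *
    set P₁ := P.erase (c', a', b') with hP₁
    set K₁ := gadget fun c a b => (c, a, b) ∈ P₁ with hK₁
    have hK₁K : ∀ x y, K₁ x y → K x y := gadget_mono fun _ _ _ h => Finset.mem_of_mem_erase h
    have hK₁s : ∀ x y, K₁ x y → K₁ y x := gadget_symm
    have hK₁avoid : ∀ x y, K₁ x y → avoid K (.inr (c', a')) (.inl (false, b', c'.1)) x y := by
      intro x y h
      refine ⟨hK₁K _ _ h, ?_⟩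
      rintro (⟨rfl, rfl⟩ | ⟨rfl, rfl⟩)
      · obtain ⟨h1, h2 | h2⟩ := h
        · simp at h2
        · simp [hP₁] at h2
      · obtain ⟨h1, h2 | h2⟩ := h
        · simp at h2
        · simp [hP₁] at h2
    set K₂ := addEdge K₁ (.inr (c', a)) (.inl (false, b', c'.1)) with hK₂
    have hns₂ : NoShort K₂ g := NoShort.addEdge hK₁s (hns.mono hK₁K) fun n hn =>
      hfar _ hp3 n (hn.mono hK₁K)
    have hK₂s : ∀ x y, K₂ x y → K₂ y x := addEdge_symm hK₁s
    have hns₃ : NoShort (addEdge K₂ (.inr (c', a')) (.inl (false, b, c'.1))) g := by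
      refine NoShort.addEdge hK₂s hns₂ fun n hn => ?_
      rcases hn.addEdge_cases with ⟨k, hk, h⟩ | ⟨k, l, hkl, ⟨h, -⟩ | ⟨h, -⟩⟩
      · by_contra hlt
        exact hp2 (hBb' (k + 1) (by omega) _ ((rw_of_middle (h.mono hK₁K)).symm hKs))
      · by_contra hlt
        refine hp1 (hBa' (k + 1 + 1) (by omega) _ ?_)
        exact rw_of_middle ((rw_of_middle (h.mono hK₁K)).symm hKs)
      · have := hns _ _ (show K (.inr (c', a')) (.inl (false, b', c'.1)) from
          ⟨rfl, Or.inr ⟨rfl, hpP⟩⟩) k (h.mono hK₁avoid)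
        omega
    have n1 : (c', a, b') ∉ P₁ := fun h => ha _ (Finset.mem_of_mem_erase h)
    have hbb : b ≠ b' := fun h => hb a' (h ▸ hpP)
    have haa : a ≠ a' := fun h => ha b' (h ▸ hpP)
    have n2 : (c', a', b) ∉ insert (c', a, b') P₁ := by
      intro h
      rcases Finset.mem_insert.1 h with h | h
      · simp only [Prod.mk.injEq] at h; exact hbb h.2.2
      · exact hb _ (Finset.mem_of_mem_erase h)
    refine ⟨insert (c', a', b) (insert (c', a, b') P₁), ⟨?_, ?_⟩, ?_, ?_⟩
    · intro c₁ a₁ b₁ b₂ h1 h2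
      have := hP.1 c₁ a₁ b₁ b₂
      have := hP.1 c' a' b' b₁
      have := hP.1 c' a' b' b₂
      simp only [hP₁, Finset.mem_insert, Finset.mem_erase, Prod.mk.injEq, ne_eq] at h1 h2
      grind
    · intro c₁ a₁ a₂ b₁ h1 h2
      have := hP.2 c₁ a₁ a₂ b₁
      have := hP.2 c' a' a₁ b'
      have := hP.2 c' a' a₂ b'
      simp only [hP₁, Finset.mem_insert, Finset.mem_erase, Prod.mk.injEq, ne_eq] at h1 h2
      grind
    · refine hns₃.mono ?_
      intro x y h
      have h3 := gadget_le_addEdge (Q := fun c₀ a₀ b₀ => (c₀, a₀, b₀) ∈ insert (c', a, b') P₁)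
        (c := c') (a := a') (b := b) (fun c₀ a₀ b₀ h => by
          simpa [or_comm, or_assoc, or_left_comm] using h) x y h
      rcases h3 with h3 | h3
      · left
        exact gadget_le_addEdge (fun c₀ a₀ b₀ h => by simpa [or_comm] using h) x y h3
      · exact Or.inr h3
    · rw [Finset.card_insert_of_notMem n2, Finset.card_insert_of_notMem n1, hP₁,
        Finset.card_erase_of_mem hpP]
      have : 0 < P.card := Finset.card_pos.2 ⟨_, hpP⟩
      omega

/-- There is a gadget of large girth. -/
theorem exists_gadget {g : ℕ} (hg : g ≤ L) {lam : ℝ} (hlam : 3 ≤ lam)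
    (hlam2 : 2 * lam + (e + 1) ≤ lam ^ 2) (hN : 4 * lam ^ (g + 2) < N₁) :
    ∃ π : ZMod L × Fin e → Equiv.Perm (Fin N₁), NoShort (gadget fun c a b => π c a = b) g := by
  obtain ⟨P, hP, hmax⟩ := Finset.exists_max_image
    ((Finset.univ : Finset (Finset ((ZMod L × Fin e) × Fin N₁ × Fin N₁))).filter fun P =>
      (PMatch fun c a b => (c, a, b) ∈ P) ∧ NoShort (gadget fun c a b => (c, a, b) ∈ P) g)
    Finset.card ⟨∅, by
      simp only [Finset.mem_filter, Finset.mem_univ, true_and, Finset.notMem_empty]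
      exact ⟨⟨by simp, by simp⟩, noShort_gadget_empty.of_le hg⟩⟩
  simp only [Finset.mem_filter, Finset.mem_univ, true_and] at hP hmax
  have htot : ∀ c a, ∃ b, (c, a, b) ∈ P := by
    intro c a
    by_contra hc
    push Not at hc
    obtain ⟨P', h1, h2, h3⟩ := exists_larger_matching hlam hlam2 hN P hP.1 hP.2 c a hc
    exact absurd (hmax P' ⟨h1, h2⟩) (by omega)
  choose f hf using htot
  have hinj : ∀ c, Function.Injective (f c) := fun c a a' h =>
    hP.1.2 c a a' (f c a) (hf c a) (h ▸ hf c a')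
  refine ⟨fun c => Equiv.ofBijective (f c) (Finite.injective_iff_bijective.1 (hinj c)), ?_⟩
  refine hP.2.mono (gadget_mono ?_)
  rintro c a b rfl
  exact hf c a

end GadgetExists

section Surgery

/-- Data for replacing the half-edges lying on short cycles, together with padding half-edges of
label `0`, by edges to copies of a gadget. -/
structure Surgery (d e N₁ L J : ℕ) (U : Type) where
  σ : Fin (d + 1) → U → U
  π : ZMod L × Fin e → Equiv.Perm (Fin N₁)
  Z : Finset U
  g : ℕ
  slot : {h : U × Fin (d + 1) // BadHalf σ g h.1 h.2 ∨ (h.2 = 0 ∧ h.1 ∈ Z)} ≃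
    (GW N₁ L e × Fin e) × Fin J
  ε : Fin (d + 1) ≃ Bool ⊕ Fin e
  invol : ∀ i x, σ i (σ i x) = x ∧ σ i x ≠ x
  three_le : 3 ≤ L
  one_le : 1 ≤ g
  girth_gadget : NoShort (gadget fun c a b => π c a = b) g
  bad_le_two : ∀ x, (Finset.univ.filter fun i => BadHalf σ g x i).card ≤ 2
  copy_inj : ∀ h h', BadHalf σ g h.1.1 h.1.2 → BadHalf σ g h'.1.1 h'.1.2 →
    (slot h).2 = (slot h').2 → h = h'
  partner_mem : ∀ z ∈ Z, σ 0 z ∈ Z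
  pad_not_bad : ∀ z ∈ Z, ∀ i, ¬ BadHalf σ g z i
  pad_far : ∀ z ∈ Z, ∀ x, (x ∈ Z ∨ ∃ i, BadHalf σ g x i) → x ≠ z → x ≠ σ 0 z →
    ∀ n, Rw (fun a b => ∃ i, σ i a = b) n z x → g ≤ n

namespace Surgery

variable {d e N₁ L J : ℕ} {U : Type} (S : Surgery d e N₁ L J U)

/-- The half-edge is removed. -/
def Cut (x : U) (i : Fin (d + 1)) : Prop := BadHalf S.σ S.g x i ∨ (i = 0 ∧ x ∈ S.Z)

/-- The removed half-edges. -/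
abbrev Half := {h : U × Fin (d + 1) // BadHalf S.σ S.g h.1 h.2 ∨ (h.2 = 0 ∧ h.1 ∈ S.Z)}

/-- The remaining edges. -/
def rem (a b : U) : Prop := ∃ i, S.σ i a = b ∧ ¬ S.Cut a i

lemma cut_partner {x : U} {i : Fin (d + 1)} (h : S.Cut x i) : S.Cut (S.σ i x) i := by
  rcases h with h | ⟨rfl, h⟩
  · exact Or.inl (h.partner S.invol)
  · exact Or.inr ⟨rfl, S.partner_mem _ h⟩

lemma cut_partner_iff {x : U} {i : Fin (d + 1)} : S.Cut (S.σ i x) i ↔ S.Cut x i := by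
  refine ⟨fun h => ?_, S.cut_partner⟩
  have := S.cut_partner h
  rwa [(S.invol i x).1] at this

lemma rem_symm : ∀ a b, S.rem a b → S.rem b a := by
  rintro a b ⟨i, rfl, h⟩
  exact ⟨i, (S.invol i a).1, fun h' => h (S.cut_partner_iff.1 h')⟩

lemma rem_le : ∀ a b, S.rem a b → ∃ i, S.σ i a = b := fun _ _ ⟨i, h, _⟩ => ⟨i, h⟩

lemma noShort_rem : NoShort S.rem S.g := by
  rintro a b ⟨i, rfl, hi⟩ n hn
  by_contra hc
  refine hi (Or.inl ⟨n, by omega, ?_⟩)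
  refine (hn.symm (avoid_symm S.rem_symm)).mono ?_
  rintro x y ⟨⟨j, rfl, hj⟩, hne⟩
  refine ⟨j, rfl, ?_⟩
  rintro ⟨rfl, rfl | h⟩
  · exact hne (Or.inl ⟨rfl, rfl⟩)
  · refine hne (Or.inr ⟨?_, h⟩)
    rw [← h, (S.invol j x).1]

lemma pad_far_rem {z x : U} (hz : z ∈ S.Z) (hx : x ∈ S.Z ∨ ∃ i, BadHalf S.σ S.g x i)
    (hne : x ≠ z) {n : ℕ} (h : Rw S.rem n z x) : S.g ≤ n := by
  by_cases h0 : x = S.σ 0 z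
  · subst h0
    by_contra hc
    refine S.pad_not_bad z hz 0 ⟨n, by omega, ?_⟩
    refine (h.symm S.rem_symm).mono ?_
    rintro a b ⟨j, rfl, hj⟩
    refine ⟨j, rfl, ?_⟩
    rintro ⟨rfl, rfl | h⟩
    · exact hj (Or.inr ⟨rfl, hz⟩)
    · exact hj (S.cut_partner_iff.1 (Or.inr ⟨rfl, by rwa [h]⟩))
  · exact S.pad_far z hz x hx hne h0 n (h.mono S.rem_le)

lemma marked (h : S.Half) : h.1.1 ∈ S.Z ∨ ∃ i, BadHalf S.σ S.g h.1.1 i := by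
  rcases h.2 with h' | h'
  · exact Or.inr ⟨_, h'⟩
  · exact Or.inl h'.2

lemma pad_ext {h h' : S.Half} (hz : h.1.1 ∈ S.Z) (e : h'.1.1 = h.1.1) : h' = h := by
  obtain ⟨⟨x, i⟩, hx⟩ := h
  obtain ⟨⟨x', i'⟩, hx'⟩ := h'
  simp only at e hz
  subst e
  have h1 := hx.resolve_left (S.pad_not_bad _ hz _)
  have h2 := hx'.resolve_left (S.pad_not_bad _ hz _)
  simp only at h1 h2
  obtain ⟨rfl, -⟩ := h1
  obtain ⟨rfl, -⟩ := h2
  rfl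

/-- The surgered graph with only the crossing edges of the half-edges in `E`. -/
def gr (E : Set S.Half) :
    U ⊕ ((GS N₁ L ⊕ GW N₁ L e) × Fin J) → U ⊕ ((GS N₁ L ⊕ GW N₁ L e) × Fin J) → Prop
  | .inl a, .inl b => S.rem a b
  | .inl a, .inr t => ∃ h ∈ E, h.1.1 = a ∧ t.1 = .inr (S.slot h).1.1 ∧ t.2 = (S.slot h).2
  | .inr t, .inl a => ∃ h ∈ E, h.1.1 = a ∧ t.1 = .inr (S.slot h).1.1 ∧ t.2 = (S.slot h).2
  | .inr t, .inr t' => t.2 = t'.2 ∧ gadget (fun c a b => S.π c a = b) t.1 t'.1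

lemma gr_symm (E : Set S.Half) : ∀ x y, S.gr E x y → S.gr E y x := by
  rintro (a | t) (b | t') h
  · exact S.rem_symm _ _ h
  · exact h
  · exact h
  · exact ⟨h.1.symm, gadget_symm _ _ h.2⟩

lemma gr_empty_inl {a b x : U} {n : ℕ} {p q : U ⊕ ((GS N₁ L ⊕ GW N₁ L e) × Fin J)}
    (h : Rw (avoid (S.gr ∅) (.inl a) (.inl b)) n p q) (hp : p = .inl x) :
    ∃ y, q = .inl y ∧ Rw (avoid S.rem a b) n x y := by
  induction h with
  | nil => exact ⟨x, hp, .nil _⟩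
  | @snoc n p q t h hr ih =>
    obtain ⟨y, rfl, hy⟩ := ih hp
    obtain ⟨hr, hne⟩ := hr
    match t, hr, hne with
    | .inl t, hr, hne => exact ⟨t, rfl, hy.snoc ⟨hr, by simpa using hne⟩⟩
    | .inr t, hr, hne => obtain ⟨h, hh, -⟩ := hr; exact hh.elim

lemma gr_empty_inr {a b x : GS N₁ L ⊕ GW N₁ L e} {c : Fin J} {n : ℕ}
    {p q : U ⊕ ((GS N₁ L ⊕ GW N₁ L e) × Fin J)}
    (h : Rw (avoid (S.gr ∅) (.inr (a, c)) (.inr (b, c))) n p q) (hp : p = .inr (x, c)) :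
    ∃ y, q = .inr (y, c) ∧ Rw (avoid (gadget fun c a b => S.π c a = b) a b) n x y := by
  induction h with
  | nil => exact ⟨x, hp, .nil _⟩
  | @snoc n p q t h hr ih =>
    obtain ⟨y, rfl, hy⟩ := ih hp
    obtain ⟨hr, hne⟩ := hr
    match t, hr, hne with
    | .inl t, hr, hne => obtain ⟨h, hh, -⟩ := hr; exact hh.elim
    | .inr (t, c'), hr, hne =>
      obtain ⟨h1, h2⟩ := hr
      simp only at h1 h2
      subst h1
      exact ⟨t, rfl, hy.snoc ⟨h2, by simpa using hne⟩⟩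

lemma noShort_gr_empty : NoShort (S.gr ∅) S.g := by
  rintro (a | ⟨a, c⟩) (b | ⟨b, c'⟩) hab n hn
  · obtain ⟨y, hy, h⟩ := S.gr_empty_inl hn rfl
    obtain rfl := Sum.inl.inj hy
    exact S.noShort_rem _ _ hab n h
  · obtain ⟨h, hh, -⟩ := hab; exact hh.elim
  · obtain ⟨h, hh, -⟩ := hab; exact hh.elim
  · obtain ⟨h1, h2⟩ := hab
    simp only at h1 h2
    subst h1
    obtain ⟨y, hy, h⟩ := S.gr_empty_inr hn rfl
    obtain rfl : b = y := by simpa using hy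
    exact S.girth_gadget _ _ h2 n h

lemma gr_walk_pad {E : Set S.Half} {h₀ : S.Half} (hE : h₀ ∉ E) (hz : h₀.1.1 ∈ S.Z) {n : ℕ}
    {p q : U ⊕ ((GS N₁ L ⊕ GW N₁ L e) × Fin J)} (h : Rw (S.gr E) n p q) (hp : p = .inl h₀.1.1) :
    S.g ≤ n ∨ ∃ a, q = .inl a ∧ ∃ m ≤ n, Rw S.rem m h₀.1.1 a := by
  induction h with
  | nil => exact Or.inr ⟨_, hp, 0, le_rfl, .nil _⟩
  | @snoc n p q t h hr ih =>
    rcases ih hp with h1 | ⟨a, rfl, m, hm, hw⟩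
    · exact Or.inl (by omega)
    · match t, hr with
      | .inl t, hr => exact Or.inr ⟨t, rfl, m + 1, by omega, hw.snoc hr⟩
      | .inr t, hr =>
        obtain ⟨h', hh', rfl, -⟩ := hr
        left
        have := S.pad_far_rem hz (S.marked h') (fun e => hE (S.pad_ext hz e ▸ hh')) hw
        omega

lemma gr_walk_bad {E : Set S.Half} {h₀ : S.Half} (hE : h₀ ∉ E)
    (hb : BadHalf S.σ S.g h₀.1.1 h₀.1.2) {n : ℕ}
    {p q : U ⊕ ((GS N₁ L ⊕ GW N₁ L e) × Fin J)} (h : Rw (S.gr E) n p q) (hp : p = .inl h₀.1.1) :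
    S.g ≤ n ∨ (∃ t, q = .inr t ∧ t.2 ≠ (S.slot h₀).2) ∨
      ∃ a, q = .inl a ∧ ∃ h' : S.Half, (BadHalf S.σ S.g h'.1.1 h'.1.2 ∨
        (S.slot h').2 ≠ (S.slot h₀).2) ∧ ∃ m ≤ n, Rw S.rem m h'.1.1 a := by
  induction h with
  | nil => exact Or.inr (Or.inr ⟨_, hp, h₀, Or.inl hb, 0, le_rfl, .nil _⟩)
  | @snoc n p q t h hr ih =>
    rcases ih hp with h1 | ⟨s, rfl, hs⟩ | ⟨a, rfl, h', hh', m, hm, hw⟩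
    · exact Or.inl (by omega)
    · match t, hr with
      | .inl t, hr =>
        obtain ⟨h', -, rfl, -, h2⟩ := hr
        exact Or.inr (Or.inr ⟨_, rfl, h', Or.inr (h2 ▸ hs), 0, by omega, .nil _⟩)
      | .inr t, hr => exact Or.inr (Or.inl ⟨t, rfl, hr.1 ▸ hs⟩)
    · match t, hr with
      | .inl t, hr => exact Or.inr (Or.inr ⟨t, rfl, h', hh', m + 1, by omega, hw.snoc hr⟩)
      | .inr t, hr =>
        obtain ⟨k, hk, rfl, h1, h2⟩ := hr
        by_cases hc : t.2 = (S.slot h₀).2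
        · left
          have hkne : k ≠ h₀ := fun e => hE (e ▸ hk)
          have hkb : ¬ BadHalf S.σ S.g k.1.1 k.1.2 := fun hkb =>
            hkne (S.copy_inj _ _ hkb hb (h2.symm.trans hc))
          have hkz := (k.2.resolve_left hkb).2
          have hne : h'.1.1 ≠ k.1.1 := by
            intro e
            obtain rfl := S.pad_ext hkz e
            rcases hh' with hh' | hh'
            · exact hkb hh'
            · exact hh' (h2.symm.trans hc)
          have := S.pad_far_rem hkz (S.marked h') hne (hw.symm S.rem_symm)
          omega
        · exact Or.inr (Or.inl ⟨t, rfl, hc⟩)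

lemma noShort_gr_finset (E : Finset S.Half) : NoShort (S.gr E) S.g := by
  induction E using Finset.induction_on with
  | empty => simpa using S.noShort_gr_empty
  | insert h₀ E hE ih =>
    have key : ∀ n, Rw (S.gr E) n (.inl h₀.1.1) (.inr (.inr (S.slot h₀).1.1, (S.slot h₀).2)) →
        S.g ≤ n + 1 := by
      intro n hn
      have hE' : h₀ ∉ (E : Set S.Half) := by simpa using hE
      rcases h₀.2 with hb | hz
      · rcases S.gr_walk_bad hE' hb hn rfl with h | ⟨t, ht, h⟩ | ⟨a, ha, -⟩
        · omega
        · obtain rfl := Sum.inr.inj ht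
          exact absurd rfl h
        · simp at ha
      · rcases S.gr_walk_pad hE' hz.2 hn rfl with h | ⟨a, ha, -⟩
        · omega
        · simp at ha
    refine (NoShort.addEdge (S.gr_symm E) ih key).mono ?_
    rintro (a | t) (b | t') hab
    · exact Or.inl hab
    · obtain ⟨h, hh, rfl, h1, h2⟩ := hab
      rcases Finset.mem_insert.1 (Finset.mem_coe.1 hh) with rfl | hh
      · exact Or.inr (Or.inl ⟨rfl, by rw [Sum.inr.injEq]; exact Prod.ext h1 h2⟩)
      · exact Or.inl ⟨h, hh, rfl, h1, h2⟩
    · obtain ⟨h, hh, rfl, h1, h2⟩ := hab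
      rcases Finset.mem_insert.1 (Finset.mem_coe.1 hh) with rfl | hh
      · exact Or.inr (Or.inr ⟨by rw [Sum.inr.injEq]; exact Prod.ext h1 h2, rfl⟩)
      · exact Or.inl ⟨h, hh, rfl, h1, h2⟩
    · exact Or.inl hab

lemma noShort_gr [Fintype U] : NoShort (S.gr Set.univ) S.g := by
  have := S.noShort_gr_finset Finset.univ
  simpa using this

end Surgery

end Surgery

section Enumeration

variable {X I : Type*} [Fintype X] [Fintype I] {nb : X → I → X} {R : X → X → Prop}

lemma sum_nb_eq (hinj : ∀ x, Function.Injective (nb x)) (hR : ∀ x y, R x y ↔ ∃ i, nb x i = y)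
    (x : X) (f : X → ℝ) : ∑ i, f (nb x i) = ∑ y, if R x y then f y else 0 := by
  rw [← Finset.sum_filter, ← Finset.sum_image (g := nb x) fun i _ j _ h => hinj x h]
  refine Finset.sum_congr ?_ fun _ _ => rfl
  ext y
  simp [hR]

lemma sum_nb_swap (hinj : ∀ x, Function.Injective (nb x)) (hR : ∀ x y, R x y ↔ ∃ i, nb x i = y)
    (hsymm : ∀ x y, R x y → R y x) (f : X → X → ℝ) :
    ∑ x, ∑ i, f x (nb x i) = ∑ x, ∑ i, f (nb x i) x := by
  rw [Finset.sum_congr rfl fun x _ => sum_nb_eq hinj hR x (f x),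
    Finset.sum_congr rfl fun x _ => sum_nb_eq hinj hR x fun y => f y x, Finset.sum_comm]
  refine Finset.sum_congr rfl fun x _ => Finset.sum_congr rfl fun y _ => ?_
  have : R x y ↔ R y x := ⟨hsymm _ _, hsymm _ _⟩
  simp [this]

/-- Weighted arithmetic-geometric mean bound for a quadratic form. -/
lemma abs_sum_nb_le (hinj : ∀ x, Function.Injective (nb x)) (hR : ∀ x y, R x y ↔ ∃ i, nb x i = y)
    (hsymm : ∀ x y, R x y → R y x) (v : X → ℝ) (a y : X → X → ℝ)
    (hy : ∀ x x', R x x' → |a x x'| * (|v x| * |v x'|) ≤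
      (y x x' * v x ^ 2 + y x' x * v x' ^ 2) / 2) :
    |∑ x, ∑ i, a x (nb x i) * (v x * v (nb x i))| ≤ ∑ x, (∑ i, y x (nb x i)) * v x ^ 2 := by
  calc _ ≤ ∑ x, ∑ i, |a x (nb x i) * (v x * v (nb x i))| :=
        (Finset.abs_sum_le_sum_abs _ _).trans
          (Finset.sum_le_sum fun x _ => Finset.abs_sum_le_sum_abs _ _)
    _ ≤ ∑ x, ∑ i, (y x (nb x i) * v x ^ 2 + y (nb x i) x * v (nb x i) ^ 2) / 2 := by
        refine Finset.sum_le_sum fun x _ => Finset.sum_le_sum fun i _ => ?_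
        rw [abs_mul, abs_mul]
        exact hy x _ ((hR _ _).2 ⟨i, rfl⟩)
    _ = (∑ x, ∑ i, y x (nb x i) * v x ^ 2 + ∑ x, ∑ i, y (nb x i) x * v (nb x i) ^ 2) / 2 := by
        rw [← Finset.sum_add_distrib, Finset.sum_div]
        refine Finset.sum_congr rfl fun x _ => ?_
        rw [← Finset.sum_add_distrib, Finset.sum_div]
    _ = ∑ x, ∑ i, y x (nb x i) * v x ^ 2 := by
        rw [← sum_nb_swap hinj hR hsymm fun x x' => y x x' * v x ^ 2]
        ring
    _ = _ := by simp_rw [Finset.sum_mul]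

end Enumeration

namespace Surgery

variable {d e N₁ L J : ℕ} {U : Type} (S : Surgery d e N₁ L J U)

/-- The vertices of the surgered graph. -/
abbrev Vtx (N₁ L e J : ℕ) (U : Type) := U ⊕ ((GS N₁ L ⊕ GW N₁ L e) × Fin J)

/-- Neighbours of a side vertex of a gadget copy. -/
def nbS (s : GS N₁ L) (c : Fin J) : Bool ⊕ Fin e → Vtx N₁ L e J U
  | .inl true => .inr (.inl (s.1, s.2.1, s.2.2 + 1), c)
  | .inl false => .inr (.inl (s.1, s.2.1, s.2.2 - 1), c)
  | .inr r => .inr (.inr ((s.2.2, r), if s.1 then s.2.1 else (S.π (s.2.2, r)).symm s.2.1), c)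

/-- Neighbours of a middle vertex of a gadget copy. -/
def nbW (w : GW N₁ L e) (c : Fin J) : Bool ⊕ Fin e → Vtx N₁ L e J U
  | .inl true => .inr (.inl (true, w.2, w.1.1), c)
  | .inl false => .inr (.inl (false, S.π w.1 w.2, w.1.1), c)
  | .inr k => .inl (S.slot.symm ((w, k), c)).1.1

/-- Neighbours of an old vertex. -/
def nbU (x : U) (i : Fin (d + 1)) : Vtx N₁ L e J U :=
  if h : S.Cut x i then .inr (.inr (S.slot ⟨(x, i), h⟩).1.1, (S.slot ⟨(x, i), h⟩).2)
  else .inl (S.σ i x)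

/-- Enumeration of the neighbours. -/
def nb : Vtx N₁ L e J U → Fin (d + 1) → Vtx N₁ L e J U
  | .inl x, i => S.nbU x i
  | .inr (.inl s, c), i => S.nbS s c (S.ε i)
  | .inr (.inr w, c), i => S.nbW w c (S.ε i)

lemma two_ne_zero_zmod (S : Surgery d e N₁ L J U) : (2 : ZMod L) ≠ 0 := by
  have := S.three_le
  intro h
  have h2 : ((2 : ℕ) : ZMod L) = 0 := by exact_mod_cast h
  rw [ZMod.natCast_eq_zero_iff] at h2
  exact absurd (Nat.le_of_dvd (by norm_num) h2) (by omega)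

lemma one_ne_zero_zmod (S : Surgery d e N₁ L J U) : (1 : ZMod L) ≠ 0 := by
  intro h
  apply S.two_ne_zero_zmod
  rw [← one_add_one_eq_two, h, add_zero]

lemma rem_label_unique {x : U} {i j : Fin (d + 1)} (hi : ¬ S.Cut x i) (h : S.σ i x = S.σ j x) :
    i = j := by
  by_contra hne
  refine hi (Or.inl ⟨1, S.one_le, Rw.single ⟨j, ?_, fun h' => hne h'.1.symm⟩⟩)
  rw [h, (S.invol j x).1]

lemma half_ext {h h' : S.Half} (hx : h.1.1 = h'.1.1) (hc : (S.slot h).2 = (S.slot h').2) :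
    h = h' := by
  by_cases hz : h'.1.1 ∈ S.Z
  · exact S.pad_ext hz hx
  · exact S.copy_inj _ _ (h.2.resolve_right fun h1 => hz (hx ▸ h1.2))
      (h'.2.resolve_right fun h1 => hz h1.2) hc

lemma nb_injective (x : Vtx N₁ L e J U) : Function.Injective (S.nb x) := by
  have h2 := S.two_ne_zero_zmod
  match x with
  | .inl x =>
    intro i j h
    simp only [nb, nbU] at h
    split_ifs at h with hi hj hj
    · rw [Sum.inr.injEq, Prod.mk.injEq] at h
      have := S.half_ext (h := ⟨(x, i), hi⟩) (h' := ⟨(x, j), hj⟩) rfl h.2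
      exact congrArg (fun h : S.Half => h.1.2) this
    · rw [Sum.inl.injEq] at h
      exact S.rem_label_unique hi h
  | .inr (.inl s, c) =>
    refine Function.Injective.comp (g := S.nbS s c) ?_ S.ε.injective
    rintro ((_ | _) | r) ((_ | _) | r') h <;> simp [nbS] at h ⊢
    · apply h2
      have : s.2.2 - 1 + 2 = s.2.2 + 1 := by ring
      rw [h] at this
      have h3 : s.2.2 + 1 + 2 = s.2.2 + 1 + 0 := by rw [this, add_zero]
      exact add_left_cancel h3
    · apply h2
      have : s.2.2 - 1 + 2 = s.2.2 + 1 := by ring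
      rw [← h] at this
      have h3 : s.2.2 + 1 + 2 = s.2.2 + 1 + 0 := by rw [this, add_zero]
      exact add_left_cancel h3
    · exact h.1
  | .inr (.inr w, c) =>
    refine Function.Injective.comp (g := S.nbW w c) ?_ S.ε.injective
    rintro ((_ | _) | k) ((_ | _) | k') h <;> simp [nbW] at h ⊢
    have := S.half_ext (h := S.slot.symm ((w, k), c)) (h' := S.slot.symm ((w, k'), c)) h (by simp)
    simpa using this

lemma gr_iff_nb (x y : Vtx N₁ L e J U) : S.gr Set.univ x y ↔ ∃ i, S.nb x i = y := by
  have hε : ∀ p : Bool ⊕ Fin e → Prop, (∃ i, p (S.ε i)) ↔ ∃ q, p q := fun p =>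
    S.ε.surjective.exists.symm
  match x, y with
  | .inl a, .inl b =>
    simp only [gr, rem, nb, nbU]
    refine exists_congr fun i => ?_
    split_ifs with h
    · simp [h]
    · simp [h]
  | .inl a, .inr t =>
    simp only [gr, nb, nbU, Set.mem_univ, true_and]
    constructor
    · rintro ⟨h, rfl, h1, h2⟩
      refine ⟨h.1.2, ?_⟩
      rw [dif_pos (show S.Cut h.1.1 h.1.2 from h.2)]
      rw [Sum.inr.injEq]
      exact Prod.ext h1.symm h2.symm
    · rintro ⟨i, hi⟩
      split_ifs at hi with hc
      rw [Sum.inr.injEq] at hi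
      exact ⟨⟨(a, i), hc⟩, rfl, by rw [← hi], by rw [← hi]⟩
  | .inr (.inl s, c), .inl b =>
    simp only [gr, nb]
    rw [hε fun q => S.nbS s c q = .inl b]
    constructor
    · rintro ⟨h, -, -, h1, -⟩; simp at h1
    · rintro ⟨(_ | _) | r, hr⟩ <;> simp [nbS] at hr
  | .inr (.inr w, c), .inl b =>
    simp only [gr, nb, Set.mem_univ, true_and, Sum.inr.injEq]
    rw [hε fun q => S.nbW w c q = .inl b]
    constructor
    · rintro ⟨h, rfl, h1, h2⟩
      refine ⟨.inr (S.slot h).1.2, ?_⟩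
      simp only [nbW]
      rw [h1, h2]
      simp
    · rintro ⟨(_ | _) | k, hk⟩
      · simp [nbW] at hk
      · simp [nbW] at hk
      · simp only [nbW, Sum.inl.injEq] at hk
        exact ⟨S.slot.symm ((w, k), c), hk, by simp, by simp⟩
  | .inr (.inl s, c), .inr (.inl s', c') =>
    obtain ⟨b, a, i⟩ := s
    obtain ⟨b', a', i'⟩ := s'
    simp only [gr, nb, gadget, gcyc]
    rw [hε fun q => S.nbS (b, a, i) c q = .inr (.inl (b', a', i'), c')]
    constructor
    · rintro ⟨rfl, rfl, rfl, rfl | rfl⟩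
      · exact ⟨.inl true, rfl⟩
      · exact ⟨.inl false, by simp [nbS]⟩
    · rintro ⟨(_ | _) | r, hr⟩ <;> simp [nbS] at hr
      · obtain ⟨⟨rfl, rfl, rfl⟩, rfl⟩ := hr; simp
      · obtain ⟨⟨rfl, rfl, rfl⟩, rfl⟩ := hr; simp
  | .inr (.inl s, c), .inr (.inr w, c') =>
    obtain ⟨b, a, i⟩ := s
    obtain ⟨⟨i', r⟩, a'⟩ := w
    simp only [gr, nb, gadget, ginc]
    rw [hε fun q => S.nbS (b, a, i) c q = .inr (.inr ((i', r), a'), c')]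
    constructor
    · rintro ⟨rfl, rfl, ⟨rfl, rfl⟩ | ⟨rfl, rfl⟩⟩
      · exact ⟨.inr r, by simp [nbS]⟩
      · exact ⟨.inr r, by simp [nbS]⟩
    · rintro ⟨(_ | _) | r, hr⟩ <;> simp [nbS] at hr
      obtain ⟨⟨⟨rfl, rfl⟩, rfl⟩, rfl⟩ := hr
      cases b <;> simp
  | .inr (.inr w, c), .inr (.inl s, c') =>
    obtain ⟨b, a, i⟩ := s
    obtain ⟨⟨i', r⟩, a'⟩ := w
    simp only [gr, nb, gadget, ginc]
    rw [hε fun q => S.nbW ((i', r), a') c q = .inr (.inl (b, a, i), c')]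
    constructor
    · rintro ⟨rfl, rfl, ⟨rfl, rfl⟩ | ⟨rfl, rfl⟩⟩
      · exact ⟨.inl true, by simp [nbW]⟩
      · exact ⟨.inl false, by simp [nbW]⟩
    · rintro ⟨(_ | _) | r, hr⟩ <;> simp [nbW] at hr
      · obtain ⟨⟨rfl, rfl, rfl⟩, rfl⟩ := hr; simp
      · obtain ⟨⟨rfl, rfl, rfl⟩, rfl⟩ := hr; simp
  | .inr (.inr w, c), .inr (.inr w', c') =>
    simp only [gr, nb, gadget, and_false, false_iff]
    rw [hε fun q => S.nbW w c q = .inr (.inr w', c')]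
    rintro ⟨(_ | _) | r, hr⟩ <;> simp [nbW] at hr

lemma gr_irrefl (x : Vtx N₁ L e J U) : ¬ S.gr Set.univ x x := by
  match x with
  | .inl a => rintro ⟨i, h, -⟩; exact (S.invol i a).2 h
  | .inr (.inl s, c) =>
    rintro ⟨-, -, -, h⟩
    have h1 := S.one_ne_zero_zmod
    simp at h
    exact h1 h
  | .inr (.inr w, c) => exact fun h => h.2

end Surgery

namespace Surgery

variable {d e N₁ L J : ℕ} {U : Type} (S : Surgery d e N₁ L J U) {R : ℕ} {a b b' z : U} {n : ℕ}

/-- Distance to the padding vertices in the remaining graph, truncated at `R`. -/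
def dep (R : ℕ) (a : U) : ℕ :=
  Nat.find (p := fun n => n = R ∨ ∃ z ∈ S.Z, Rw S.rem n z a) ⟨R, Or.inl rfl⟩

lemma dep_le : S.dep R a ≤ R := Nat.find_min' _ (Or.inl rfl)

lemma exists_of_dep_lt (h : S.dep R a < R) : ∃ z ∈ S.Z, Rw S.rem (S.dep R a) z a :=
  (Nat.find_spec (p := fun n => n = R ∨ ∃ z ∈ S.Z, Rw S.rem n z a) ⟨R, Or.inl rfl⟩).resolve_left
    h.ne

lemma dep_le_of_rw (hz : z ∈ S.Z) (h : Rw S.rem n z a) : S.dep R a ≤ n :=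
  Nat.find_min' _ (Or.inr ⟨z, hz, h⟩)

lemma dep_of_mem (h : a ∈ S.Z) : S.dep R a = 0 :=
  Nat.le_zero.1 (S.dep_le_of_rw h (.nil _))

lemma mem_of_dep_eq_zero (hR : 0 < R) (h : S.dep R a = 0) : a ∈ S.Z := by
  obtain ⟨z, hz, hw⟩ := S.exists_of_dep_lt (h.trans_lt hR)
  rw [h] at hw
  exact hw.eq_of_zero ▸ hz

lemma dep_le_succ (h : S.rem a b) : S.dep R b ≤ S.dep R a + 1 := by
  by_cases hl : S.dep R a < R
  · obtain ⟨z, hz, hw⟩ := S.exists_of_dep_lt hl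
    exact S.dep_le_of_rw hz (hw.snoc h)
  · have := S.dep_le (R := R) (a := b)
    omega

lemma dep_of_bad (hR : R ≤ S.g) {i : Fin (d + 1)} (h : BadHalf S.σ S.g a i) : S.dep R a = R := by
  by_contra hc
  have hl : S.dep R a < R := lt_of_le_of_ne S.dep_le hc
  obtain ⟨z, hz, hw⟩ := S.exists_of_dep_lt hl
  have := S.pad_far_rem hz (Or.inr ⟨i, h⟩) (fun hh => S.pad_not_bad z hz i (hh ▸ h)) hw
  omega

lemma rem_irrefl : ¬ S.rem a a := fun ⟨i, h, _⟩ => (S.invol i a).2 h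

lemma rw_avoid {c : U} (hz : z ∈ S.Z) (h : Rw S.rem n z b) (hn : n ≤ S.dep R a) (hb : b ≠ a) :
    Rw (avoid S.rem a c) n z b := by
  induction h with
  | nil => exact .nil _
  | @snoc n x y t h hr ih =>
    have hy : y ≠ a := by
      rintro rfl
      have := S.dep_le_of_rw (R := R) hz h
      omega
    refine (ih hz (by omega) hy).snoc ⟨hr, ?_⟩
    tauto

lemma eq_of_dep_le (hR : 2 * R + 2 ≤ S.g) (hlt : S.dep R a < R)
    (hab : S.rem a b) (hab' : S.rem a b') (hb : S.dep R b ≤ S.dep R a)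
    (hb' : S.dep R b' ≤ S.dep R a) : b = b' := by
  obtain ⟨z, hz, hw⟩ := S.exists_of_dep_lt (hb.trans_lt hlt)
  obtain ⟨z', hz', hw'⟩ := S.exists_of_dep_lt (hb'.trans_lt hlt)
  have hba : b ≠ a := by rintro rfl; exact S.rem_irrefl hab
  have hba' : b' ≠ a := by rintro rfl; exact S.rem_irrefl hab'
  by_cases hzz : z' = z
  · subst hzz
    by_contra hne
    have h1 := S.rw_avoid (c := b) hz hw hb hba
    have h2 := S.rw_avoid (c := b) hz hw' hb' hba'
    have h3 : avoid S.rem a b a b' := ⟨hab', by tauto⟩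
    have h4 := S.noShort_rem a b hab _
      (((h2.symm (avoid_symm S.rem_symm)).append h1).cons h3)
    omega
  · have := S.pad_far_rem hz (Or.inl hz') hzz
      (((hw.snoc (S.rem_symm _ _ hab)).snoc hab').append (hw'.symm S.rem_symm))
    omega

lemma not_rem_of_mem (hg : 2 ≤ S.g) (ha : a ∈ S.Z) (hb : b ∈ S.Z) : ¬ S.rem a b := by
  intro h
  have := S.pad_far_rem ha (Or.inl hb) (by rintro rfl; exact S.rem_irrefl h) (.single h)
  omega

lemma card_dep_lt_le [Fintype U] :
    (Finset.univ.filter fun a => S.dep R a < R).card ≤ S.Z.card * (d + 1 + 1) ^ R := by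
  choose B hB hB' using exists_ball_card_le S.σ S.rem_le R
  refine (Finset.card_le_card (t := S.Z.biUnion B) fun a ha => ?_).trans
    (Finset.card_biUnion_le_card_mul _ _ _ fun z _ => hB z)
  obtain ⟨z, hz, hw⟩ := S.exists_of_dep_lt (Finset.mem_filter.1 ha).2
  exact Finset.mem_biUnion.2 ⟨z, hz, hB' z _ S.dep_le _ hw⟩

/-- The angle of the partition of unity separating the gadget copies from the old vertices. -/
def ang (R : ℕ) : Vtx N₁ L e J U → ℝ
  | .inl a => Real.pi / (2 * R) * S.dep R a
  | .inr _ => 0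

lemma ang_of_mem (h : a ∈ S.Z) : S.ang R (.inl a) = 0 := by
  simp [ang, S.dep_of_mem h]

lemma ang_of_dep_eq (hR : 0 < R) (h : S.dep R a = R) : S.ang R (.inl a) = Real.pi / 2 := by
  have : (R : ℝ) ≠ 0 := by positivity
  simp only [ang, h]
  field_simp

lemma one_sub_cos_le (hab : S.rem a b) :
    1 - Real.cos (S.ang R (.inl a) - S.ang R (.inl b)) ≤ (Real.pi / (2 * R)) ^ 2 / 2 := by
  have h1 := S.dep_le_succ (R := R) hab
  have h2 := S.dep_le_succ (R := R) (S.rem_symm _ _ hab)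
  have h3 := Real.one_sub_sq_div_two_le_cos (x := S.ang R (.inl a) - S.ang R (.inl b))
  have h4 : (S.ang R (.inl a) - S.ang R (.inl b)) ^ 2 ≤ (Real.pi / (2 * R)) ^ 2 := by
    simp only [ang]
    rw [← mul_sub, mul_pow]
    refine mul_le_of_le_one_right (by positivity) ?_
    rw [sq_le_one_iff_abs_le_one, abs_le]
    constructor
    · have : (S.dep R b : ℝ) ≤ S.dep R a + 1 := by exact_mod_cast h1
      linarith
    · have : (S.dep R a : ℝ) ≤ S.dep R b + 1 := by exact_mod_cast h2
      linarith
  linarith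

end Surgery

namespace Surgery

variable {d e N₁ L J : ℕ} {U : Type} (S : Surgery d e N₁ L J U) {R : ℕ}

lemma card_labels (S : Surgery d e N₁ L J U) : d = e + 1 := by
  have := Fintype.card_congr S.ε
  simp at this
  omega

/-- Weights for the arithmetic-geometric mean bound near the gadget copies. -/
def wt (R : ℕ) : Vtx N₁ L e J U → Vtx N₁ L e J U → ℝ
  | .inl a, .inl b => if S.dep R b ≤ S.dep R a then √d else 1 / √d
  | .inl _, .inr _ => √d
  | .inr (.inr _, _), .inl _ => 1 / √d
  | .inr (.inl _, _), .inl _ => 0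
  | .inr (.inl _, _), .inr (.inl _, _) => 1
  | .inr (.inl _, _), .inr (.inr _, _) => 2 / √d
  | .inr (.inr _, _), .inr (.inl _, _) => √d / 2
  | .inr (.inr _, _), .inr (.inr _, _) => 0

lemma wt_mul (hd : 1 ≤ d) (x y : Vtx N₁ L e J U) (h : S.gr Set.univ x y) :
    0 < S.wt R x y ∧ 1 ≤ S.wt R x y * S.wt R y x := by
  have hs : 1 ≤ √(d : ℝ) := Real.one_le_sqrt.2 (by exact_mod_cast hd)
  have hs0 : 0 < √(d : ℝ) := by linarith
  match x, y with
  | .inl a, .inl b =>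
    simp only [wt]
    split_ifs
    · exact ⟨hs0, by nlinarith⟩
    · exact ⟨hs0, (mul_one_div_cancel hs0.ne').ge⟩
    · exact ⟨by positivity, (one_div_mul_cancel hs0.ne').ge⟩
    · omega
  | .inl _, .inr (.inr _, _) => exact ⟨hs0, (mul_one_div_cancel hs0.ne').ge⟩
  | .inl _, .inr (.inl _, _) => obtain ⟨h, -, -, h1, -⟩ := h; simp at h1
  | .inr (.inr _, _), .inl _ =>
    exact ⟨by simp only [wt]; positivity, (one_div_mul_cancel hs0.ne').ge⟩
  | .inr (.inl _, _), .inl _ => obtain ⟨h, -, -, h1, -⟩ := h; simp at h1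
  | .inr (.inl _, _), .inr (.inl _, _) => simp [wt]
  | .inr (.inl _, _), .inr (.inr _, _) =>
    simp only [wt]
    exact ⟨by positivity, by field_simp; rfl⟩
  | .inr (.inr _, _), .inr (.inl _, _) =>
    simp only [wt]
    exact ⟨by positivity, by field_simp; rfl⟩
  | .inr (.inr _, _), .inr (.inr _, _) => exact h.2.elim

lemma sum_label (f : Bool ⊕ Fin e → ℝ) :
    ∑ i, f (S.ε i) = f (.inl true) + f (.inl false) + ∑ k, f (.inr k) := by
  rw [Equiv.sum_comp S.ε, Fintype.sum_sum_type, Fintype.sum_bool]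

lemma exists_label_wt_le (hd : 1 ≤ d) (hR : 2 * R + 2 ≤ S.g) {a : U} (ha : S.dep R a < R) :
    ∃ i₀, ∀ i, S.wt R (.inl a) (S.nb (.inl a) i) ≤ if i = i₀ then √(d : ℝ) else 1 / √d := by
  have hs : 1 ≤ √(d : ℝ) := Real.one_le_sqrt.2 (by exact_mod_cast hd)
  have hs0 : 0 < √(d : ℝ) := by linarith
  have hsi : 1 / √(d : ℝ) ≤ √d := by rw [div_le_iff₀ hs0]; nlinarith
  have hle : ∀ y, S.wt R (.inl a) y ≤ √(d : ℝ) := by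
    rintro (b | t)
    · simp only [wt]; split_ifs <;> [exact le_rfl; exact hsi]
    · exact le_rfl
  by_cases hz : a ∈ S.Z
  · refine ⟨0, fun i => ?_⟩
    split_ifs with hi
    · exact hle _
    · have hc : ¬ S.Cut a i := by
        rintro (h | h)
        · exact S.pad_not_bad a hz i h
        · exact hi h.1
      simp only [nb, nbU, dif_neg hc, wt]
      rw [if_neg]
      intro h
      rw [S.dep_of_mem hz, Nat.le_zero] at h
      exact S.not_rem_of_mem (by omega) hz (S.mem_of_dep_eq_zero (by omega) h) ⟨i, rfl, hc⟩
  · have hc : ∀ i, ¬ S.Cut a i := by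
      rintro i (h | h)
      · exact ha.ne (S.dep_of_bad (by omega) h)
      · exact hz h.2
    by_cases hex : ∃ i, S.dep R (S.σ i a) ≤ S.dep R a
    · obtain ⟨i₀, hi₀⟩ := hex
      refine ⟨i₀, fun i => ?_⟩
      split_ifs with hi
      · exact hle _
      · simp only [nb, nbU, dif_neg (hc i), wt]
        rw [if_neg]
        intro h
        exact hi (S.rem_label_unique (hc i)
          (S.eq_of_dep_le hR ha ⟨i, rfl, hc i⟩ ⟨i₀, rfl, hc i₀⟩ h hi₀))
    · refine ⟨0, fun i => ?_⟩
      simp only [nb, nbU, dif_neg (hc i), wt]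
      rw [if_neg fun h => hex ⟨i, h⟩]
      split_ifs <;> [exact hsi; exact le_rfl]

lemma sum_wt_le (hd : 1 ≤ d) (hR : 2 * R + 2 ≤ S.g) (x : Vtx N₁ L e J U)
    (hx : ∀ a, x = .inl a → S.dep R a < R) : ∑ i, S.wt R x (S.nb x i) ≤ 2 * √d + 2 := by
  have hs : 1 ≤ √(d : ℝ) := Real.one_le_sqrt.2 (by exact_mod_cast hd)
  have hs0 : 0 < √(d : ℝ) := by linarith
  have hsq : √(d : ℝ) * √d = d := Real.mul_self_sqrt (by positivity)
  have hdd : (d : ℝ) * (1 / √d) = √d := by rw [mul_one_div, div_eq_iff hs0.ne', hsq]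
  have he : (e : ℝ) * (1 / √d) ≤ √d := by
    have hed : (e : ℝ) ≤ d := by
      have := S.card_labels
      exact_mod_cast (by omega : e ≤ d)
    calc (e : ℝ) * (1 / √d) ≤ d * (1 / √d) := by gcongr
      _ = √d := hdd
  match x with
  | .inl a =>
    obtain ⟨i₀, hi₀⟩ := S.exists_label_wt_le hd hR (hx a rfl)
    refine (Finset.sum_le_sum fun i _ => hi₀ i).trans ?_
    rw [Finset.sum_ite, Finset.filter_eq', if_pos (Finset.mem_univ _), Finset.filter_ne',
      Finset.sum_const, Finset.sum_const, Finset.card_erase_of_mem (Finset.mem_univ _)]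
    simp only [Finset.card_singleton, one_smul, Finset.card_univ, Fintype.card_fin,
      Nat.add_sub_cancel, nsmul_eq_mul]
    rw [hdd]
    linarith
  | .inr (.inl s, c) =>
    have := S.sum_label fun q => S.wt R (.inr (.inl s, c)) (S.nbS s c q)
    simp only [nb]
    rw [this]
    simp only [nbS, wt, Finset.sum_const, Finset.card_univ, Fintype.card_fin, nsmul_eq_mul]
    have h2 : (e : ℝ) * (2 / √d) = 2 * (e * (1 / √d)) := by ring
    rw [h2]
    linarith
  | .inr (.inr w, c) =>
    have := S.sum_label fun q => S.wt R (.inr (.inr w, c)) (S.nbW w c q)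
    simp only [nb]
    rw [this]
    simp only [nbW, wt, Finset.sum_const, Finset.card_univ, Fintype.card_fin, nsmul_eq_mul]
    linarith

lemma sum_one_sub_cos_le (hR0 : 0 < R) (hR : R ≤ S.g) (x : Vtx N₁ L e J U) :
    ∑ i, (1 - Real.cos (S.ang R x - S.ang R (S.nb x i))) ≤
      2 + (d + 1) * ((Real.pi / (2 * R)) ^ 2 / 2) := by
  match x with
  | .inl a =>
    have hterm : ∀ i, 1 - Real.cos (S.ang R (.inl a) - S.ang R (S.nb (.inl a) i)) ≤
        (if BadHalf S.σ S.g a i then 1 else 0) + (Real.pi / (2 * R)) ^ 2 / 2 := by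
      intro i
      simp only [nb, nbU]
      split_ifs with hc hb hb
      · rw [S.ang_of_dep_eq hR0 (S.dep_of_bad hR hb)]
        simp only [ang, sub_zero, Real.cos_pi_div_two]
        have : 0 ≤ (Real.pi / (2 * R)) ^ 2 / 2 := by positivity
        linarith
      · have h1 := (hc.resolve_left hb).2
        rw [S.ang_of_mem h1]
        simp only [ang, sub_zero, Real.cos_zero]
        have : 0 ≤ (Real.pi / (2 * R)) ^ 2 / 2 := by positivity
        linarith
      · exact absurd (Or.inl hb) hc
      · rw [zero_add]
        exact S.one_sub_cos_le ⟨i, rfl, hc⟩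
    refine (Finset.sum_le_sum fun i _ => hterm i).trans ?_
    rw [Finset.sum_add_distrib, Finset.sum_boole, Finset.sum_const, Finset.card_univ,
      Fintype.card_fin, nsmul_eq_mul]
    have h2 : ((Finset.univ.filter fun i => BadHalf S.σ S.g a i).card : ℝ) ≤ 2 := by
      exact_mod_cast S.bad_le_two a
    push_cast
    linarith
  | .inr (.inl s, c) =>
    have := S.sum_label fun q => 1 - Real.cos (S.ang R (.inr (.inl s, c)) - S.ang R (S.nbS s c q))
    simp only [nb]
    rw [this]
    simp only [nbS, ang, Real.cos_zero, sub_self, Finset.sum_const_zero, add_zero]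
    positivity
  | .inr (.inr w, c) =>
    have := S.sum_label fun q => 1 - Real.cos (S.ang R (.inr (.inr w, c)) - S.ang R (S.nbW w c q))
    simp only [nb]
    rw [this]
    simp only [nbW, ang, Real.cos_zero, sub_self, zero_add, zero_sub, Real.cos_neg]
    have hterm : ∀ k, 1 - Real.cos (Real.pi / (2 * R) * S.dep R (S.slot.symm ((w, k), c)).1.1) ≤
        if BadHalf S.σ S.g (S.slot.symm ((w, k), c)).1.1 (S.slot.symm ((w, k), c)).1.2
          then 1 else 0 := by
      intro k
      split_ifs with hb
      · have h1 := S.ang_of_dep_eq hR0 (S.dep_of_bad hR hb)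
        simp only [ang] at h1
        rw [h1, Real.cos_pi_div_two, sub_zero]
      · rw [S.dep_of_mem ((S.slot.symm ((w, k), c)).2.resolve_left hb).2]
        simp
    refine (Finset.sum_le_sum fun k _ => hterm k).trans ?_
    rw [Finset.sum_boole]
    have h1 : (Finset.univ.filter fun k => BadHalf S.σ S.g (S.slot.symm ((w, k), c)).1.1
        (S.slot.symm ((w, k), c)).1.2).card ≤ 1 := by
      rw [Finset.card_le_one]
      intro k hk k' hk'
      rw [Finset.mem_filter] at hk hk'
      have := S.copy_inj _ _ hk.2 hk'.2 (by simp)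
      simpa using this
    have h2 : ((Finset.univ.filter fun k => BadHalf S.σ S.g (S.slot.symm ((w, k), c)).1.1
        (S.slot.symm ((w, k), c)).1.2).card : ℝ) ≤ 1 := by exact_mod_cast h1
    have : 0 ≤ ((d : ℝ) + 1) * ((Real.pi / (2 * R)) ^ 2 / 2) := by positivity
    linarith

end Surgery

open Matrix

namespace Surgery

variable {d e N₁ L J : ℕ} {U : Type} [Fintype U] [NeZero L] (S : Surgery d e N₁ L J U) {R : ℕ}

lemma abs_form_cos_le (hd : 1 ≤ d) (hR0 : 0 < R) (hR : 2 * R + 2 ≤ S.g) (v : Vtx N₁ L e J U → ℝ) :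
    |∑ x, ∑ i, (Real.cos (S.ang R x) * v x) *
      (Real.cos (S.ang R (S.nb x i)) * v (S.nb x i))| ≤
      (2 * √d + 2) * ∑ x, (Real.cos (S.ang R x) * v x) ^ 2 := by
  set u : Vtx N₁ L e J U → ℝ := fun x => Real.cos (S.ang R x) * v x with hu
  have h := abs_sum_nb_le S.nb_injective S.gr_iff_nb (S.gr_symm _) u (fun _ _ => 1) (S.wt R) ?_
  · simp only [one_mul] at h
    refine h.trans ?_
    rw [Finset.mul_sum]
    refine Finset.sum_le_sum fun x _ => ?_
    by_cases hx : ∀ a, x = .inl a → S.dep R a < R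
    · exact mul_le_mul_of_nonneg_right (S.sum_wt_le hd hR x hx) (sq_nonneg _)
    · push Not at hx
      obtain ⟨a, rfl, ha⟩ := hx
      have : u (.inl a) = 0 := by
        simp only [hu]
        rw [S.ang_of_dep_eq hR0 (le_antisymm S.dep_le ha), Real.cos_pi_div_two, zero_mul]
      rw [this]
      simp only [ne_eq, OfNat.ofNat_ne_zero, not_false_eq_true, zero_pow, mul_zero]
      positivity
  · intro x x' hxx
    obtain ⟨h1, h2⟩ := S.wt_mul (R := R) hd x x' hxx
    rw [abs_one, one_mul, le_div_iff₀ two_pos, ← sq_abs (u x), ← sq_abs (u x')]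
    have h3 : 0 ≤ S.wt R x x' * (S.wt R x x' * |u x| ^ 2 + S.wt R x' x * |u x'| ^ 2
        - 2 * (|u x| * |u x'|)) := by
      nlinarith [sq_nonneg (S.wt R x x' * |u x| - |u x'|), sq_nonneg |u x'|]
    have := nonneg_of_mul_nonneg_right h3 h1
    linarith

lemma sum_comp_σ (i : Fin (d + 1)) (f : U → ℝ) : ∑ x, f (S.σ i x) = ∑ x, f x :=
  Equiv.sum_comp (Function.Involutive.toPerm (S.σ i) fun x => (S.invol i x).1) f

lemma abs_form_rem_le (hram : NearlyRamanujan S.σ) (w : U → ℝ) (hw : ∀ z ∈ S.Z, w z = 0) :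
    |∑ a, ∑ i, if S.Cut a i then 0 else w a * w (S.σ i a)| ≤
      (2 * √d + 3) * ∑ a, w a ^ 2 + ((d : ℝ) + 1) / Fintype.card U * (∑ a, w a) ^ 2 := by
  have h1 := hram w
  have h2 : w ⬝ᵥ unionMat S.σ *ᵥ w = ∑ a, ∑ i, w a * w (S.σ i a) := by
    rw [dotProduct]
    exact Finset.sum_congr rfl fun a _ => by rw [unionMat_mulVec, Finset.mul_sum]
  have h3 : w ⬝ᵥ w = ∑ a, w a ^ 2 := Finset.sum_congr rfl fun a _ => (sq _).symm
  have h4 : ∑ a, ∑ i, (if S.Cut a i then 0 else w a * w (S.σ i a)) =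
      (∑ a, ∑ i, w a * w (S.σ i a)) - ∑ a, ∑ i, if S.Cut a i then w a * w (S.σ i a) else 0 := by
    rw [← Finset.sum_sub_distrib]
    refine Finset.sum_congr rfl fun a _ => ?_
    rw [← Finset.sum_sub_distrib]
    refine Finset.sum_congr rfl fun i _ => ?_
    split_ifs <;> simp
  have h5 : |∑ a, ∑ i, if S.Cut a i then w a * w (S.σ i a) else 0| ≤ 2 * ∑ a, w a ^ 2 := by
    calc _ ≤ ∑ a, ∑ i, |if S.Cut a i then w a * w (S.σ i a) else 0| :=
          (Finset.abs_sum_le_sum_abs _ _).trans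
            (Finset.sum_le_sum fun x _ => Finset.abs_sum_le_sum_abs _ _)
      _ ≤ ∑ a, ∑ i, ((if S.Cut a i then w a ^ 2 else 0) +
            if S.Cut (S.σ i a) i then w (S.σ i a) ^ 2 else 0) / 2 := by
          refine Finset.sum_le_sum fun a _ => Finset.sum_le_sum fun i _ => ?_
          rw [S.cut_partner_iff]
          split_ifs
          · rw [abs_mul, ← sq_abs (w a), ← sq_abs (w (S.σ i a))]
            nlinarith [sq_nonneg (|w a| - |w (S.σ i a)|)]
          · simp
      _ = ∑ i, ∑ a, if S.Cut a i then w a ^ 2 else 0 := by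
          rw [Finset.sum_comm]
          refine Finset.sum_congr rfl fun i _ => ?_
          rw [← Finset.sum_div, Finset.sum_add_distrib,
            S.sum_comp_σ i fun a => if S.Cut a i then w a ^ 2 else 0]
          ring
      _ ≤ ∑ a, 2 * w a ^ 2 := by
          rw [Finset.sum_comm]
          refine Finset.sum_le_sum fun a _ => ?_
          by_cases ha : a ∈ S.Z
          · simp [hw a ha]
          · have hc : ∀ i, S.Cut a i ↔ BadHalf S.σ S.g a i :=
              fun i => ⟨fun h => h.resolve_right fun h' => ha h'.2, Or.inl⟩
            simp only [hc]
            rw [← Finset.sum_filter, Finset.sum_const, nsmul_eq_mul]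
            refine mul_le_mul_of_nonneg_right ?_ (sq_nonneg _)
            exact_mod_cast S.bad_le_two a
      _ = _ := by rw [Finset.mul_sum]
  rw [h2, h3] at h1
  rw [h4]
  refine (abs_sub _ _).trans ?_
  linarith

lemma form_sin_eq (v : Vtx N₁ L e J U → ℝ) :
    ∑ x, ∑ i, (Real.sin (S.ang R x) * v x) * (Real.sin (S.ang R (S.nb x i)) * v (S.nb x i)) =
      ∑ a, ∑ i, if S.Cut a i then 0 else (Real.sin (S.ang R (.inl a)) * v (.inl a)) *
        (Real.sin (S.ang R (.inl (S.σ i a))) * v (.inl (S.σ i a))) := by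
  rw [Fintype.sum_sum_type]
  have h0 : ∀ t, Real.sin (S.ang R (.inr t)) = 0 := fun t => Real.sin_zero
  rw [Finset.sum_eq_zero (s := Finset.univ (α := (GS N₁ L ⊕ GW N₁ L e) × Fin J))
    fun t _ => Finset.sum_eq_zero fun i _ => by rw [h0]; ring, add_zero]
  refine Finset.sum_congr rfl fun a _ => Finset.sum_congr rfl fun i _ => ?_
  simp only [nb, nbU]
  split_ifs
  · rw [h0]; ring
  · rfl

theorem abs_form_le (hd : 1 ≤ d) (hR0 : 0 < R) (hR : 2 * R + 2 ≤ S.g)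
    (hram : NearlyRamanujan S.σ) (v : Vtx N₁ L e J U → ℝ) :
    |∑ x, ∑ i, v x * v (S.nb x i)| ≤
      (2 * √d + 5 + (d + 1) * ((Real.pi / (2 * R)) ^ 2 / 2)) * ∑ x, v x ^ 2 +
        ((d : ℝ) + 1) / Fintype.card U *
          (∑ a, Real.sin (S.ang R (.inl a)) * v (.inl a)) ^ 2 := by
  have h1 := S.abs_form_cos_le hd hR0 hR v
  have h2 := S.abs_form_rem_le hram (fun a => Real.sin (S.ang R (.inl a)) * v (.inl a))
    fun z hz => by rw [S.ang_of_mem hz]; simp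
  rw [← S.form_sin_eq v] at h2
  have h3 := abs_sum_nb_le S.nb_injective S.gr_iff_nb (S.gr_symm _) v
    (fun x y => 1 - Real.cos (S.ang R x - S.ang R y))
    (fun x y => 1 - Real.cos (S.ang R x - S.ang R y)) fun x y _ => by
      rw [← neg_sub (S.ang R x) (S.ang R y), Real.cos_neg, ← sq_abs (v x), ← sq_abs (v y),
        abs_of_nonneg (sub_nonneg.2 (Real.cos_le_one _))]
      have := mul_nonneg (sub_nonneg.2 (Real.cos_le_one (S.ang R x - S.ang R y)))
        (sq_nonneg (|v x| - |v y|))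
      nlinarith
  have h4 : ∑ x, (∑ i, (1 - Real.cos (S.ang R x - S.ang R (S.nb x i)))) * v x ^ 2 ≤
      (2 + (d + 1) * ((Real.pi / (2 * R)) ^ 2 / 2)) * ∑ x, v x ^ 2 := by
    rw [Finset.mul_sum]
    exact Finset.sum_le_sum fun x _ =>
      mul_le_mul_of_nonneg_right (S.sum_one_sub_cos_le hR0 (by omega) x) (sq_nonneg _)
  have h5 : ∑ a, (Real.sin (S.ang R (.inl a)) * v (.inl a)) ^ 2 ≤
      ∑ x, (Real.sin (S.ang R x) * v x) ^ 2 := by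
    rw [Fintype.sum_sum_type]
    exact le_add_of_nonneg_right (Finset.sum_nonneg fun _ _ => sq_nonneg _)
  have h6 : ∑ x, v x ^ 2 = ∑ x, (Real.cos (S.ang R x) * v x) ^ 2 +
      ∑ x, (Real.sin (S.ang R x) * v x) ^ 2 := by
    rw [← Finset.sum_add_distrib]
    refine Finset.sum_congr rfl fun x _ => ?_
    rw [mul_pow, mul_pow, ← add_mul, Real.cos_sq_add_sin_sq, one_mul]
  have h7 : ∑ x, ∑ i, v x * v (S.nb x i) =
      ∑ x, ∑ i, (Real.cos (S.ang R x) * v x) * (Real.cos (S.ang R (S.nb x i)) * v (S.nb x i)) +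
      ∑ x, ∑ i, (Real.sin (S.ang R x) * v x) * (Real.sin (S.ang R (S.nb x i)) * v (S.nb x i)) +
      ∑ x, ∑ i, (1 - Real.cos (S.ang R x - S.ang R (S.nb x i))) * (v x * v (S.nb x i)) := by
    simp only [← Finset.sum_add_distrib]
    refine Finset.sum_congr rfl fun x _ => Finset.sum_congr rfl fun i _ => ?_
    rw [Real.cos_sub]
    ring
  have h8 : (2 * √d + 3) * ∑ a, (Real.sin (S.ang R (.inl a)) * v (.inl a)) ^ 2 ≤
      (2 * √d + 3) * ∑ x, (Real.sin (S.ang R x) * v x) ^ 2 :=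
    mul_le_mul_of_nonneg_left h5 (by positivity)
  have h9 : 0 ≤ ∑ x, (Real.cos (S.ang R x) * v x) ^ 2 := Finset.sum_nonneg fun _ _ => sq_nonneg _
  have h10 : (2 * √d + 3) * ∑ x, v x ^ 2 =
      (2 * √d + 2) * ∑ x, (Real.cos (S.ang R x) * v x) ^ 2 +
        ∑ x, (Real.cos (S.ang R x) * v x) ^ 2 +
          (2 * √d + 3) * ∑ x, (Real.sin (S.ang R x) * v x) ^ 2 := by
    rw [h6]
    ring
  have h11 : (2 * √d + 5 + (d + 1) * ((Real.pi / (2 * R)) ^ 2 / 2)) * ∑ x, v x ^ 2 =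
      (2 * √d + 3) * ∑ x, v x ^ 2 +
        (2 + (d + 1) * ((Real.pi / (2 * R)) ^ 2 / 2)) * ∑ x, v x ^ 2 := by ring
  rw [h7, h11]
  refine (abs_add_three _ _ _).trans ?_
  linarith [h1, h2, h3, h4, h8, h9, h10]

theorem abs_form_le_of_sum_eq_zero (hd : 1 ≤ d) (hR0 : 0 < R) (hR : 2 * R + 2 ≤ S.g)
    (hram : NearlyRamanujan S.σ) (v : Vtx N₁ L e J U → ℝ) (hv : ∑ x, v x = 0) :
    |∑ x, ∑ i, v x * v (S.nb x i)| ≤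
      (2 * √d + 5 + (d + 1) * ((Real.pi / (2 * R)) ^ 2 / 2) + ((d : ℝ) + 1) / Fintype.card U *
        (Fintype.card ((GS N₁ L ⊕ GW N₁ L e) × Fin J) + S.Z.card * (d + 1 + 1) ^ R : ℕ)) *
          ∑ x, v x ^ 2 := by
  have h1 := S.abs_form_le hd hR0 hR hram v
  set s : Vtx N₁ L e J U → ℝ := fun x => 1 - Real.sin (S.ang R x) with hs
  have h2 : ∑ a, Real.sin (S.ang R (.inl a)) * v (.inl a) = -∑ x, s x * v x := by
    have : ∑ x, s x * v x = ∑ x, v x - ∑ x, Real.sin (S.ang R x) * v x := by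
      rw [← Finset.sum_sub_distrib]
      exact Finset.sum_congr rfl fun x _ => by simp only [hs]; ring
    rw [this, hv, zero_sub, neg_neg, Fintype.sum_sum_type]
    simp [ang]
  have h3 : ∑ x, s x ^ 2 ≤
      (Fintype.card ((GS N₁ L ⊕ GW N₁ L e) × Fin J) + S.Z.card * (d + 1 + 1) ^ R : ℕ) := by
    have hang : ∀ a, 0 ≤ Real.sin (S.ang R (.inl a)) := by
      intro a
      refine Real.sin_nonneg_of_nonneg_of_le_pi (by simp only [ang]; positivity) ?_
      simp only [ang]
      have h5 : (S.dep R a : ℝ) ≤ R := by exact_mod_cast S.dep_le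
      have h6 : (0 : ℝ) < R := by exact_mod_cast hR0
      have h7 := Real.pi_pos
      rw [div_mul_eq_mul_div, div_le_iff₀ (by positivity)]
      nlinarith
    rw [Fintype.sum_sum_type, Nat.cast_add, add_comm]
    refine add_le_add ?_ ?_
    · simp [hs, ang]
    · refine le_trans ?_ (Nat.cast_le.2 S.card_dep_lt_le)
      rw [← Finset.sum_boole]
      refine Finset.sum_le_sum fun a _ => ?_
      have h8 := hang a
      have h9 := Real.sin_le_one (S.ang R (.inl a))
      split_ifs with h
      · simp only [hs]; nlinarith
      · simp only [hs]
        rw [S.ang_of_dep_eq hR0 (le_antisymm S.dep_le (not_lt.1 h)), Real.sin_pi_div_two]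
        simp
  have h4 : (∑ x, s x * v x) ^ 2 ≤ (∑ x, s x ^ 2) * ∑ x, v x ^ 2 :=
    Finset.sum_mul_sq_le_sq_mul_sq _ _ _
  have h0 : 0 ≤ ∑ x, v x ^ 2 := Finset.sum_nonneg fun _ _ => sq_nonneg _
  rw [h2, neg_sq] at h1
  refine h1.trans ?_
  conv_rhs => rw [add_mul, mul_assoc (((d : ℝ) + 1) / Fintype.card U)]
  refine add_le_add le_rfl (mul_le_mul_of_nonneg_left ?_ (by positivity))
  exact h4.trans (mul_le_mul_of_nonneg_right h3 h0)

end Surgery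

section RegularGraph

open Matrix

variable {W : Type*} [Fintype W] [DecidableEq W] {D : ℕ} {G : SimpleGraph W} {nb : W → Fin D → W}

lemma adjMat_mulVec_eq (hinj : ∀ x, Function.Injective (nb x))
    (hG : ∀ x y, G.Adj x y ↔ ∃ i, nb x i = y) (v : W → ℝ) (x : W) :
    (adjMat G *ᵥ v) x = ∑ i, v (nb x i) := by
  rw [sum_nb_eq hinj hG x v]
  simp only [mulVec, dotProduct, adjMat, SimpleGraph.adjMatrix_apply, ite_mul, one_mul, zero_mul]

lemma isRegular_of_enum (hinj : ∀ x, Function.Injective (nb x))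
    (hG : ∀ x y, G.Adj x y ↔ ∃ i, nb x i = y) : IsRegular G D := by
  intro x
  have h : G.neighborSet x = Set.range (nb x) := by
    ext y
    simp [hG]
  rw [h, ← Set.image_univ, Set.ncard_image_of_injective _ (hinj x), Set.ncard_univ]
  simp

lemma eig_cases {Λ : ℝ} (hinj : ∀ x, Function.Injective (nb x))
    (hG : ∀ x y, G.Adj x y ↔ ∃ i, nb x i = y)
    (hform : ∀ v : W → ℝ, ∑ x, v x = 0 → |∑ x, ∑ i, v x * v (nb x i)| ≤ Λ * ∑ x, v x ^ 2)
    {v : W → ℝ} {μ : ℝ} (hv : ∑ x, v x ^ 2 = 1) (hμ : adjMat G *ᵥ v = μ • v) (hlt : Λ < |μ|) :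
    μ = D := by
  by_contra hne
  have h1 : ∑ x, ∑ i, v (nb x i) = μ * ∑ x, v x := by
    rw [Finset.mul_sum]
    refine Finset.sum_congr rfl fun x _ => ?_
    rw [← adjMat_mulVec_eq hinj hG, hμ]
    rfl
  have h2 : ∑ x, ∑ i, v (nb x i) = D * ∑ x, v x := by
    rw [sum_nb_swap hinj hG (fun _ _ h => h.symm) fun _ y => v y, Finset.mul_sum]
    simp
  have h3 : ∑ x, v x = 0 := by
    have : (μ - D) * ∑ x, v x = 0 := by rw [sub_mul, ← h1, ← h2, sub_self]
    exact (mul_eq_zero.1 this).resolve_left (sub_ne_zero.2 hne)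
  have h4 := hform v h3
  have h5 : ∑ x, ∑ i, v x * v (nb x i) = μ := by
    rw [← mul_one μ, ← hv, Finset.mul_sum]
    refine Finset.sum_congr rfl fun x _ => ?_
    rw [← Finset.mul_sum, ← adjMat_mulVec_eq hinj hG, hμ, Pi.smul_apply, smul_eq_mul]
    ring
  rw [h5, hv] at h4
  linarith

lemma eig_index_unique {Λ : ℝ} (hinj : ∀ x, Function.Injective (nb x))
    (hG : ∀ x y, G.Adj x y ↔ ∃ i, nb x i = y)
    (hform : ∀ v : W → ℝ, ∑ x, v x = 0 → |∑ x, ∑ i, v x * v (nb x i)| ≤ Λ * ∑ x, v x ^ 2)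
    {j k : W} (hj : Λ < |eigs G j|) (hk : Λ < |eigs G k|) : j = k := by
  by_contra hne
  set B := (adjMat_isHermitian G).eigenvectorBasis with hB
  have hmul : ∀ l, adjMat G *ᵥ ⇑(B l) = eigs G l • ⇑(B l) := fun l =>
    (adjMat_isHermitian G).mulVec_eigenvectorBasis l
  have hnorm : ∀ l, ∑ x, B l x ^ 2 = 1 := by
    intro l
    have := B.orthonormal.1 l
    rw [EuclideanSpace.norm_eq, Real.sqrt_eq_one] at this
    rw [← this]
    exact Finset.sum_congr rfl fun x _ => by rw [Real.norm_eq_abs, sq_abs]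
  have horth : ∑ x, B j x * B k x = 0 := by
    have := B.orthonormal.2 hne
    rw [← this, PiLp.inner_apply]
    exact Finset.sum_congr rfl fun x _ => by simp [mul_comm]
  have hj' := eig_cases hinj hG hform (hnorm j) (hmul j) hj
  have hk' := eig_cases hinj hG hform (hnorm k) (hmul k) hk
  set p := ∑ x, B j x with hp
  set q := ∑ x, B k x with hq
  by_cases hp0 : p = 0
  · have h1 := hform _ hp0
    have h5 : ∑ x, ∑ i, B j x * B j (nb x i) = D := by
      rw [← mul_one (D : ℝ), ← hnorm j, Finset.mul_sum]
      refine Finset.sum_congr rfl fun x _ => ?_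
      rw [← Finset.mul_sum, ← adjMat_mulVec_eq hinj hG (B j), hmul, Pi.smul_apply, smul_eq_mul, hj']
      ring
    rw [h5, hnorm j, ← hj'] at h1
    linarith
  · set w : W → ℝ := fun x => q * B j x - p * B k x with hw
    have hw0 : ∑ x, w x = 0 := by
      simp only [hw]
      rw [Finset.sum_sub_distrib, ← Finset.mul_sum, ← Finset.mul_sum, ← hp, ← hq]
      ring
    have hA : ∀ x, ∑ i, w (nb x i) = D * w x := by
      intro x
      have e1 : ∑ i, B j (nb x i) = D * B j x := by
        rw [← adjMat_mulVec_eq hinj hG (B j), hmul, Pi.smul_apply, smul_eq_mul, hj']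
      have e2 : ∑ i, B k (nb x i) = D * B k x := by
        rw [← adjMat_mulVec_eq hinj hG (B k), hmul, Pi.smul_apply, smul_eq_mul, hk']
      simp only [hw]
      rw [Finset.sum_sub_distrib, ← Finset.mul_sum, ← Finset.mul_sum, e1, e2]
      ring
    have hwn : ∑ x, w x ^ 2 = q ^ 2 + p ^ 2 := by
      have : ∀ x, w x ^ 2 =
          q ^ 2 * B j x ^ 2 + p ^ 2 * B k x ^ 2 - 2 * p * q * (B j x * B k x) := by
        intro x; simp only [hw]; ring
      simp only [this]
      rw [Finset.sum_sub_distrib, Finset.sum_add_distrib, ← Finset.mul_sum, ← Finset.mul_sum,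
        ← Finset.mul_sum, hnorm, hnorm, horth]
      ring
    have h1 := hform w hw0
    have h5 : ∑ x, ∑ i, w x * w (nb x i) = D * ∑ x, w x ^ 2 := by
      rw [Finset.mul_sum]
      refine Finset.sum_congr rfl fun x _ => ?_
      rw [← Finset.mul_sum, hA]
      ring
    have h6 : 0 < ∑ x, w x ^ 2 := by
      rw [hwn]; positivity
    rw [h5, abs_mul, abs_of_pos h6, ← hj'] at h1
    have := le_of_mul_le_mul_right h1 h6
    linarith

lemma getD_sort_le {s : Multiset ℝ} {Λ : ℝ} (hs : 2 ≤ s.card)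
    (h : s.countP (fun x => Λ < x) ≤ 1) : (s.sort (· ≤ ·)).getD (s.card - 2) 0 ≤ Λ := by
  set l := s.sort (· ≤ ·) with hl
  have hlen : l.length = s.card := Multiset.length_sort _
  have hlt : s.card - 2 < l.length := by omega
  rw [List.getD_eq_getElem _ _ hlt]
  by_contra hc
  push Not at hc
  have hdrop : (l.drop (s.card - 2)).countP (fun x => Λ < x) = 2 := by
    rw [List.countP_eq_length.2, List.length_drop, hlen]
    · omega
    intro a ha
    have hpw : (l.drop (s.card - 2)).Pairwise (· ≤ ·) :=
      (Multiset.pairwise_sort (s := s) (r := (· ≤ ·))).sublist (List.drop_sublist _ _)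
    rw [List.drop_eq_getElem_cons hlt] at hpw ha
    rw [List.pairwise_cons] at hpw
    rw [List.mem_cons] at ha
    rcases ha with rfl | ha
    · simpa using hc
    · simpa using hc.trans_le (hpw.1 a ha)
  have h2 : (l.drop (s.card - 2)).countP (fun x => Λ < x) ≤ l.countP (fun x => Λ < x) :=
    (List.drop_sublist _ _).countP_le
  have h3 : s.countP (fun x => Λ < x) = l.countP (fun x => Λ < x) := by
    conv_lhs => rw [← Multiset.sort_eq (s := s) (r := (· ≤ ·))]
    rw [Multiset.coe_countP]
  omega

lemma secondLargestAbsEig_le {Λ : ℝ} (hcard : 2 ≤ Fintype.card W)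
    (hinj : ∀ x, Function.Injective (nb x)) (hG : ∀ x y, G.Adj x y ↔ ∃ i, nb x i = y)
    (hform : ∀ v : W → ℝ, ∑ x, v x = 0 → |∑ x, ∑ i, v x * v (nb x i)| ≤ Λ * ∑ x, v x ^ 2) :
    secondLargestAbsEig G ≤ Λ := by
  have hc : (Finset.univ.val.map fun i => |eigs G i|).card = Fintype.card W := by
    rw [Multiset.card_map]; rfl
  have := getD_sort_le (s := Finset.univ.val.map fun i => |eigs G i|) (Λ := Λ)
    (by rw [hc]; exact hcard) ?_
  · rw [hc] at this
    exact this
  · rw [Multiset.countP_map]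
    have : (Finset.univ.filter fun i => Λ < |eigs G i|).card ≤ 1 := by
      rw [Finset.card_le_one]
      intro j hj k hk
      rw [Finset.mem_filter] at hj hk
      exact eig_index_unique hinj hG hform hj.2 hk.2
    exact this

lemma not_isAcyclic_of_cycle {L : ℕ} (hL : 3 ≤ L) (f : ZMod L → W) (hf : Function.Injective f)
    (hadj : ∀ i, G.Adj (f i) (f (i + 1))) : ¬ G.IsAcyclic := by
  have : NeZero L := ⟨by omega⟩
  have hcast : ∀ n : ℕ, 0 < n → n < L → (n : ZMod L) ≠ 0 := by
    intro n h0 hn h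
    rw [ZMod.natCast_eq_zero_iff] at h
    exact absurd (Nat.le_of_dvd h0 h) (by omega)
  rw [SimpleGraph.isAcyclic_iff_forall_adj_isBridge]
  intro h
  have h1 := h (hadj (-1)).symm
  rw [SimpleGraph.isBridge_iff] at h1
  have hreach : ∀ n : ℕ, n < L →
      (G.deleteEdges {s(f (-1 + 1), f (-1))}).Reachable (f (-1 + 1)) (f n) := by
    intro n
    induction n with
    | zero => intro _; simp
    | succ n ih =>
      intro hn
      refine (ih (by omega)).trans (SimpleGraph.Adj.reachable ?_)
      rw [SimpleGraph.deleteEdges_adj]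
      push_cast
      refine ⟨hadj n, ?_⟩
      rw [Set.mem_singleton_iff, Sym2.eq_iff]
      rintro (⟨h2, h3⟩ | ⟨h2, h3⟩)
      · have h4 := hf h2
        have h5 := hf h3
        refine hcast 2 (by norm_num) (by omega) ?_
        push_cast
        linear_combination h5 - h4
      · have h5 := hf h3
        refine hcast (n + 1) (by omega) hn ?_
        push_cast
        rw [h5]; ring
  refine h1 ?_
  have h2 := hreach (L - 1) (by omega)
  have h3 : ((L - 1 : ℕ) : ZMod L) = -1 := by
    rw [Nat.cast_sub (by omega)]; simp
  rwa [h3] at h2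

lemma girthGe_of_noShort {g : ℕ} {x : ℝ} (hac : ¬ G.IsAcyclic) (h : NoShort G.Adj g) (hx : x ≤ g) :
    girthGe G x := by
  intro g' hg'
  obtain ⟨a, w, hw, hl⟩ := SimpleGraph.exists_girth_eq_length.2 hac
  have := h.le_length_of_isCycle hw
  rw [← hg', hl]
  exact hx.trans (by exact_mod_cast this)

end RegularGraph

lemma cos_val_intCast (L : ℕ) [NeZero L] (j : ℕ) (n : ℤ) :
    Real.cos (2 * Real.pi * j / L * ((n : ZMod L).val : ℝ)) =
      Real.cos (2 * Real.pi * j / L * n) := by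
  have hL : (L : ℝ) ≠ 0 := Nat.cast_ne_zero.2 (NeZero.ne L)
  have h1 : (((n : ZMod L).val : ℤ) : ℝ) = n - L * ((n / L : ℤ) : ℝ) := by
    rw [ZMod.val_intCast, Int.emod_def]
    push_cast
    ring
  rw [Int.cast_natCast] at h1
  rw [h1, ← Real.cos_sub_int_mul_two_pi (2 * Real.pi * j / L * n) (j * (n / L))]
  congr 1
  push_cast
  field_simp

lemma cos_val_recurrence (L : ℕ) [NeZero L] (j : ℕ) (i : ZMod L) :
    Real.cos (2 * Real.pi * j / L * ((i + 1).val : ℝ)) +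
      Real.cos (2 * Real.pi * j / L * ((i - 1).val : ℝ)) =
      2 * Real.cos (2 * Real.pi * j / L) * Real.cos (2 * Real.pi * j / L * (i.val : ℝ)) := by
  obtain ⟨n, rfl⟩ := ZMod.intCast_surjective i
  have h1 : (n : ZMod L) + 1 = ((n + 1 : ℤ) : ZMod L) := by push_cast; rfl
  have h2 : (n : ZMod L) - 1 = ((n - 1 : ℤ) : ZMod L) := by push_cast; rfl
  rw [h1, h2, cos_val_intCast, cos_val_intCast, cos_val_intCast]
  push_cast
  rw [mul_add, mul_sub, mul_one, Real.cos_add, Real.cos_sub]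
  ring

namespace Surgery

variable {d e N₁ L J : ℕ} {U : Type} [Fintype U] [NeZero L] (S : Surgery d e N₁ L J U)

/-- The eigenvector supported on the cycles of the gadget copy `c`. -/
def cycVec (U : Type) (N₁ L e : ℕ) {J : ℕ} (c : Fin J) (j : ℕ) : Vtx N₁ L e J U → ℝ
  | .inl _ => 0
  | .inr (.inr _, _) => 0
  | .inr (.inl s, c') => if c' = c then
      (if s.1 then 1 else -1) * Real.cos (2 * Real.pi * j / L * (s.2.2.val : ℝ)) else 0

lemma sum_cycVec (c : Fin J) (j : ℕ) (x : Vtx N₁ L e J U) :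
    ∑ i, cycVec U N₁ L e c j (S.nb x i) =
      2 * Real.cos (2 * Real.pi * j / L) * cycVec U N₁ L e c j x := by
  match x with
  | .inl a =>
    simp only [cycVec, mul_zero]
    refine Finset.sum_eq_zero fun i _ => ?_
    simp only [nb, nbU]
    split_ifs <;> rfl
  | .inr (.inl s, c') =>
    have := S.sum_label fun q => cycVec U N₁ L e c j (S.nbS s c' q)
    simp only [nb]
    rw [this]
    simp only [nbS, cycVec, Finset.sum_const_zero, add_zero]
    split_ifs with h1 h2
    · have := cos_val_recurrence L j s.2.2
      linarith
    · have := cos_val_recurrence L j s.2.2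
      linarith
    · simp
  | .inr (.inr w, c') =>
    have := S.sum_label fun q => cycVec U N₁ L e c j (S.nbW w c' q)
    simp only [nb]
    rw [this]
    simp only [nbW, cycVec, Finset.sum_const_zero, add_zero, mul_zero]
    split_ifs <;> simp_all

/-- The surgered graph, with vertices renamed along a bijection. -/
def graph {W : Type} (f : W ≃ Vtx N₁ L e J U) : SimpleGraph W where
  Adj x y := S.gr Set.univ (f x) (f y)
  symm := ⟨fun _ _ h => S.gr_symm _ _ _ h⟩
  loopless := ⟨fun _ => S.gr_irrefl _⟩

lemma noShort_comap {α β : Type*} {r : β → β → Prop} {g : ℕ} (h : NoShort r g) (f : α ≃ β) :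
    NoShort (fun x y => r (f x) (f y)) g := by
  intro x y hxy n hn
  refine h _ _ hxy n ?_
  have key : ∀ {n : ℕ} {a b : α}, Rw (avoid (fun x y => r (f x) (f y)) x y) n a b →
      Rw (avoid r (f x) (f y)) n (f a) (f b) := by
    intro n a b h
    induction h with
    | nil => exact .nil _
    | snoc _ h' ih => exact ih.snoc ⟨h'.1, by simpa using h'.2⟩
  exact key hn

theorem exists_graph (hd : 1 ≤ d) (hJ : 0 < J) (hN : 0 < N₁) {R : ℕ} (hR0 : 0 < R)
    (hR : 2 * R + 2 ≤ S.g) (hram : NearlyRamanujan S.σ) {m : ℕ}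
    (hm : Fintype.card (Vtx N₁ L e J U) = m) :
    ∃ G : SimpleGraph (Fin m), IsRegular G (d + 1) ∧
      (∀ x : ℝ, x ≤ S.g → girthGe G x) ∧
      (∀ (r : ℕ) (ε bound : ℝ), 2 * r ≤ L → ε ≤ 1 → 2 * N₁ * L ≤ bound →
        LocalizedSpectrum G r ε bound) ∧
      secondLargestAbsEig G ≤
        2 * √d + 5 + (d + 1) * ((Real.pi / (2 * R)) ^ 2 / 2) + ((d : ℝ) + 1) / Fintype.card U *
        (Fintype.card ((GS N₁ L ⊕ GW N₁ L e) × Fin J) + S.Z.card * (d + 1 + 1) ^ R : ℕ) := by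
  have f : Fin m ≃ Vtx N₁ L e J U := (Fintype.equivFinOfCardEq hm).symm
  have hinj : ∀ x : Fin m, Function.Injective fun i => f.symm (S.nb (f x) i) := fun x =>
    f.symm.injective.comp (S.nb_injective (f x))
  have hG : ∀ x y, (S.graph f).Adj x y ↔ ∃ i, f.symm (S.nb (f x) i) = y := by
    intro x y
    refine (S.gr_iff_nb _ _).trans (exists_congr fun i => ?_)
    rw [Equiv.symm_apply_eq]
  have hcyc : Function.Injective fun i : ZMod L =>
      f.symm (.inr (.inl (true, ⟨0, hN⟩, i), ⟨0, hJ⟩)) := by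
    intro i j h
    simpa using h
  have hac : ¬ (S.graph f).IsAcyclic := by
    refine not_isAcyclic_of_cycle S.three_le _ hcyc fun i => ?_
    simp only [graph, Equiv.apply_symm_apply, gr, gadget, gcyc]
    simp
  refine ⟨S.graph f, isRegular_of_enum hinj hG,
    fun x hx => girthGe_of_noShort hac (noShort_comap S.noShort_gr f) hx, ?_, ?_⟩
  · intro r ε bound hr hε hb
    have hL : (0 : ℝ) < L := by exact_mod_cast (NeZero.pos L)
    have hinj2 : Set.InjOn (fun j : ℕ => 2 * Real.cos (2 * Real.pi * j / L))
        (Finset.range r : Set ℕ) := by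
      have hmem : ∀ j ∈ (Finset.range r : Set ℕ), 2 * Real.pi * j / L ∈ Set.Icc 0 Real.pi := by
        intro j hj
        refine ⟨by positivity, ?_⟩
        rw [div_le_iff₀ hL]
        have : 2 * (j : ℝ) ≤ L := by
          have := Finset.mem_range.1 (Finset.mem_coe.1 hj)
          exact_mod_cast (by omega : 2 * j ≤ L)
        nlinarith [Real.pi_pos]
      intro j hj k hk h
      have h1 : 2 * Real.cos (2 * Real.pi * j / L) = 2 * Real.cos (2 * Real.pi * k / L) := h
      have h2 := Real.injOn_cos (hmem j hj) (hmem k hk) (by linarith)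
      have h3 := Real.pi_pos
      field_simp at h2
      exact_mod_cast h2
    refine ⟨(Finset.range r).image fun j : ℕ => 2 * Real.cos (2 * Real.pi * j / L), ?_, ?_⟩
    · rw [Finset.card_image_of_injOn hinj2, Finset.card_range]
    intro μ hμ
    obtain ⟨j, -, rfl⟩ := Finset.mem_image.1 hμ
    set c : Fin J := ⟨0, hJ⟩
    set u := cycVec U N₁ L e c j with hu
    set n := ∑ x, u x ^ 2 with hn
    have hn0 : 0 < n := by
      refine (Finset.sum_pos_iff_of_nonneg fun _ _ => sq_nonneg _).2
        ⟨.inr (.inl (true, ⟨0, hN⟩, 0), c), Finset.mem_univ _, ?_⟩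
      simp [hu, cycVec]
    have hsum : ∑ x : Fin m, (u (f x) / √n) ^ 2 = 1 := by
      rw [Equiv.sum_comp f fun y => (u y / √n) ^ 2]
      simp only [div_pow]
      rw [← Finset.sum_div, Real.sq_sqrt hn0.le, ← hn, div_self hn0.ne']
    let T : Finset (Fin m) := Finset.univ.image fun s : GS N₁ L => f.symm (.inr (.inl s, c))
    have hT : T.card = 2 * N₁ * L := by
      rw [Finset.card_image_of_injective _ fun s s' h => by simpa using h, Finset.card_univ]
      simp [GS, ZMod.card]
      ring
    refine ⟨2 * N₁ * L, by exact_mod_cast hb, fun x => u (f x) / √n, ?_, hsum, T, hT, ?_⟩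
    · ext x
      rw [adjMat_mulVec_eq hinj hG]
      simp only [Equiv.apply_symm_apply, Pi.smul_apply, smul_eq_mul]
      rw [← Finset.sum_div, S.sum_cycVec]
      ring
    · rw [Finset.sum_subset (Finset.subset_univ T) ?_, hsum]
      · exact hε
      · intro x _ hx
        have : u (f x) = 0 := by
          rcases hfx : f x with a | ⟨s | w, c'⟩
          · rfl
          · by_cases hc : c' = c
            · exfalso
              refine hx (Finset.mem_image.2 ⟨s, Finset.mem_univ _, ?_⟩)
              rw [← hc, ← hfx, Equiv.symm_apply_apply]
            · simp [hu, cycVec, hc]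
          · rfl
        simp [this]
  · refine secondLargestAbsEig_le ?_ hinj hG fun v hv => ?_
    · have := (Fintype.card_le_of_injective _ hcyc)
      rw [ZMod.card] at this
      have := S.three_le
      omega
    · have h := S.abs_form_le_of_sum_eq_zero hd hR0 hR hram (fun y => v (f.symm y))
        (by rw [Equiv.sum_comp f.symm v, hv])
      rw [Equiv.sum_comp f.symm fun x => v x ^ 2] at h
      rw [← Equiv.sum_comp f] at h
      simpa only [Equiv.symm_apply_apply] using h

end Surgery

lemma even_card_of_involution {α : Type*} (s : Finset α) (f : α → α) (hmem : ∀ a ∈ s, f a ∈ s)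
    (hne : ∀ a ∈ s, f a ≠ a) (hinv : ∀ a ∈ s, f (f a) = a) : Even s.card := by
  rw [← ZMod.natCast_eq_zero_iff_even, Finset.cast_card]
  exact Finset.sum_involution (fun a _ => f a) (fun _ _ => by decide) (fun a ha _ => hne a ha)
    (fun a ha => hmem a ha) fun a ha => hinv a ha

section Padding

variable {U : Type} [Fintype U] {d g : ℕ} {σ : Fin (d + 1) → U → U}

/-- Pairs of vertices that are far from each other and from a given set can be chosen greedily. -/
lemma exists_padding (hσ : ∀ i x, σ i (σ i x) = x ∧ σ i x ≠ x) (M : Finset U) (k : ℕ)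
    (h : (2 * k + M.card) * (d + 1 + 1) ^ (g + 1) < Fintype.card U) :
    ∃ Z : Finset U, Z.card = 2 * k ∧ (∀ z ∈ Z, σ 0 z ∈ Z) ∧ (∀ z ∈ Z, z ∉ M) ∧
      ∀ z ∈ Z, ∀ x, (x ∈ Z ∨ x ∈ M) → x ≠ z → x ≠ σ 0 z →
        ∀ n, Rw (fun a b => ∃ i, σ i a = b) n z x → g ≤ n := by
  set r : U → U → Prop := fun a b => ∃ i, σ i a = b with hr
  have hsymm : ∀ a b, r a b → r b a := by
    rintro a _ ⟨i, rfl⟩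
    exact ⟨i, (hσ i a).1⟩
  choose B hB hB' using exists_ball_card_le (r := r) σ (fun _ _ h => h) (g + 1)
  induction k with
  | zero => exact ⟨∅, by simp⟩
  | succ k ih =>
    obtain ⟨Z, hc, hp, hM, hfar⟩ := ih (lt_of_le_of_lt (Nat.mul_le_mul_right _ (by omega)) h)
    obtain ⟨z, -, hz⟩ : ∃ z ∈ (Finset.univ : Finset U), z ∉ (Z ∪ M).biUnion B := by
      refine Finset.exists_mem_notMem_of_card_lt_card ?_
      rw [Finset.card_univ]
      refine (Finset.card_biUnion_le_card_mul _ _ _ fun x _ => hB x).trans_lt (lt_of_le_of_lt ?_ h)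
      refine Nat.mul_le_mul_right _ ((Finset.card_union_le _ _).trans ?_)
      omega
    have hz1 : ∀ x, x ∈ Z ∨ x ∈ M → ∀ n, Rw r n x z → g + 1 < n := by
      intro x hx n hn
      by_contra hcon
      exact hz (Finset.mem_biUnion.2 ⟨x, Finset.mem_union.2 hx, hB' x n (by omega) z hn⟩)
    have hz0 : ¬ (z ∈ Z ∨ z ∈ M) := fun hx => absurd (hz1 z hx 0 (.nil _)) (by omega)
    have hz0' : ¬ (σ 0 z ∈ Z ∨ σ 0 z ∈ M) := fun hx =>
      absurd (hz1 _ hx 1 (.single ⟨0, (hσ 0 z).1⟩)) (by omega)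
    have hz2 : ∀ x, x ∈ Z ∨ x ∈ M → ∀ n, Rw r n x (σ 0 z) → g < n := by
      intro x hx n hn
      have := hz1 x hx (n + 1) (hn.snoc ⟨0, (hσ 0 z).1⟩)
      omega
    refine ⟨insert z (insert (σ 0 z) Z), ?_, ?_, ?_, ?_⟩
    · rw [Finset.card_insert_of_notMem, Finset.card_insert_of_notMem, hc]
      · ring
      · exact fun hh => hz0' (Or.inl hh)
      · rw [Finset.mem_insert]
        rintro (hh | hh)
        · exact (hσ 0 z).2 hh.symm
        · exact hz0 (Or.inl hh)
    · intro y hy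
      simp only [Finset.mem_insert] at hy ⊢
      rcases hy with rfl | rfl | hy
      · simp
      · simp [(hσ 0 z).1]
      · exact Or.inr (Or.inr (hp y hy))
    · intro y hy
      simp only [Finset.mem_insert] at hy
      rcases hy with rfl | rfl | hy
      · exact fun hh => hz0 (Or.inr hh)
      · exact fun hh => hz0' (Or.inr hh)
      · exact hM y hy
    · intro y hy x hx hne hne' n hn
      simp only [Finset.mem_insert] at hy hx
      have hx' : x = z ∨ x = σ 0 z ∨ (x ∈ Z ∨ x ∈ M) := by tauto
      have hn' := hn.symm hsymm
      rcases hy with rfl | rfl | hy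
      · rcases hx' with rfl | rfl | hx'
        · exact absurd rfl hne
        · exact absurd rfl hne'
        · have := hz1 x hx' n hn'; omega
      · rcases hx' with rfl | rfl | hx'
        · exact absurd (hσ 0 x).1.symm hne'
        · exact absurd rfl hne
        · have := hz2 x hx' n hn'; omega
      · rcases hx' with rfl | rfl | hx'
        · have := hz1 y (Or.inl hy) n hn; omega
        · have := hz2 y (Or.inl hy) n hn; omega
        · exact hfar y hy x hx' hne hne' n hn

end Padding

theorem exists_surgery {d e N₁ L J g : ℕ} {U : Type} [Fintype U] [NeZero L]
    {σ : Fin (d + 1) → U → U} (hσ : σ ∈ matchings (d + 1) U)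
    {π : ZMod L × Fin e → Equiv.Perm (Fin N₁)} (hde : d = e + 1) (hL : 3 ≤ L) (hg : 1 ≤ g)
    (hJ0 : 0 < J) (hJe : Even J) (he : 0 < e) (hN : 0 < N₁)
    (hπ : NoShort (gadget fun c a b => π c a = b) g)
    (h2 : ∀ x, (Finset.univ.filter fun i => BadHalf σ g x i).card ≤ 2)
    (hJ : (Finset.univ.filter fun h : U × Fin (d + 1) => BadHalf σ g h.1 h.2).card ≤ J)
    (hcard : Fintype.card ((GW N₁ L e × Fin e) × Fin J) * (d + 1 + 1) ^ (g + 1) <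
      Fintype.card U) :
    ∃ S : Surgery d e N₁ L J U, S.σ = σ ∧ S.g = g ∧
      S.Z.card ≤ Fintype.card ((GW N₁ L e × Fin e) × Fin J) := by
  have hinv := mem_matchings.1 hσ
  set K := Fintype.card ((GW N₁ L e × Fin e) × Fin J) with hK
  set Bd := Finset.univ.filter fun h : U × Fin (d + 1) => BadHalf σ g h.1 h.2 with hBd
  have hBeven : Even Bd.card := by
    refine even_card_of_involution Bd (fun h => (σ h.2 h.1, h.2)) ?_ ?_ ?_
    · intro h hh
      rw [hBd, Finset.mem_filter] at hh ⊢
      exact ⟨Finset.mem_univ _, hh.2.partner hinv⟩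
    · intro h _ hh
      exact (hinv h.2 h.1).2 (congrArg Prod.fst hh)
    · intro h _
      exact Prod.ext (hinv h.2 h.1).1 rfl
  have w₀ : GW N₁ L e := ((0, ⟨0, he⟩), ⟨0, hN⟩)
  have hKJ : K = Fintype.card (GW N₁ L e × Fin e) * J := by
    rw [hK, Fintype.card_prod, Fintype.card_fin]
  have hpos : 0 < Fintype.card (GW N₁ L e × Fin e) := Fintype.card_pos_iff.2 ⟨(w₀, ⟨0, he⟩)⟩
  have hKge : J ≤ K := by rw [hKJ]; exact Nat.le_mul_of_pos_left _ hpos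
  have hKeven : Even K := by rw [hKJ]; exact hJe.mul_left _
  obtain ⟨k, hk⟩ : Even (K - Bd.card) := Even.tsub hKeven hBeven
  set M : Finset U := Bd.image Prod.fst with hM
  have hMc : M.card ≤ Bd.card := Finset.card_image_le
  obtain ⟨Z, hZc, hZp, hZM, hZfar⟩ := exists_padding (g := g) hinv M k
    (lt_of_le_of_lt (Nat.mul_le_mul_right _ (by omega)) hcard)
  have hMmem : ∀ {x : U} {i : Fin (d + 1)}, BadHalf σ g x i → x ∈ M := fun {x i} h =>
    Finset.mem_image.2 ⟨(x, i), Finset.mem_filter.2 ⟨Finset.mem_univ _, h⟩, rfl⟩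
  have hpad : ∀ z ∈ Z, ∀ i, ¬ BadHalf σ g z i := fun z hz i h => hZM z hz (hMmem h)
  let H := {h : U × Fin (d + 1) // BadHalf σ g h.1 h.2 ∨ (h.2 = 0 ∧ h.1 ∈ Z)}
  have hH : Fintype.card H = K := by
    have h1 : Fintype.card H = (Bd ∪ Z.image fun z => (z, (0 : Fin (d + 1)))).card := by
      rw [Fintype.card_subtype]
      congr 1
      ext ⟨x, i⟩
      simp [hBd, and_comm, eq_comm]
    rw [h1, Finset.card_union_of_disjoint, Finset.card_image_of_injective _
      (fun z z' h => congrArg Prod.fst h)]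
    · omega
    · rw [Finset.disjoint_left]
      rintro ⟨x, i⟩ hx hx'
      simp only [Finset.mem_image, Prod.mk.injEq] at hx'
      obtain ⟨z, hz, rfl, rfl⟩ := hx'
      exact hpad z hz _ (Finset.mem_filter.1 hx).2
  obtain ⟨j⟩ : Nonempty (Bd ↪ Fin J) :=
    Function.Embedding.nonempty_of_card_le (by simpa using hJ)
  let f : H → (GW N₁ L e × Fin e) × Fin J := fun h =>
    ((w₀, ⟨0, he⟩), if hb : h.1 ∈ Bd then j ⟨h.1, hb⟩ else ⟨0, hJ0⟩)
  obtain ⟨s, hs⟩ := Finset.exists_equiv_extend_of_card_eq (t := Finset.univ)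
    (s := Finset.univ.filter fun h : H => h.1 ∈ Bd) (f := f)
    (by rw [hH, Finset.card_univ]) (Finset.subset_univ _) (by
      intro h hh h' hh' e
      have e2 := congrArg Prod.snd e
      rw [Finset.mem_coe, Finset.mem_filter] at hh hh'
      simp only [f, dif_pos hh.2, dif_pos hh'.2] at e2
      have e3 := j.injective e2
      exact Subtype.ext (Subtype.mk.inj e3))
  have hs2 : ∀ h : H, ∀ hb : h.1 ∈ Bd, (s h).1.2 = j ⟨h.1, hb⟩ := by
    intro h hb
    rw [hs h (Finset.mem_filter.2 ⟨Finset.mem_univ _, hb⟩)]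
    simp only [f, dif_pos hb]
  refine ⟨{ σ := σ, π := π, Z := Z, g := g,
            slot := s.trans (Equiv.subtypeUnivEquiv fun _ => Finset.mem_univ _)
            ε := Fintype.equivOfCardEq (by simp; omega)
            invol := hinv, three_le := hL, one_le := hg, girth_gadget := hπ, bad_le_two := ?_
            copy_inj := ?_, partner_mem := hZp, pad_not_bad := hpad, pad_far := ?_ },
          rfl, rfl, ?_⟩
  · intro x
    convert h2 x
  · intro h h' hb hb' e
    have hb1 : h.1 ∈ Bd := Finset.mem_filter.2 ⟨Finset.mem_univ _, hb⟩
    have hb2 : h'.1 ∈ Bd := Finset.mem_filter.2 ⟨Finset.mem_univ _, hb'⟩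
    have e1 : (s h).1.2 = (s h').1.2 := e
    rw [hs2 h hb1, hs2 h' hb2] at e1
    exact Subtype.ext (Subtype.mk.inj (j.injective e1))
  · intro z hz x hx
    exact hZfar z hz x (hx.imp id fun ⟨i, hi⟩ => hMmem hi)
  · simp only
    omega

lemma monomial_le_monomial {y a : ℝ} (hy : 1 ≤ y) (ha : 1 ≤ a) {i j k l : ℕ} (hik : i ≤ k)
    (hjl : j ≤ l) : y ^ i * a ^ j ≤ y ^ k * a ^ l :=
  mul_le_mul (pow_le_pow_right₀ hy hik) (pow_le_pow_right₀ ha hjl) (by positivity) (by positivity)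

set_option maxHeartbeats 1000000 in
/-- The construction for explicit parameters: `y` dominates every quantity of subpolynomial size,
and `a ^ 2` the growth of the balls. -/
theorem exists_graph_of_parameters {d A g R : ℕ} {y a : ℝ} {U : Type} [Fintype U] (hd : 100 ≤ d)
    (hU : Fintype.card U = 2 * A) (hne : (matchings (d + 1) U).Nonempty)
    (hram : 4 * ((matchings (d + 1) U).filter fun σ => ¬NearlyRamanujan σ).card ≤
      (matchings (d + 1) U).card)
    (ha : 1 ≤ a) (hA : (2 * A : ℝ) = (y ^ 20 * a ^ 2) ^ 3) (hyd : (d : ℝ) + 2 ≤ y)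
    (hyg : 2 * (g : ℝ) + 3 ≤ y) (hyR : ((d : ℝ) + 2) ^ R ≤ y)
    (hball : (2 * (d : ℝ) - 1) ^ g ≤ y * a ^ 2) (hR0 : 0 < R) (hR : 2 * R + 2 ≤ g) :
    ∃ m : ℕ, 2 * A ≤ m ∧ m ≤ 4 * A ∧ ∃ G : SimpleGraph (Fin m), IsRegular G (d + 1) ∧
      (∀ x : ℝ, x ≤ g → girthGe G x) ∧
      (∀ (r : ℕ) (ε bound : ℝ), r ≤ g → ε ≤ 1 →
        10 * (1 + √(d + 1)) ^ (g + 2) * (2 * g + 3) ≤ bound → LocalizedSpectrum G r ε bound) ∧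
      secondLargestAbsEig G ≤
        2 * √d + 5 + (d + 1) * ((Real.pi / (2 * R)) ^ 2 / 2) + 3 / 10 := by
  have hdR : (100 : ℝ) ≤ d := by exact_mod_cast hd
  have hy : (100 : ℝ) ≤ y := by linarith
  have hy1 : (1 : ℝ) ≤ y := by linarith
  have hy0 : (0 : ℝ) < y := by linarith
  have ha0 : (0 : ℝ) < a := by linarith
  set q := y ^ 20 * a ^ 2 with hq
  have hq1 : 1 ≤ q := by
    simpa using monomial_le_monomial hy1 ha (i := 0) (j := 0) (k := 20) (l := 2)
      (by norm_num) (by norm_num)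
  set lam : ℝ := 1 + √(d + 1) with hlam
  have hs : √((d : ℝ) + 1) ^ 2 = d + 1 := Real.sq_sqrt (by positivity)
  have hs10 : 10 ≤ √((d : ℝ) + 1) := Real.le_sqrt_of_sq_le (by linarith)
  have hlam3 : 3 ≤ lam := by linarith
  have hlamd : lam ≤ y := by nlinarith
  have hlamD : lam ^ 2 ≤ 2 * d - 1 := by nlinarith
  have hX : lam ^ g ≤ y * a := by
    refine le_of_sq_le_sq ?_ (by positivity)
    calc (lam ^ g) ^ 2 = (lam ^ 2) ^ g := by rw [← pow_mul, ← pow_mul, mul_comm]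
      _ ≤ (2 * (d : ℝ) - 1) ^ g := pow_le_pow_left₀ (by positivity) hlamD _
      _ ≤ y * a ^ 2 := hball
      _ ≤ (y * a) ^ 2 := by
          nlinarith [mul_nonneg (sub_nonneg.2 hy1) (mul_pos hy0 (pow_pos ha0 2)).le]
  obtain ⟨e, rfl⟩ : ∃ e, d = e + 1 := ⟨d - 1, by omega⟩
  push_cast at *
  set d : ℝ := (e : ℝ) + 1 with hd'
  set N₁ := ⌊4 * lam ^ (g + 2)⌋₊ + 1 with hN₁
  have hpow1 : 1 ≤ lam ^ (g + 2) := one_le_pow₀ (by linarith)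
  have hN₁l : 4 * lam ^ (g + 2) < N₁ := by
    rw [hN₁]; push_cast; exact Nat.lt_floor_add_one _
  have hN₁u' : (N₁ : ℝ) ≤ 5 * lam ^ (g + 2) := by
    rw [hN₁]; push_cast
    linarith [Nat.floor_le (show 0 ≤ 4 * lam ^ (g + 2) by positivity)]
  have hN₁u : (N₁ : ℝ) ≤ y ^ 4 * a := by
    calc (N₁ : ℝ) ≤ 5 * (lam ^ g * lam ^ 2) := by rwa [← pow_add]
      _ ≤ y * ((y * a) * y ^ 2) := by gcongr; linarith
      _ = y ^ 4 * a := by ring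
  set J := 2 * ⌈q⌉₊ with hJ
  have hJl : q ≤ J := by
    rw [hJ]; push_cast
    linarith [Nat.le_ceil q]
  have hJu : (J : ℝ) ≤ y * q := by
    rw [hJ]; push_cast
    linarith [Nat.ceil_lt_add_one (show 0 ≤ q by linarith),
      mul_le_mul_of_nonneg_right hy (show 0 ≤ q by linarith)]
  have hJ0 : (0 : ℝ) < J := by linarith
  have hA0' : (0 : ℝ) < A := by
    have : 0 < q ^ 3 := by positivity
    linarith
  have hA0 : 0 < A := by exact_mod_cast hA0'
  have hg1 : 1 ≤ g := by omega
  have hball1 : (d + 1) ^ g ≤ y * a ^ 2 :=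
    (pow_le_pow_left₀ (by positivity) (by linarith) _).trans hball
  have hball2 : (d + 2) ^ g ≤ y * a ^ 2 :=
    (pow_le_pow_left₀ (by positivity) (by linarith) _).trans hball
  have hd1 : d + 1 ≤ y := by linarith
  have hq3 : q ^ 3 = y ^ 60 * a ^ 6 := by rw [hq]; ring
  have hUA : (Fintype.card U : ℝ) = 2 * A := by rw [hU]; push_cast; rfl
  obtain ⟨σ, hσ, hσr, hσ2, hσJ⟩ := exists_good_matchings (U := U) (d := e + 1) (A := A) (g := g)
    (J := J) hJ0 hA0 hne (by
      have : (2 * (2 * ((g : ℝ) + 1)) + 1 + A) ≤ 2 * A := by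
        have h1 := monomial_le_monomial hy1 ha (i := 2) (j := 0) (k := 60) (l := 6)
          (by norm_num) (by norm_num)
        rw [pow_zero, mul_one, sq, ← hq3] at h1
        linarith [mul_le_mul_of_nonneg_right hy hy0.le]
      rw [hU]
      exact_mod_cast this) hram (by
      have hch : (((2 * (g + 1)).choose 2 : ℕ) : ℝ) ≤ y ^ 2 := by
        have : (2 * (g + 1)).choose 2 ≤ (2 * (g + 1)) ^ 2 := Nat.choose_le_pow _ _
        have h2 : (((2 * (g + 1)).choose 2 : ℕ) : ℝ) ≤ (2 * (g + 1)) ^ 2 := by exact_mod_cast this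
        refine h2.trans (pow_le_pow_left₀ (by positivity) (by linarith) _)
      have hpw : (d + 1) ^ (2 * (g + 1)) ≤ (y * a ^ 2) ^ 2 * y ^ 2 := by
        calc (d + 1) ^ (2 * (g + 1)) = ((d + 1) ^ g) ^ 2 * (d + 1) ^ 2 := by
              rw [mul_comm 2, pow_mul, pow_succ (d + 1) g, mul_pow]
          _ ≤ _ := by gcongr
      rw [hUA]
      push_cast
      calc 2 * (A : ℝ) * ((d + 1) ^ (2 * (g + 1)) * ((((2 * (g + 1)).choose 2 : ℕ) : ℝ) *
            ((2 * ((g : ℝ) + 1) + 1) / A) ^ 2))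
          ≤ 2 * A * ((y * a ^ 2) ^ 2 * y ^ 2 * (y ^ 2 * (y / A) ^ 2)) := by
            gcongr; linarith
        _ = 4 * (y ^ 8 * a ^ 4) / (2 * A) := by field_simp; ring
        _ ≤ 1 / 4 := by
          rw [hA, div_le_iff₀ (by positivity), hq3]
          have h1 := monomial_le_monomial hy1 ha (i := 9) (j := 4) (k := 60) (l := 6)
            (by norm_num) (by norm_num)
          have h2 : 100 * (y ^ 8 * a ^ 4) ≤ y ^ 9 * a ^ 4 := by
            rw [show y ^ 9 * a ^ 4 = y * (y ^ 8 * a ^ 4) by ring]; gcongr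
          have h3 : 0 < y ^ 8 * a ^ 4 := by positivity
          linarith) (by
      rw [hUA]
      push_cast
      calc 2 * (A : ℝ) * (d + 1) * ((d + 1) ^ (g + 1) * (((g : ℝ) + 1) * (((g : ℝ) + 1 + 1) / A)))
          ≤ 2 * A * y * ((y * a ^ 2 * y) * (y * (y / A))) := by
            rw [pow_succ]
            gcongr <;> linarith
        _ = 2 * (y ^ 5 * a ^ 2) := by field_simp
        _ ≤ J / 4 := by
          have h1 := monomial_le_monomial hy1 ha (i := 6) (j := 2) (k := 20) (l := 2)
            (by norm_num) (by norm_num)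
          have h2 : 100 * (y ^ 5 * a ^ 2) ≤ y ^ 6 * a ^ 2 := by
            rw [show y ^ 6 * a ^ 2 = y * (y ^ 5 * a ^ 2) by ring]; gcongr
          have h3 : 0 < y ^ 5 * a ^ 2 := by positivity
          linarith)
  set L := 2 * g + 3 with hL
  have : NeZero L := ⟨by omega⟩
  have hLy : (L : ℝ) ≤ y := by rw [hL]; push_cast; exact hyg
  have hey : (e : ℝ) ≤ y := by linarith
  obtain ⟨π, hπ⟩ := exists_gadget (N₁ := N₁) (L := L) (e := e) (g := g) (by omega) hlam3
    (by rw [hlam, add_sq, hs]; linarith) hN₁l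
  have hN₁0 : 0 < N₁ := Nat.succ_pos _
  have hK : (Fintype.card ((GW N₁ L e × Fin e) × Fin J) : ℝ) ≤ y ^ 8 * a * q := by
    simp only [Fintype.card_prod, Fintype.card_fin, ZMod.card]
    push_cast
    calc (L : ℝ) * e * N₁ * e * J ≤ y * y * (y ^ 4 * a) * y * (y * q) := by gcongr
      _ = _ := by ring
  have hT : (Fintype.card ((GS N₁ L ⊕ GW N₁ L e) × Fin J) : ℝ) ≤ y ^ 8 * a * q := by
    simp only [Fintype.card_prod, Fintype.card_fin, ZMod.card, Fintype.card_sum, Fintype.card_bool]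
    push_cast
    calc (2 * ((N₁ : ℝ) * L) + L * e * N₁) * J
        ≤ (2 * ((y ^ 4 * a) * y) + y * y * (y ^ 4 * a)) * (y * q) := by gcongr
      _ = (2 + y) * (y ^ 6 * a * q) := by ring
      _ ≤ y ^ 2 * (y ^ 6 * a * q) := by
          gcongr
          rw [sq]
          linarith [mul_le_mul_of_nonneg_right hy hy0.le]
      _ = _ := by ring
  have hstep : y * (y ^ 10 * a ^ 3 * q) ≤ q ^ 3 := by
    have := monomial_le_monomial hy1 ha (i := 31) (j := 5) (k := 60) (l := 6)
            (by norm_num) (by norm_num)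
    calc y * (y ^ 10 * a ^ 3 * q) = y ^ 31 * a ^ 5 := by rw [hq]; ring
      _ ≤ _ := this
      _ = _ := hq3.symm
  have hpos : 0 < y ^ 10 * a ^ 3 * q := by positivity
  have hstep' : 100 * (y ^ 10 * a ^ 3 * q) ≤ q ^ 3 :=
    (mul_le_mul_of_nonneg_right hy hpos.le).trans hstep
  have hcmp : y ^ 8 * a * q ≤ y ^ 10 * a ^ 3 * q := by
    have := monomial_le_monomial hy1 ha (i := 8) (j := 1) (k := 10) (l := 3)
            (by norm_num) (by norm_num)
    rw [pow_one] at this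
    gcongr
  obtain ⟨S, rfl, hSg, hSZ⟩ := exists_surgery (d := e + 1) (J := J) hσ rfl (by omega) hg1
    (by exact_mod_cast hJ0) (even_two_mul _) (by omega) hN₁0 hπ hσ2 (by exact_mod_cast hσJ) (by
      have : (Fintype.card ((GW N₁ L e × Fin e) × Fin J) : ℝ) * (d + 2) ^ (g + 1) <
          Fintype.card U := by
        calc (Fintype.card ((GW N₁ L e × Fin e) × Fin J) : ℝ) * (d + 2) ^ (g + 1)
            ≤ y ^ 8 * a * q * ((y * a ^ 2) * y) := by
              rw [pow_succ]; gcongr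
          _ = y ^ 10 * a ^ 3 * q := by ring
          _ < Fintype.card U := by rw [hUA, hA]; linarith
      have h2 : (((e + 1 + 1 + 1 : ℕ)) : ℝ) = d + 2 := by push_cast; rw [hd']; ring
      rw [← h2] at this
      exact_mod_cast this)
  have hTA : Fintype.card ((GS N₁ L ⊕ GW N₁ L e) × Fin J) ≤ 2 * A := by
    have : (Fintype.card ((GS N₁ L ⊕ GW N₁ L e) × Fin J) : ℝ) ≤ 2 * A := by linarith
    exact_mod_cast this
  obtain ⟨G, hGr, hGg, hGl, hGs⟩ := S.exists_graph (by omega) (by exact_mod_cast hJ0) hN₁0 hR0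
    (by omega) hσr rfl
  refine ⟨_, ?_, ?_, G, hGr, fun x hx => hGg x (by rwa [hSg]), fun r ε bound hr hε hb =>
    hGl r ε bound (by omega) hε (le_trans ?_ hb), hGs.trans ?_⟩
  · rw [Fintype.card_sum]; omega
  · rw [Fintype.card_sum]; omega
  · rw [hL]; push_cast
    linarith [mul_le_mul_of_nonneg_right hN₁u' (show (0 : ℝ) ≤ 2 * g + 3 by positivity)]
  · push_cast
    have hZ : (S.Z.card : ℝ) ≤ y ^ 8 * a * q := le_trans (by exact_mod_cast hSZ) hK
    have : (d + 1) / Fintype.card U * ((Fintype.card ((GS N₁ L ⊕ GW N₁ L e) × Fin J) : ℝ) +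
        S.Z.card * (d + 1 + 1) ^ R) ≤ 3 / 10 := by
      rw [div_mul_eq_mul_div, hUA, hA, div_le_iff₀ (by positivity)]
      have h2 : (d + 1 + 1) ^ R ≤ y := by rwa [add_assoc, one_add_one_eq_two]
      calc (d + 1) * ((Fintype.card ((GS N₁ L ⊕ GW N₁ L e) × Fin J) : ℝ) +
            S.Z.card * (d + 1 + 1) ^ R) ≤ y * (y ^ 8 * a * q + y ^ 8 * a * q * y) := by gcongr
        _ = (1 + y) * (y ^ 9 * a * q) := by ring
        _ ≤ (2 * y) * (y ^ 9 * a * q) := by gcongr; linarith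
        _ = 2 * (y ^ 10 * a * q) := by ring
        _ ≤ 2 * (y ^ 10 * a ^ 3 * q) := by gcongr; exact le_self_pow₀ ha (by norm_num)
        _ ≤ 3 / 10 * q ^ 3 := by linarith
    rw [← hd']
    linarith

lemma sqrt_slack {d p t : ℕ} (htp : t < p) (htd : t ≤ d)
    (hgap : (p : ℝ) - t < (5 / (2 * √6) - 1) * √t) :
    100 ≤ d ∧ 2 * √d + 5 + 1 / 2 + 3 / 10 ≤ 3 / √2 * √d := by
  have h1 : (1 : ℝ) ≤ (p : ℝ) - t := by
    have : (t : ℝ) + 1 ≤ p := by exact_mod_cast htp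
    linarith
  have h6 : (24494 / 10000 : ℝ) ≤ √6 := Real.le_sqrt_of_sq_le (by norm_num)
  have h6' : 5 / (2 * √6) - 1 ≤ 1 / 48 := by
    rw [sub_le_iff_le_add, div_le_iff₀ (by positivity)]
    linarith
  have ht : 48 ≤ √(t : ℝ) := by
    have := mul_le_mul_of_nonneg_right h6' (Real.sqrt_nonneg (t : ℝ))
    linarith
  have hd : 48 ≤ √(d : ℝ) := ht.trans (Real.sqrt_le_sqrt (by exact_mod_cast htd))
  refine ⟨?_, ?_⟩
  · have : (48 : ℝ) ^ 2 ≤ d := (Real.le_sqrt' (by norm_num)).1 hd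
    have h2 : (100 : ℝ) ≤ d := by linarith
    exact_mod_cast h2
  · have h2 : √2 ≤ (141422 / 100000 : ℝ) := Real.sqrt_le_iff.2 ⟨by norm_num, by norm_num⟩
    have h3 : (2 + 121 / 1000 : ℝ) ≤ 3 / √2 := by
      rw [le_div_iff₀ (by positivity)]
      linarith
    have := mul_le_mul_of_nonneg_right h3 (Real.sqrt_nonneg (d : ℝ))
    linarith

lemma exists_pi_div_sq_le (d : ℕ) : ∃ R : ℕ, 0 < R ∧
    ((d : ℝ) + 1) * ((Real.pi / (2 * R)) ^ 2 / 2) ≤ 1 / 2 := by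
  refine ⟨2 * (d + 1), by positivity, ?_⟩
  have hp : Real.pi ≤ 4 := Real.pi_le_four
  have h : Real.pi / (2 * ((2 * (d + 1) : ℕ) : ℝ)) ≤ 1 / (d + 1) := by
    push_cast
    rw [div_le_div_iff₀ (by positivity) (by positivity)]
    nlinarith
  have h0 : 0 ≤ Real.pi / (2 * ((2 * (d + 1) : ℕ) : ℝ)) := by positivity
  have h1 := pow_le_pow_left₀ h0 h 2
  calc ((d : ℝ) + 1) * ((Real.pi / (2 * ((2 * (d + 1) : ℕ) : ℝ))) ^ 2 / 2)
      ≤ ((d : ℝ) + 1) * ((1 / (d + 1)) ^ 2 / 2) := by gcongr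
    _ = 1 / ((d : ℝ) + 1) / 2 := by field_simp
    _ ≤ 1 / 2 := by
      gcongr
      rw [div_le_one (by positivity)]
      linarith [show (0 : ℝ) ≤ d from by positivity]

lemma exists_sq_mul_pow_le {κ : ℝ} (h0 : 0 < κ) (h1 : κ < 1) :
    ∃ C : ℝ, 0 < C ∧ ∀ n : ℕ, (2 * (n : ℝ) + 3) ^ 2 * κ ^ n ≤ C := by
  have ht := (tendsto_pow_const_mul_const_pow_of_abs_lt_one 2
    (show |κ| < 1 by rwa [abs_of_pos h0])).bddAbove_range
  obtain ⟨B, hB⟩ := ht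
  have hB' : ∀ n : ℕ, (n : ℝ) ^ 2 * κ ^ n ≤ B := fun n => hB ⟨n, rfl⟩
  have hB0 : 0 ≤ B := by simpa using hB' 0
  refine ⟨9 * B / κ + 1, by positivity, fun n => ?_⟩
  have := hB' (n + 1)
  push_cast at this
  have h3 : (2 * (n : ℝ) + 3) ^ 2 * κ ^ n ≤ 9 * B / κ := by
    rw [le_div_iff₀ h0]
    calc (2 * (n : ℝ) + 3) ^ 2 * κ ^ n * κ ≤ (3 * ((n : ℝ) + 1)) ^ 2 * κ ^ n * κ := by
          gcongr; linarith
      _ = 9 * (((n : ℝ) + 1) ^ 2 * κ ^ (n + 1)) := by ring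
      _ ≤ 9 * B := by linarith
  linarith

/-- The size of the gadget, compared with the ball growth `(2 d - 1) ^ g`. -/
lemma exists_gadget_size_le {d : ℕ} (hd : 100 ≤ d) : ∃ C : ℝ, 0 < C ∧ ∀ (g : ℕ) (a : ℝ), 0 ≤ a →
    (2 * (d : ℝ) - 1) ^ g ≤ 2 * (2 * d - 1) * a ^ 2 →
    10 * (1 + √(d + 1)) ^ (g + 2) * (2 * g + 3) ≤ C * a := by
  have hdR : (100 : ℝ) ≤ d := by exact_mod_cast hd
  set lam : ℝ := 1 + √(d + 1) with hlam
  have hs : √((d : ℝ) + 1) ^ 2 = d + 1 := Real.sq_sqrt (by positivity)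
  have hs10 : 10 ≤ √((d : ℝ) + 1) := Real.le_sqrt_of_sq_le (by linarith)
  have hlam0 : 0 < lam := by positivity
  have hD : (0 : ℝ) < 2 * d - 1 := by linarith
  have hlamD : lam ^ 2 < 2 * d - 1 := by nlinarith
  obtain ⟨B, hB0, hB⟩ := exists_sq_mul_pow_le (κ := lam ^ 2 / (2 * d - 1)) (by positivity)
    ((div_lt_one hD).2 hlamD)
  refine ⟨10 * lam ^ 2 * √(B * (2 * (2 * d - 1))), by positivity, fun g a ha hg => ?_⟩
  have key : lam ^ g * (2 * g + 3) ≤ √(B * (2 * (2 * d - 1))) * a := by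
    refine le_of_sq_le_sq ?_ (by positivity)
    rw [mul_pow _ a, Real.sq_sqrt (by positivity)]
    have h := hB g
    rw [div_pow, mul_div_assoc', div_le_iff₀ (by positivity)] at h
    calc (lam ^ g * (2 * (g : ℝ) + 3)) ^ 2 = (2 * (g : ℝ) + 3) ^ 2 * (lam ^ 2) ^ g := by
          rw [mul_pow, ← pow_mul, ← pow_mul, mul_comm g, mul_comm]
      _ ≤ B * (2 * d - 1) ^ g := h
      _ ≤ B * (2 * (2 * d - 1) * a ^ 2) := by gcongr
      _ = _ := by ring
  calc 10 * lam ^ (g + 2) * (2 * g + 3) = 10 * lam ^ 2 * (lam ^ g * (2 * g + 3)) := by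
        rw [pow_add]; ring
    _ ≤ 10 * lam ^ 2 * (√(B * (2 * (2 * d - 1))) * a) := by gcongr
    _ = _ := by ring

lemma eventually_parameters {δ c : ℝ} (hδ : 0 < δ) (hc : 0 < c) (K : ℝ) (R : ℕ) :
    ∀ᶠ b : ℕ in Filter.atTop, K ≤ ((2 : ℝ) ^ b) ^ δ ∧ 2 * (b : ℝ) + 7 ≤ ((2 : ℝ) ^ b) ^ δ ∧
      (R : ℝ) ≤ c * b := by
  have h1 : (1 : ℝ) < 2 ^ δ := Real.one_lt_rpow (by norm_num) hδ
  have hpow : ∀ b : ℕ, ((2 : ℝ) ^ b) ^ δ = ((2 : ℝ) ^ δ) ^ b := fun b => by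
    rw [← Real.rpow_natCast, ← Real.rpow_natCast, ← Real.rpow_mul (by norm_num),
      ← Real.rpow_mul (by norm_num), mul_comm]
  have ht : Filter.Tendsto (fun b : ℕ => ((2 : ℝ) ^ δ) ^ b) Filter.atTop Filter.atTop :=
    tendsto_pow_atTop_atTop_of_one_lt h1
  have hl : Filter.Tendsto (fun b : ℕ => (b : ℝ) ^ 1 / ((2 : ℝ) ^ δ) ^ b) Filter.atTop (nhds 0) :=
    tendsto_pow_const_div_const_pow_of_one_lt 1 h1
  have hR : Filter.Tendsto (fun b : ℕ => c * (b : ℝ)) Filter.atTop Filter.atTop :=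
    tendsto_natCast_atTop_atTop.const_mul_atTop hc
  filter_upwards [ht.eventually_ge_atTop K, ht.eventually_ge_atTop 14,
    hl.eventually_lt_const (show (0 : ℝ) < 1 / 4 by norm_num), hR.eventually_ge_atTop (R : ℝ)]
    with b hK h14 hb hRb
  rw [hpow]
  refine ⟨hK, ?_, hRb⟩
  rw [div_lt_iff₀ (by positivity)] at hb
  linarith

lemma girth_parameter {D α : ℝ} (hD : 2 ≤ D) (h0 : 0 < α) (h1 : 2 * α ≤ 1) (b : ℕ) :
    ∃ g : ℕ, 2 * α * Real.logb D (2 * 2 ^ b) ≤ g ∧ (g : ℝ) ≤ b + 2 ∧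
      2 * α * Real.logb D 2 * b ≤ g ∧ D ^ g ≤ 2 * D * (((2 : ℝ) ^ b) ^ α) ^ 2 := by
  have hD0 : 0 < D := by linarith
  have hD1 : 1 < D := by linarith
  have hx : (0 : ℝ) < 2 ^ b := by positivity
  have hl0 : 0 < Real.logb D 2 := Real.logb_pos hD1 (by norm_num)
  have hl1 : Real.logb D 2 ≤ 1 := by
    rw [Real.logb_le_iff_le_rpow hD1 (by norm_num), Real.rpow_one]
    exact hD
  have hlog : Real.logb D (2 * 2 ^ b) = (b + 1) * Real.logb D 2 := by
    rw [← pow_succ', Real.logb_pow]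
    push_cast
    rfl
  have hlogb : (b + 1) * Real.logb D 2 ≤ b + 1 := mul_le_of_le_one_right (by positivity) hl1
  have hnn : 0 ≤ 2 * α * Real.logb D (2 * 2 ^ b) := by rw [hlog]; positivity
  have hceil := Nat.ceil_lt_add_one hnn
  have hle := Nat.le_ceil (2 * α * Real.logb D (2 * 2 ^ b))
  refine ⟨⌈2 * α * Real.logb D (2 * 2 ^ b)⌉₊, hle, ?_, ?_, ?_⟩
  · have : 2 * α * Real.logb D (2 * 2 ^ b) ≤ 1 * (b + 1) := by
      rw [hlog]
      gcongr
    linarith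
  · refine le_trans ?_ hle
    rw [hlog]
    have : 0 < 2 * α * Real.logb D 2 := by positivity
    linarith
  · calc D ^ ⌈2 * α * Real.logb D (2 * 2 ^ b)⌉₊
        = D ^ ((⌈2 * α * Real.logb D (2 * 2 ^ b)⌉₊ : ℕ) : ℝ) := (Real.rpow_natCast _ _).symm
      _ ≤ D ^ (Real.logb D (2 * 2 ^ b) * (2 * α) + 1) :=
        Real.rpow_le_rpow_of_exponent_le hD1.le (by linarith)
      _ = (2 * 2 ^ b) ^ (2 * α) * D := by
        rw [Real.rpow_add hD0, Real.rpow_one, Real.rpow_mul hD0.le,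
          Real.rpow_logb hD0 hD1.ne' (by positivity)]
      _ = 2 ^ (2 * α) * (((2 : ℝ) ^ b) ^ α) ^ 2 * D := by
        rw [Real.mul_rpow (by norm_num) hx.le, mul_comm 2 α, Real.rpow_mul hx.le, Real.rpow_two]
      _ ≤ 2 ^ (1 : ℝ) * (((2 : ℝ) ^ b) ^ α) ^ 2 * D := by
        gcongr
        norm_num
      _ = 2 * D * (((2 : ℝ) ^ b) ^ α) ^ 2 := by rw [Real.rpow_one]; ring

lemma logb_le_two_mul_logb {d x : ℝ} (hd : 2 ≤ d) (hx : 1 ≤ x) :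
    Real.logb d x ≤ 2 * Real.logb (2 * d - 1) x := by
  have hlogd : 0 < Real.log d := Real.log_pos (by linarith)
  have hlogD : 0 < Real.log (2 * d - 1) := Real.log_pos (by linarith)
  have hDd : Real.log (2 * d - 1) ≤ 2 * Real.log d := by
    rw [show 2 * Real.log d = Real.log (d ^ 2) by rw [Real.log_pow]; norm_num]
    exact Real.log_le_log (by linarith) (by nlinarith)
  rw [Real.logb, Real.logb, ← mul_div_assoc, div_le_div_iff₀ hlogd hlogD]
  linarith [mul_le_mul_of_nonneg_left hDd (Real.log_nonneg hx)]

/-- Theorem 1.4, which moreover bounds the second largest eigenvalue. -/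
theorem stmt_3 (d : ℕ) (hd : 2 ≤ d)
    (α : ℝ) (hα : α ∈ Set.Ioo (0 : ℝ) (1 / 6))
    (p t : ℕ) (hp : Nat.Prime p) (hpodd : Odd p) (ht : 0 < t) (htp : t < p)
    (htd : t ≤ d) (hdp : d ≤ p)
    (hgap : (p : ℝ) - t < (5 / (2 * Real.sqrt 6) - 1) * Real.sqrt t)
    (hratio : Real.log t / Real.log p > 6 * α)
    (ε : ℝ) (hε : ε ∈ Set.Ioo (0 : ℝ) 1) :
    ∃ C : ℝ, 0 < C ∧
      {m : ℕ | 0 < m ∧ ∃ G : SimpleGraph (Fin m),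
        IsRegular G (d + 1) ∧
        girthGe G (2 * α * Real.logb (2 * (d : ℝ) - 1) m) ∧
        LocalizedSpectrum G ⌊α * Real.logb d m⌋₊ ε (C * (m : ℝ) ^ α) ∧
        secondLargestAbsEig G ≤ (3 / Real.sqrt 2) * Real.sqrt d}.Infinite := by
  obtain ⟨hα0, hα6⟩ := hα
  obtain ⟨hd100, hslack⟩ := sqrt_slack htp htd hgap
  obtain ⟨R, hR0, hR⟩ := exists_pi_div_sq_le d
  obtain ⟨b₀, hb₀⟩ := card_not_nearlyRamanujan_le (d := d) (by omega)
  obtain ⟨C, hC, hsize⟩ := exists_gadget_size_le hd100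
  have hdR : (100 : ℝ) ≤ d := by exact_mod_cast hd100
  set D : ℝ := 2 * d - 1 with hD
  have hD2 : 2 ≤ D := by linarith
  have hD1 : 1 < D := by linarith
  set δ : ℝ := (1 / 3 - 2 * α) / 20 with hδ
  have hδ0 : 0 < δ := by rw [hδ]; linarith
  refine ⟨C, hC, Set.infinite_of_forall_exists_gt fun n => ?_⟩
  obtain ⟨b, ⟨hK, hb7, hRb⟩, hbn⟩ := ((eventually_parameters hδ0
    (show 0 < 2 * α * Real.logb D 2 by
      have := Real.logb_pos hD1 (show (1 : ℝ) < 2 by norm_num)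
      positivity) ((d + 2) + (d + 2) ^ R + 2 * D) (2 * R + 2)).and
    (Filter.eventually_ge_atTop (b₀ + n + 1))).exists
  obtain ⟨g, hgl, hgu, hgc, hball⟩ := girth_parameter hD2 hα0 (by linarith) b
  set x : ℝ := 2 ^ b with hx
  have hx1 : 1 ≤ x := one_le_pow₀ (by norm_num)
  have hx0 : 0 < x := by linarith
  obtain ⟨k, rfl⟩ : ∃ k, b = k + 1 := ⟨b - 1, by omega⟩
  have hU : Fintype.card (Fin (2 ^ k) × Bool) = 2 * 2 ^ k := by simp [mul_comm]
  have hpR : (0 : ℝ) ≤ (d + 2) ^ R := by positivity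
  obtain ⟨m, hml, hmu, G, hGr, hGg, hGl, hGs⟩ := exists_graph_of_parameters (d := d) (A := 2 ^ k)
    (g := g) (R := R) (y := x ^ δ) (a := x ^ α) hd100 hU (matchings_nonempty _ _)
    (hb₀ (k + 1) (by omega) _ (by rw [hU, pow_succ'])) (Real.one_le_rpow hx1 hα0.le) (by
      push_cast
      rw [← pow_succ', ← hx, ← Real.rpow_natCast, ← Real.rpow_natCast, ← Real.rpow_natCast,
        ← Real.rpow_mul hx0.le, ← Real.rpow_mul hx0.le, ← Real.rpow_add hx0,
        ← Real.rpow_mul hx0.le]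
      have : (δ * (20 : ℕ) + α * (2 : ℕ)) * (3 : ℕ) = 1 := by rw [hδ]; push_cast; ring
      rw [this, Real.rpow_one])
    (by linarith) (by linarith) (by linarith)
    (hball.trans (mul_le_mul_of_nonneg_right (by linarith) (by positivity))) hR0
    (by exact_mod_cast hRb.trans hgc)
  have hxm : x ≤ m := by
    rw [hx, pow_succ']
    exact_mod_cast hml
  have hmx : (m : ℝ) ≤ 2 * x := by
    rw [hx, pow_succ', ← mul_assoc]
    have : (m : ℝ) ≤ ((4 * 2 ^ k : ℕ) : ℝ) := by exact_mod_cast hmu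
    push_cast at this
    linarith
  have hm0 : (0 : ℝ) < m := by linarith
  have hlogm : 2 * α * Real.logb D m ≤ g :=
    le_trans (mul_le_mul_of_nonneg_left (Real.logb_le_logb_of_le hD1 hm0 hmx) (by positivity)) hgl
  refine ⟨m, ⟨by exact_mod_cast hm0, G, hGr, hGg _ hlogm, hGl _ _ _ ?_ hε.2.le ?_, ?_⟩, ?_⟩
  · have hcmp := mul_le_mul_of_nonneg_left (logb_le_two_mul_logb (d := d) (x := m)
      (by linarith) (by linarith)) hα0.le
    have : α * Real.logb d m ≤ g := by
      rw [← hD] at hcmp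
      linarith
    exact Nat.floor_le_of_le this
  · refine (hsize g (x ^ α) (by positivity) hball).trans ?_
    exact mul_le_mul_of_nonneg_left (Real.rpow_le_rpow hx0.le hxm hα0.le) hC.le
  · linarith
  · have h1 : n < 2 ^ n := Nat.lt_two_pow_self
    have h2 : 2 ^ n ≤ 2 ^ k := Nat.pow_le_pow_right (by norm_num) (by omega)
    exact h1.trans_le (h2.trans ((Nat.le_mul_of_pos_left _ two_pos).trans hml))

end Formal
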